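/- arXiv:math/0608747 — 2 statements merged into one kernel-verified Lean document; each statement's English description precedes it below -/
import Mathlib

section
/- (Decomposition formula, short version.) Let K be an infinite field, let (T,(X_1,…,X_s)) be a tableau with substitution of dimension n = (n_1,…,n_m) ∈ ℕ^m with matrices over a commutative unital K-algebra, let 1 ≤ q_1 < q_2 ≤ m with n_{q_1} = n_{q_2}, and let d ∈ ℕ^{m−2} be obtained from n by deleting the q_1-th and q_2-th coordinates. Then bpf_T(X_1,…,X_s) is a polynomial, with coefficients in the image of ℤ in K under the natural homomorphism, in the elements bpf_D(Y_1,…,Y_l) and σ_k(h), where (D,(Y_1,…,Y_l)) ranges over tableaux with substitutions of dimension d such that Y_1,…,Y_l are products of the matrices X_1,…,X_s, X_1^t,…,X_s^t; h ranges over products of the matrices X_1,…,X_s, X_1^t,…,X_s^t; and k ranges over 1,…,n_{q_1}. -/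
open scoped BigOperators

attribute [local instance] Classical.propDecidable

/-- The cells of a shape of dimension `n : ι → ℕ`: the column `i` has `n i` cells. -/
abbrev TabCell {ι : Type} (n : ι → ℕ) : Type := Σ i : ι, Fin (n i)

/-- A tableau with substitution `(T,(X_1,…,X_s))` of dimension `n : ι → ℕ` with entries
in `A`.  Cells are paired by the involution `mate` (each pair of cells is an arrow going
from the tail cell, where `isTail` holds, to the head cell); `lab` assigns to every
arrow (encoded via either of its two cells) its index `φ ∈ {1,…,s}`; `X j` is the matrix
assigned to the arrows with label `j`, which is an `n_{a''} × n_{a'}` matrix where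
`colTail j = a''` and `colHead j = a'` are the tail and head columns of those arrows. -/
structure TabSub (A : Type) [CommRing A] (ι : Type) [Fintype ι] [DecidableEq ι]
    (n : ι → ℕ) (s : ℕ) where
  mate : Equiv.Perm (TabCell n)
  isTail : TabCell n → Bool
  lab : TabCell n → Fin s
  colTail : Fin s → ι
  colHead : Fin s → ι
  X : ∀ j : Fin s, Matrix (Fin (n (colTail j))) (Fin (n (colHead j))) A
  mate_ne : ∀ c, mate c ≠ c
  mate_invol : ∀ c, mate (mate c) = c
  isTail_mate : ∀ c, isTail (mate c) = !isTail c
  lab_mate : ∀ c, lab (mate c) = lab c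
  lab_surj : ∀ j : Fin s, ∃ c, isTail c = true ∧ lab c = j
  colTail_eq : ∀ c, isTail c = true → colTail (lab c) = c.1
  colHead_eq : ∀ c, isTail c = true → colHead (lab c) = (mate c).1

namespace TabSub

variable {A : Type} [CommRing A] {ι : Type} [Fintype ι] [DecidableEq ι] {n : ι → ℕ} {s : ℕ}

/-- The entry of a (rectangular) matrix at a pair of natural number indices, extended
by zero outside the range. -/
def castEntry {a b : ι} (M : Matrix (Fin (n a)) (Fin (n b)) A) (i j : ℕ) : A :=
  if h : i < n a ∧ j < n b then M ⟨i, h.1⟩ ⟨j, h.2⟩ else 0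

/-- The set of tail cells of a tableau; tail cells are in bijection with arrows. -/
noncomputable def tails (T : TabSub A ι n s) : Finset (TabCell n) :=
  Finset.univ.filter fun c => T.isTail c = true

/-- `sgn(π_1)⋯sgn(π_m)` for a tuple of permutations of the columns. -/
def sgnT (π : ∀ i : ι, Equiv.Perm (Fin (n i))) : ℤ :=
  ∏ i, (Equiv.Perm.sign (π i) : ℤ)

/-- The factor `(X_{φ(a)})_{π_{a''}(''a), π_{a'}('a)}` contributed by the arrow with
tail cell `c`. -/
def entry (T : TabSub A ι n s) (π : ∀ i : ι, Equiv.Perm (Fin (n i))) (c : TabCell n) : A :=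
  castEntry (T.X (T.lab c)) (π c.1 c.2 : Fin (n c.1)).1
    ((π (T.mate c).1 (T.mate c).2 : Fin (n (T.mate c).1)).1)

/-- `bpf⁰_T(X_1,…,X_s)`: the sum over all tuples of permutations. -/
noncomputable def bpf0 (T : TabSub A ι n s) : A :=
  ∑ π : ∀ i : ι, Equiv.Perm (Fin (n i)), sgnT π • ∏ c ∈ T.tails, T.entry π c

/-- The condition on a tuple of permutations appearing in `bpf`: whenever
`φ(a) = φ(b)` and `''a < ''b` then `π_i(''a) < π_i(''b)`. -/
def SortedPi (T : TabSub A ι n s) (π : ∀ i : ι, Equiv.Perm (Fin (n i))) : Prop :=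
  ∀ c ∈ T.tails, ∀ d ∈ T.tails, T.lab c = T.lab d → (c.2 : ℕ) < (d.2 : ℕ) →
    ((π c.1 c.2 : Fin (n c.1)) : ℕ) < ((π d.1 d.2 : Fin (n d.1)) : ℕ)

/-- `bpf_T(X_1,…,X_s)`. -/
noncomputable def bpf (T : TabSub A ι n s) : A :=
  ∑ π ∈ Finset.univ.filter T.SortedPi, sgnT π • ∏ c ∈ T.tails, T.entry π c

/-- Conjugating a tableau with substitution by a column-preserving permutation of the
cells. -/
def permTab (T : TabSub A ι n s) (ρ : Equiv.Perm (TabCell n))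
    (hρ : ∀ c, (ρ c).1 = c.1) : TabSub A ι n s where
  mate := (ρ.symm.trans T.mate).trans ρ
  isTail c := T.isTail (ρ.symm c)
  lab c := T.lab (ρ.symm c)
  colTail := T.colTail
  colHead := T.colHead
  X := T.X
  mate_ne c h := by
    refine T.mate_ne (ρ.symm c) ?_
    simpa using congrArg ρ.symm h
  mate_invol c := by simp [T.mate_invol]
  isTail_mate c := by simpa using T.isTail_mate (ρ.symm c)
  lab_mate c := by simpa using T.lab_mate (ρ.symm c)
  lab_surj j := by
    obtain ⟨c, hc1, hc2⟩ := T.lab_surj j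
    exact ⟨ρ c, by simpa using hc1, by simpa using hc2⟩
  colTail_eq c h := by
    have h1 := T.colTail_eq (ρ.symm c) h
    have h2 : (ρ (ρ.symm c)).1 = (ρ.symm c).1 := hρ (ρ.symm c)
    simpa [h1] using h2.symm
  colHead_eq c h := by
    have h1 := T.colHead_eq (ρ.symm c) h
    have h2 := hρ (T.mate (ρ.symm c))
    simp only [Equiv.trans_apply]
    rw [h1, h2]

/-- The permutation of the cells permuting the cells of column `q` by `τ`. -/
def colPerm (n : ι → ℕ) (q : ι) (τ : Equiv.Perm (Fin (n q))) : Equiv.Perm (TabCell n) :=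
  Equiv.sigmaCongrRight fun i =>
    if h : i = q then ((finCongr (congrArg n h)).permCongr.symm τ) else Equiv.refl _

/-- The tableau `T^τ` obtained from `T` by permuting the cells of column `q` by `τ`. -/
def tw (T : TabSub A ι n s) (q : ι) (τ : Equiv.Perm (Fin (n q))) : TabSub A ι n s :=
  T.permTab (colPerm n q τ) (fun _ => rfl)

end TabSub

namespace TabSub

variable {A : Type} [CommRing A] {ι : Type} [Fintype ι] [DecidableEq ι] {n : ι → ℕ} {s : ℕ}

/-! ### Oriented arrows, paths, and the matrices they carry

An element `a ∈t T` (an arrow of `T` or the transpose of one) is encoded by a cell `c`: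
the oriented arrow with tail cell `c` and head cell `T.mate c`.  If `c` is a tail cell
this is the arrow itself, otherwise it is the transpose of an arrow. -/

/-- The letter `φ(a) ∈ M_T` of an oriented arrow: its label together with a flag telling
whether it is transposed. -/
def letter (T : TabSub A ι n s) (c : TabCell n) : Fin s × Bool := (T.lab c, !T.isTail c)

/-- The word `φ(a_1)⋯φ(a_r) ∈ M_T` of a word of oriented arrows. -/
def word (T : TabSub A ι n s) (l : List (TabCell n)) : List (Fin s × Bool) :=
  l.map T.letter

/-- The entries (as a function on natural number indices, extended by zero) of the
matrix `X_{φ(a)}` assigned to an oriented arrow: rows are indexed by its tail column,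
columns by its head column; for a transposed arrow this is the transposed matrix. -/
def matOf (T : TabSub A ι n s) (c : TabCell n) : ℕ → ℕ → A :=
  fun i j => if T.isTail c then castEntry (T.X (T.lab c)) i j else castEntry (T.X (T.lab c)) j i

/-- The product of a list of `ℕ×ℕ`-indexed matrices, all summations being over
`Finset.range B`. -/
def matListProd (B : ℕ) : List (ℕ → ℕ → A) → ℕ → ℕ → A
  | [] => fun i j => if i = j then 1 else 0
  | f :: fs => fun i j => ∑ p ∈ Finset.range B, f i p * matListProd B fs p j

/-- A bound exceeding the sizes of all matrices involved. -/
def dimBound (n : ι → ℕ) [Fintype ι] : ℕ := ∑ i, n i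

/-- The entries of the product matrix `X_{φ(a_1)}⋯X_{φ(a_r)}` of a word of oriented
arrows (the product being `0` if the sizes do not match). -/
def pathMat (T : TabSub A ι n s) (l : List (TabCell n)) : ℕ → ℕ → A :=
  matListProd (dimBound n) (l.map T.matOf)

/-- The trace of the matrix of a (closed) word of oriented arrows. -/
def pathTr (T : TabSub A ι n s) (l : List (TabCell n)) : A :=
  ∑ p ∈ Finset.range (dimBound n), T.pathMat l p p

/-- The entries of the matrix `X_u` of a word `u ∈ M_T` in the letters
`1,…,s,1ᵗ,…,sᵗ` (the product being `0` if the sizes do not match). -/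
def wordMat (T : TabSub A ι n s) (w : List (Fin s × Bool)) : ℕ → ℕ → A :=
  matListProd (dimBound n)
    (w.map fun p => fun i j =>
      if p.2 then castEntry (T.X p.1) j i else castEntry (T.X p.1) i j)

/-- `σ_k(X)`: the coefficient in the characteristic polynomial defined by
`det(λE − X) = λ^n − σ_1(X)λ^{n−1} + ⋯ + (−1)^n σ_n(X)`. -/
noncomputable def sigmaCoeff (N : ℕ) (M : Matrix (Fin N) (Fin N) A) (k : ℕ) : A :=
  (-1) ^ k * (Matrix.charpoly M).coeff (N - k)

/-- `σ_k(X_u)` for a word `u ∈ M_T`. -/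
noncomputable def wordSigma (T : TabSub A ι n s) (w : List (Fin s × Bool)) (k : ℕ) : A :=
  sigmaCoeff (dimBound n) (Matrix.of fun i j : Fin (dimBound n) => T.wordMat w i j) k

/-- Oriented arrows `a_1, a_2` are successive (with respect to the distinguished columns
`q_1, q_2`): `a_1', a_2'' ∈ {q_1,q_2}`, `a_1' ≠ a_2''` and `'a_1 = ''a_2`. -/
def Succ (T : TabSub A ι n s) (q1 q2 : ι) (c d : TabCell n) : Prop :=
  ((T.mate c).1 = q1 ∨ (T.mate c).1 = q2) ∧ (d.1 = q1 ∨ d.1 = q2) ∧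
    (T.mate c).1 ≠ d.1 ∧ ((T.mate c).2 : ℕ) = (d.2 : ℕ)

/-- A path in `T` with respect to the columns `q_1` and `q_2`: a (nonempty, repetition
free) word of oriented arrows in which consecutive arrows are successive. -/
def IsPath (T : TabSub A ι n s) (q1 q2 : ι) (l : List (TabCell n)) : Prop :=
  l ≠ [] ∧ l.Chain' (T.Succ q1 q2) ∧ l.Nodup

/-- An open path: a path passing through the columns `q_1,q_2` whose first tail and
last head lie outside `{q_1,q_2}`. -/
def IsOpenPath (T : TabSub A ι n s) (q1 q2 : ι) (l : List (TabCell n)) : Prop :=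
  T.IsPath q1 q2 l ∧ 2 ≤ l.length ∧ ∀ h : l ≠ [],
    ((l.head h).1 ≠ q1 ∧ (l.head h).1 ≠ q2) ∧
    ((T.mate (l.getLast h)).1 ≠ q1 ∧ (T.mate (l.getLast h)).1 ≠ q2)

/-- A closed path: a path whose last and first arrows are also successive. -/
def IsClosedPath (T : TabSub A ι n s) (q1 q2 : ι) (l : List (TabCell n)) : Prop :=
  T.IsPath q1 q2 l ∧ ∀ h : l ≠ [], T.Succ q1 q2 (l.getLast h) (l.head h)

/-- The transpose `aᵗ = a_rᵗ⋯a_1ᵗ` of a word of oriented arrows. -/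
def tp (T : TabSub A ι n s) (l : List (TabCell n)) : List (TabCell n) :=
  (l.map T.mate).reverse

/-- Equality of words of oriented arrows up to transposition (`=t`). -/
def eqT (T : TabSub A ι n s) (l l' : List (TabCell n)) : Prop :=
  l = l' ∨ l = T.tp l'

/-- Equality of words of oriented arrows up to cyclic permutation and transposition
(`=ct`). -/
def eqCT (T : TabSub A ι n s) (l l' : List (TabCell n)) : Prop :=
  l.IsRotated l' ∨ l.IsRotated (T.tp l')

/-- `R` is a set of representatives of the open paths of `T` (w.r.t. `q_1,q_2`) modulo
the `=t`-equivalence. -/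
def OpenReps (T : TabSub A ι n s) (q1 q2 : ι) (R : Finset (List (TabCell n))) : Prop :=
  (∀ l ∈ R, T.IsOpenPath q1 q2 l) ∧
  ∀ l, T.IsOpenPath q1 q2 l → ∃! l', l' ∈ R ∧ T.eqT l l'

/-- `R` is a set of representatives of the closed paths of `T` (w.r.t. `q_1,q_2`)
modulo the `=ct`-equivalence. -/
def ClosedReps (T : TabSub A ι n s) (q1 q2 : ι) (R : Finset (List (TabCell n))) : Prop :=
  (∀ l ∈ R, T.IsClosedPath q1 q2 l) ∧
  ∀ l, T.IsClosedPath q1 q2 l → ∃! l', l' ∈ R ∧ T.eqCT l l'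

/-- `tr(T_cl) = ∏_{a ∈ T_cl} tr(X_{φ(a)})` for a set `R` of representatives of the
closed paths. -/
noncomputable def trClosed (T : TabSub A ι n s) (R : Finset (List (TabCell n))) : A :=
  ∏ l ∈ R, T.pathTr l

end TabSub

/-! ### Words in the free monoid `M_T` -/

/-- The transpose `uᵗ` of a word `u ∈ M_T` in the letters `1,…,s,1ᵗ,…,sᵗ`. -/
def wtp {s : ℕ} (w : List (Fin s × Bool)) : List (Fin s × Bool) :=
  (w.map fun p => (p.1, !p.2)).reverse

/-- Equality of words in `M_T` up to transposition (`=t`). -/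
def weqT {s : ℕ} (w w' : List (Fin s × Bool)) : Prop := w = w' ∨ w = wtp w'

/-- Equality of words in `M_T` up to cyclic permutation and transposition (`=ct`). -/
def weqCT {s : ℕ} (w w' : List (Fin s × Bool)) : Prop :=
  w.IsRotated w' ∨ w.IsRotated (wtp w')

/-- A word in a free monoid is primitive if it is not a power (with at least two
factors) of a word. -/
def PrimitiveWord {α : Type*} (w : List α) : Prop :=
  w ≠ [] ∧ ∀ (u : List α) (r : ℕ), 2 ≤ r → w ≠ (List.replicate r u).flatten

namespace TabSub

variable {A : Type} [CommRing A] {ι : Type} [Fintype ι] [DecidableEq ι] {n : ι → ℕ} {s : ℕ}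

/-! ### The tableau `T̃` -/

/-- The inclusion of the cells of the shape with the columns `q_1, q_2` deleted into the
cells of the original shape. -/
def embCell (q1 q2 : ι) (c : TabCell (fun i : {i : ι // i ≠ q1 ∧ i ≠ q2} => n i.1)) :
    TabCell n := ⟨c.1.1, c.2⟩

/-- The word in `M_T` corresponding to an arrow of `T̃` with tail cell `c'`: for an old
arrow (Case A) it is the single letter `φ(a)`; for an arrow coming from an open path
`l ∈ Ro` starting at `c'` (Case B) it is `φ(l)`. -/
noncomputable def tildeWord (T : TabSub A ι n s) (q1 q2 : ι)
    (Ro : Finset (List (TabCell n)))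
    (c' : TabCell (fun i : {i : ι // i ≠ q1 ∧ i ≠ q2} => n i.1)) : List (Fin s × Bool) :=
  if ((T.mate (embCell q1 q2 c')).1 ≠ q1 ∧ (T.mate (embCell q1 q2 c')).1 ≠ q2) then
    [T.letter (embCell q1 q2 c')]
  else
    T.word ((Ro.filter fun l => l.head? = some (embCell q1 q2 c')).toList.headI)

end TabSub

namespace TabSub

variable {A : Type} [CommRing A] {ι : Type} [Fintype ι] [DecidableEq ι] {n : ι → ℕ} {s : ℕ}

/-- `D` is (a tableau with substitution equal to) the tableau `T̃` associated with `T`,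
the columns `q_1, q_2`, and the set `Ro` of representatives of open paths.  Its arrows
are the arrows of `T` lying entirely outside the columns `q_1, q_2` (Case A, carrying
the same matrices), together with one arrow for each open path `l ∈ Ro`, going from the
tail of the first arrow of `l` to the head of its last arrow and carrying the matrix
`X_{φ(l)}` (Case B); two arrows of `D` carry the same label iff the corresponding words
in `M_T` coincide. -/
def IsTilde (T : TabSub A ι n s) (q1 q2 : ι) (Ro : Finset (List (TabCell n))) {t : ℕ}
    (D : TabSub A {i : ι // i ≠ q1 ∧ i ≠ q2} (fun i => n i.1) t) : Prop :=
  (∀ c' : TabCell (fun i : {i : ι // i ≠ q1 ∧ i ≠ q2} => n i.1),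
    ((T.mate (embCell q1 q2 c')).1 ≠ q1 ∧ (T.mate (embCell q1 q2 c')).1 ≠ q2) →
      D.isTail c' = T.isTail (embCell q1 q2 c') ∧
      embCell q1 q2 (D.mate c') = T.mate (embCell q1 q2 c') ∧
      ∀ i j, D.matOf c' i j = T.matOf (embCell q1 q2 c') i j) ∧
  (∀ l ∈ Ro, ∀ (h : l ≠ []) (h1 : (l.head h).1 ≠ q1 ∧ (l.head h).1 ≠ q2),
      D.isTail ⟨⟨(l.head h).1, h1⟩, (l.head h).2⟩ = true ∧
      embCell q1 q2 (D.mate ⟨⟨(l.head h).1, h1⟩, (l.head h).2⟩) = T.mate (l.getLast h) ∧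
      ∀ i j, D.matOf ⟨⟨(l.head h).1, h1⟩, (l.head h).2⟩ i j = T.pathMat l i j) ∧
  (∀ c' d', D.isTail c' = true → D.isTail d' = true →
      (D.lab c' = D.lab d' ↔ tildeWord T q1 q2 Ro c' = tildeWord T q1 q2 Ro d'))

end TabSub

/-! ### Quadruples and the sets `S_τ`, `S_{β,γ,b,c}` -/

/-- The data of a quadruple `(β,γ,b,c)` with `β ∈ ℕ^p`, `γ ∈ ℕ^q` and `b`, `c`
sequences of words in `M_T`. -/
structure QuadData (s : ℕ) where
  p : ℕ
  q : ℕ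
  β : Fin p → ℕ
  γ : Fin q → ℕ
  b : Fin p → List (Fin s × Bool)
  c : Fin q → List (Fin s × Bool)

namespace QuadData

variable {s : ℕ}

/-- `(β,γ,b,c)` is a `T`-quadruple: the `b_i`, `c_j` are primitive, the `b_i` are
pairwise different with respect to `=t` and the `c_j` pairwise different with respect
to `=ct`. -/
def IsQuad (Q : QuadData s) : Prop :=
  (∀ i, PrimitiveWord (Q.b i)) ∧ (∀ j, PrimitiveWord (Q.c j)) ∧
  (∀ i i', i ≠ i' → ¬ weqT (Q.b i) (Q.b i')) ∧
  (∀ j j', j ≠ j' → ¬ weqCT (Q.c j) (Q.c j'))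

/-- The multiset `{{b_1,…,b_1,…,b_p,…,b_p}}` with `b_i` of multiplicity `β_i`. -/
def mB (Q : QuadData s) : Multiset (List (Fin s × Bool)) :=
  ∑ i, Multiset.replicate (Q.β i) (Q.b i)

/-- The multiset `{{c_1,…,c_1,…,c_q,…,c_q}}` with `c_j` of multiplicity `γ_j`. -/
def mC (Q : QuadData s) : Multiset (List (Fin s × Bool)) :=
  ∑ j, Multiset.replicate (Q.γ j) (Q.c j)

/-- Equivalence of quadruples: the associated multisets agree up to `=t` (for `b`)
and up to `=ct` (for `c`). -/
def Equiv (Q Q' : QuadData s) : Prop :=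
  Multiset.Rel weqT Q.mB Q'.mB ∧ Multiset.Rel weqCT Q.mC Q'.mC

end QuadData

namespace TabSub

variable {A : Type} [CommRing A] {ι : Type} [Fintype ι] [DecidableEq ι] {n : ι → ℕ} {s : ℕ}

/-- The multiset `φ(T_o)` (or `φ(T_cl)`) of words in `M_T` of a set `R` of
representative paths. -/
def wordsOf (T : TabSub A ι n s) (R : Finset (List (TabCell n))) :
    Multiset (List (Fin s × Bool)) :=
  R.val.map T.word

/-- `ξ` witnesses the `T`-admissibility of the quadruple `Q`, with respect to the given
families `Ro ξ`, `Rcl ξ` of representatives of the open and closed paths of `T^ξ`: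
`φ(T^ξ_o) =t {{b_i with multiplicity β_i}}` and
`φ(T^ξ_cl) =ct {{c_j with multiplicity γ_j}}`. -/
def Witness (T : TabSub A ι n s) (q1 q2 : ι)
    (Ro Rcl : Finset (List (TabCell n))) (Q : QuadData s) : Prop :=
  Multiset.Rel weqT (T.wordsOf Ro) Q.mB ∧ Multiset.Rel weqCT (T.wordsOf Rcl) Q.mC

/-- The quadruple `Q` is `T`-admissible. -/
def Admissible (T : TabSub A ι n s) (q1 q2 : ι) (hn : n q1 = n q2)
    (Ro Rcl : Equiv.Perm (Fin (n q2)) → Finset (List (TabCell n)))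
    (Q : QuadData s) : Prop :=
  Q.IsQuad ∧ ∃ ξ : Equiv.Perm (Fin (n q2)), Witness (T.tw q2 ξ) q1 q2 (Ro ξ) (Rcl ξ) Q

/-- Membership `τ ∈ S_{β,γ,b,c}`: `φ(T^τ_o) =t {{b_i with multiplicity β_i}}` and
`φ(T^τ_cl) =ct {{c_1^{λ_{11}},…,c_1^{λ_{1l_1}},…,c_q^{λ_{q1}},…,c_q^{λ_{ql_q}}}}` for
some positive integers `λ_{ij}` with `λ_{i1}+⋯+λ_{il_i} = γ_i`. -/
def SQuadMem (T : TabSub A ι n s) (q1 q2 : ι)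
    (Ro Rcl : Equiv.Perm (Fin (n q2)) → Finset (List (TabCell n)))
    (Q : QuadData s) (τ : Equiv.Perm (Fin (n q2))) : Prop :=
  Multiset.Rel weqT ((T.tw q2 τ).wordsOf (Ro τ)) Q.mB ∧
  ∃ L : Fin Q.q → Multiset ℕ,
    (∀ j, (∀ x ∈ L j, 0 < x) ∧ (L j).sum = Q.γ j) ∧
    Multiset.Rel weqCT ((T.tw q2 τ).wordsOf (Rcl τ))
      (∑ j, (L j).map fun lam => (List.replicate lam (Q.c j)).flatten)

/-- The set `S_τ` of permutations `π` with `φ(T^π_o) =t φ(T^τ_o)` and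
`φ(T^π_cl) =ct φ(T^τ_cl)`. -/
def SPerm (T : TabSub A ι n s) (q1 q2 : ι)
    (Ro Rcl : Equiv.Perm (Fin (n q2)) → Finset (List (TabCell n)))
    (τ : Equiv.Perm (Fin (n q2))) : Set (Equiv.Perm (Fin (n q2))) :=
  {π | Multiset.Rel weqT ((T.tw q2 π).wordsOf (Ro π)) ((T.tw q2 τ).wordsOf (Ro τ)) ∧
       Multiset.Rel weqCT ((T.tw q2 π).wordsOf (Rcl π)) ((T.tw q2 τ).wordsOf (Rcl τ))}

/-! ### Auxiliary constructions for Lemmas about `T^π` -/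

/-- The word of arrows of `T` underlying a word of arrows of `T^τ`. -/
def underlying (T : TabSub A ι n s) (q2 : ι) (τ : Equiv.Perm (Fin (n q2)))
    (l : List (TabCell n)) : List (TabCell n) :=
  l.map (colPerm n q2 τ).symm

/-- The cell number of a cell lying in column `q_1` or `q_2`, as an element of
`Fin (n q2)` (using `n q1 = n q2`). -/
def toQ2 {q1 q2 : ι} (hn : n q1 = n q2) (c : TabCell n) (h : c.1 = q1 ∨ c.1 = q2) :
    Fin (n q2) :=
  if h2 : c.1 = q2 then Fin.cast (congrArg n h2) c.2
  else Fin.cast ((congrArg n (h.resolve_right h2)).trans hn) c.2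

/-- The substitution `a → b, b → a` on oriented arrows (hence also `aᵗ → bᵗ, bᵗ → aᵗ`). -/
def swapSub (T : TabSub A ι n s) (a b : TabCell n) (c : TabCell n) : TabCell n :=
  if c = a then b else if c = b then a
  else if c = T.mate a then T.mate b else if c = T.mate b then T.mate a else c

end TabSub

namespace DecompPf

open Equiv Equiv.Perm

set_option linter.unusedSectionVars false

section PFsec

variable {Q : Type} [CommRing Q] {S I L : Type} [Fintype S] [Fintype I] [DecidableEq I]
  [DecidableEq S] [Fintype L] [DecidableEq L]

/-- Unnormalised pfaffian-like sum of a family of matrices along a perfect matching. -/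
noncomputable def PF (e : S ⊕ S ≃ I) (B : S → Matrix I I Q) : Q :=
  ∑ σ : Perm I, ((sign σ : ℤˣ) : ℤ) • ∏ a, B a (σ (e (Sum.inl a))) (σ (e (Sum.inr a)))

theorem PF_trans (e : S ⊕ S ≃ I) (σ0 : Perm I) (B : S → Matrix I I Q) :
    PF e B = ((sign σ0 : ℤˣ) : ℤ) • PF (e.trans σ0) B := by
  unfold PF
  rw [Finset.smul_sum]
  rw [← Equiv.sum_comp (Equiv.mulRight σ0)]
  refine Finset.sum_congr rfl fun σ _ => ?_
  simp only [Equiv.coe_mulRight, Perm.sign_mul, Units.val_mul, Equiv.trans_apply, Perm.mul_apply, smul_smul]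
  rw [mul_comm]

theorem PF_perm (e : S ⊕ S ≃ I) (ρ : Perm S) (B : S → Matrix I I Q) :
    PF e (fun a => B (ρ a)) = PF e B := by
  rw [PF_trans e (e.permCongr (Equiv.sumCongr ρ ρ))]
  rw [Equiv.Perm.sign_permCongr]
  have h : sign (Equiv.sumCongr ρ ρ) = 1 := by
    rw [sign_sumCongr]; exact Int.units_mul_self _
  rw [h]
  simp only [Units.val_one, one_smul]
  unfold PF
  refine Finset.sum_congr rfl fun σ _ => ?_
  congr 1
  rw [← Equiv.prod_comp ρ (fun a => B a (σ (e (Sum.inl a))) (σ (e (Sum.inr a))))]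
  simp [Equiv.permCongr_apply]

theorem PF_sum (e : S ⊕ S ≃ I) (B : L → Matrix I I Q) :
    PF e (fun _ => ∑ l, B l) = ∑ j : S → L, PF e (fun a => B (j a)) := by
  unfold PF
  rw [Finset.sum_comm]
  refine Finset.sum_congr rfl fun σ _ => ?_
  simp only [Matrix.sum_apply]
  rw [Fintype.prod_sum, Finset.smul_sum]

theorem PF_smul (e : S ⊕ S ≃ I) (x : S → Q) (B : S → Matrix I I Q) :
    PF e (fun a => x a • B a) = (∏ a, x a) * PF e B := by
  unfold PF
  rw [Finset.mul_sum]
  refine Finset.sum_congr rfl fun σ _ => ?_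
  simp [Finset.prod_mul_distrib, mul_left_comm]

theorem PF_map {Q' : Type} [CommRing Q'] (f : Q →+* Q') (e : S ⊕ S ≃ I) (B : S → Matrix I I Q) :
    f (PF e B) = PF e (fun a => (B a).map f) := by
  unfold PF
  simp [map_sum, map_prod]

theorem PF_sub_mem (J : Ideal Q) (e : S ⊕ S ≃ I) (B B' : S → Matrix I I Q)
    (h : ∀ a c d, B a c d - B' a c d ∈ J) : PF e B - PF e B' ∈ J := by
  rw [← Ideal.Quotient.eq, PF_map, PF_map]
  congr 1
  funext a
  ext c d
  simpa using Ideal.Quotient.eq.2 (h a c d)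

theorem PF_conj (e : S ⊕ S ≃ I) (h : Matrix I I Q) (B : S → Matrix I I Q) :
    PF e (fun a => h.transpose * B a * h) = h.det * PF e B := by
  have key : ∀ σ : Perm I, ∏ a, (h.transpose * B a * h) (σ (e (Sum.inl a))) (σ (e (Sum.inr a)))
      = ∑ f : I → I, (∏ c, h (f c) (σ c)) * ∏ a, B a (f (e (Sum.inl a))) (f (e (Sum.inr a))) := by
    intro σ
    have h1 : ∀ a, (h.transpose * B a * h) (σ (e (Sum.inl a))) (σ (e (Sum.inr a))) =
        ∑ p : I × I, h p.1 (σ (e (Sum.inl a))) * h p.2 (σ (e (Sum.inr a))) * B a p.1 p.2 := by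
      intro a
      rw [Matrix.mul_apply, Fintype.sum_prod_type, Finset.sum_comm]
      refine Finset.sum_congr rfl fun y _ => ?_
      rw [Matrix.mul_apply, Finset.sum_mul]
      refine Finset.sum_congr rfl fun x _ => ?_
      simp only [Matrix.transpose_apply]; ring
    simp only [h1]
    rw [Fintype.prod_sum]
    let E : (S → I × I) ≃ (I → I) :=
      (Equiv.arrowProdEquivProdArrow S (fun _ => I) (fun _ => I)).trans ((Equiv.sumArrowEquivProdArrow S S I).symm.trans
        (Equiv.arrowCongr e (Equiv.refl I)))
    rw [← Equiv.sum_comp E]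
    refine Finset.sum_congr rfl fun p _ => ?_
    have hl : ∀ a, E p (e (Sum.inl a)) = (p a).1 := by intro a; simp [E]
    have hr : ∀ a, E p (e (Sum.inr a)) = (p a).2 := by intro a; simp [E]
    rw [← Equiv.prod_comp e, Fintype.prod_sum_type]
    simp only [hl, hr, Finset.prod_mul_distrib]
  unfold PF
  simp only [key]
  simp only [Finset.smul_sum]
  rw [Finset.sum_comm]
  have h2 : ∀ f : I → I, ∑ σ : Perm I, ((sign σ : ℤˣ) : ℤ) • ((∏ c, h (f c) (σ c)) *
      ∏ a, B a (f (e (Sum.inl a))) (f (e (Sum.inr a)))) =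
      (Matrix.det (h.submatrix f id)) * ∏ a, B a (f (e (Sum.inl a))) (f (e (Sum.inr a))) := by
    intro f
    rw [← Matrix.det_transpose, Matrix.det_apply, Finset.sum_mul]
    refine Finset.sum_congr rfl fun σ _ => ?_
    simp [Units.smul_def, mul_assoc]
  simp only [h2]
  rw [Finset.mul_sum]
  symm
  refine Finset.sum_bij_ne_zero (fun σ _ _ => (σ : I → I)) (fun _ _ _ => Finset.mem_univ _)
    (fun a _ _ b _ _ hab => DFunLike.coe_injective hab) ?_ ?_
  · intro f _ hf
    have hinj : Function.Injective f := by
      by_contra hni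
      apply hf
      simp only [Function.Injective, not_forall] at hni
      obtain ⟨a, b, hab, hne⟩ := hni
      rw [Matrix.det_zero_of_row_eq hne (by ext x; simp [hab]), zero_mul]
    have hbij := Finite.injective_iff_bijective.1 hinj
    refine ⟨Equiv.ofBijective f hbij, Finset.mem_univ _, ?_, rfl⟩
    intro h0
    apply hf
    rw [← h0]
    have := Matrix.det_permute (Equiv.ofBijective f hbij) h
    rw [show h.submatrix f id = h.submatrix (Equiv.ofBijective f hbij) id from rfl, this]
    simp only [zsmul_eq_mul, Equiv.ofBijective_apply]
    ring
  · intro σ _ _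
    rw [Matrix.det_permute]
    simp only [zsmul_eq_mul]
    ring

theorem PF_swap_zero (e : S ⊕ S ≃ I) (B : S → Matrix I I Q) (a0 : S)
    (hB : (B a0).IsSymm) : PF e B = 0 := by
  unfold PF
  have hne : e (Sum.inl a0) ≠ e (Sum.inr a0) := by simp
  refine Finset.sum_involution (fun σ _ => σ * Equiv.swap (e (Sum.inl a0)) (e (Sum.inr a0))) ?_ ?_ ?_ ?_
  · intro σ _
    have : ∏ a, B a ((σ * Equiv.swap (e (Sum.inl a0)) (e (Sum.inr a0))) (e (Sum.inl a)))
        ((σ * Equiv.swap (e (Sum.inl a0)) (e (Sum.inr a0))) (e (Sum.inr a))) =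
        ∏ a, B a (σ (e (Sum.inl a))) (σ (e (Sum.inr a))) := by
      refine Finset.prod_congr rfl fun a _ => ?_
      by_cases ha : a = a0
      · subst ha
        simp only [Perm.mul_apply, swap_apply_left, swap_apply_right]
        exact hB.apply _ _
      · simp only [Perm.mul_apply]
        rw [swap_apply_of_ne_of_ne, swap_apply_of_ne_of_ne] <;> simp [ha]
    rw [this]
    simp [sign_swap hne]
  · intro σ _ _ h
    have h2 := congrArg (fun τ => σ⁻¹ * τ) h
    simp only [inv_mul_cancel_left, inv_mul_cancel] at h2
    rw [Equiv.swap_eq_one_iff] at h2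
    exact hne h2
  · intro σ _; exact Finset.mem_univ _
  · intro σ _; simp [mul_assoc]

theorem PF_add_symm (e : S ⊕ S ≃ I) (M N : Matrix I I Q) (hN : N.IsSymm) :
    PF e (fun _ => M + N) = PF e (fun _ => M) := by
  have h := PF_sum e (fun b : Bool => if b then M else N)
  simp only [Fintype.sum_bool, if_true] at h
  have h' : PF e (fun _ => M + N) = ∑ j : S → Bool, PF e (fun a => if j a = true then M else N) := by
    rw [← h]; simp
  rw [h', Finset.sum_eq_single (fun _ => true)]
  · simp
  · intro j _ hj
    have : ∃ a, j a = false := by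
      by_contra hc
      push Not at hc
      exact hj (funext fun a => by simpa using hc a)
    obtain ⟨a, ha⟩ := this
    exact PF_swap_zero e _ a (by simpa [ha] using hN)
  · simp

end PFsec

section Sigma

variable {ι : Type} [Fintype ι] [DecidableEq ι] {n : ι → ℕ}

theorem sign_sigma (π : ∀ i : ι, Perm (Fin (n i))) :
    ((sign (Equiv.sigmaCongrRight π : Perm (TabCell n)) : ℤˣ) : ℤ) = TabSub.sgnT π := by
  have h : ((sign : Perm (TabCell n) →* ℤˣ).comp (sigmaCongrRightHom (fun i => Fin (n i)))) =
      (∏ i, (sign : Perm (Fin (n i)) →* ℤˣ).comp (Pi.evalMonoidHom _ i)) := by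
    apply MonoidHom.pi_ext
    intro i x
    have h2 : ∀ y : Perm (Fin (n i)), (∏ k, (sign : Perm (Fin (n k)) →* ℤˣ).comp
        (Pi.evalMonoidHom (fun i => Perm (Fin (n i))) k)) (Pi.mulSingle i y) = sign y := by
      intro y
      rw [MonoidHom.finsetProd_apply, Finset.prod_eq_single i]
      · simp
      · intro k _ hk; simp [Pi.mulSingle_eq_of_ne hk]
      · simp
    rw [h2]
    induction x using swap_induction_on with
    | one => simp
    | swap_mul f a b hab ih =>
      rw [Pi.mulSingle_mul, map_mul, map_mul, ih, sign_swap hab]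
      congr 1
      have : (sigmaCongrRightHom (fun i => Fin (n i))) (Pi.mulSingle i (Equiv.swap a b)) =
          Equiv.swap (⟨i, a⟩ : TabCell n) ⟨i, b⟩ := by
        ext ⟨k, y⟩ : 1
        simp only [sigmaCongrRightHom_apply, sigmaCongrRight_apply, Sigma.map]
        by_cases hk : k = i
        · subst hk
          simp only [Pi.mulSingle_eq_same, id]
          by_cases h1 : y = a
          · subst h1; simp
          by_cases h2 : y = b
          · subst h2; simp
          rw [swap_apply_of_ne_of_ne h1 h2, swap_apply_of_ne_of_ne] <;> simp [h1, h2]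
        · rw [Pi.mulSingle_eq_of_ne hk, swap_apply_of_ne_of_ne]
          · simp
          · simp [hk]
          · simp [hk]
      rw [MonoidHom.comp_apply, this, sign_swap]
      simpa using hab
  have := DFunLike.congr_fun h π
  simp only [MonoidHom.comp_apply, MonoidHom.finsetProd_apply] at this
  have h3 := congrArg (fun u : ℤˣ => (u : ℤ)) this
  rw [sigmaCongrRightHom_apply] at h3
  rw [h3]
  simp [TabSub.sgnT]

variable {Q : Type} [CommRing Q] {S : Type} [Fintype S]

theorem PF_block (e : S ⊕ S ≃ TabCell n) (B : S → Matrix (TabCell n) (TabCell n) Q)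
    (hB : ∀ a c d, B a c d ≠ 0 → c.1 = (e (Sum.inl a)).1 ∧ d.1 = (e (Sum.inr a)).1) :
    PF e B = ∑ π : ∀ i : ι, Perm (Fin (n i)), TabSub.sgnT π •
      ∏ a, B a ⟨(e (Sum.inl a)).1, π _ (e (Sum.inl a)).2⟩ ⟨(e (Sum.inr a)).1, π _ (e (Sum.inr a)).2⟩ := by
  unfold PF
  symm
  refine Finset.sum_bij_ne_zero (fun π _ _ => (Equiv.sigmaCongrRight π : Perm (TabCell n)))
    (fun _ _ _ => Finset.mem_univ _)
    (fun a _ _ b _ _ hab => sigmaCongrRightHom_injective (by simpa using hab)) ?_ ?_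
  · intro σ _ hσ
    have hcol : ∀ c, (σ c).1 = c.1 := by
      intro c
      have h1 : ∏ a, B a (σ (e (Sum.inl a))) (σ (e (Sum.inr a))) ≠ 0 := by
        intro h0; apply hσ; rw [h0, smul_zero]
      have h2 : ∀ a, B a (σ (e (Sum.inl a))) (σ (e (Sum.inr a))) ≠ 0 := by
        intro a h0; exact h1 (Finset.prod_eq_zero (Finset.mem_univ a) h0)
      obtain ⟨x, rfl⟩ := e.surjective c
      rcases x with a | a
      · exact (hB a _ _ (h2 a)).1
      · exact (hB a _ _ (h2 a)).2
    have hmem : σ ∈ (sigmaCongrRightHom (fun i => Fin (n i))).range := by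
      let f : ∀ i, Fin (n i) → Fin (n i) := fun i x => Fin.cast (congrArg n (hcol ⟨i, x⟩)) (σ ⟨i, x⟩).2
      have hf : ∀ i x, (⟨i, f i x⟩ : TabCell n) = σ ⟨i, x⟩ := by
        intro i x
        have : ∀ (c : TabCell n) (h : c.1 = i), (⟨i, Fin.cast (congrArg n h) c.2⟩ : TabCell n) = c := by
          rintro ⟨k, y⟩ h
          subst h
          rfl
        exact this _ (hcol ⟨i, x⟩)
      have hinj : ∀ i, Function.Injective (f i) := by
        intro i x y hxy
        have h3 : σ ⟨i, x⟩ = σ ⟨i, y⟩ := by rw [← hf, ← hf, hxy]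
        simpa using σ.injective h3
      refine ⟨fun i => Equiv.ofBijective (f i) (Finite.injective_iff_bijective.1 (hinj i)), ?_⟩
      ext ⟨i, x⟩ : 1
      rw [← hf]
      rfl
    obtain ⟨π, rfl⟩ := hmem
    refine ⟨π, Finset.mem_univ _, ?_, rfl⟩
    intro h0
    apply hσ
    rw [← h0, sigmaCongrRightHom_apply, sign_sigma]
    rfl
  · intro π _ _
    rw [sign_sigma]
    rfl

end Sigma
end DecompPf

namespace DecompPf

open Equiv Equiv.Perm

set_option linter.unusedSectionVars false

theorem orbit_sum {S L Q : Type} [CommRing Q] [Fintype S] [DecidableEq S] [Fintype L]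
    [DecidableEq L] (C : Subring Q) (f : (S → L) → Q)
    (hinv : ∀ (j : S → L) (ρ : Perm S), f (fun a => j (ρ a)) = f j)
    (hf : ∀ j : S → L, ∃ c ∈ C,
      f j = ((∏ l, (Fintype.card {a // j a = l}).factorial : ℕ) : Q) * c) :
    ∃ c ∈ C, ∑ j, f j = ((Fintype.card S).factorial : Q) * c := by
  choose c hc hfc using hf
  let O := Quotient (MulAction.orbitRel (Perm S)ᵈᵐᵃ (S → L))
  refine ⟨∑ o : O, c o.out, Subring.sum_mem _ (fun o _ => hc _), ?_⟩
  rw [Finset.mul_sum]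
  rw [← Finset.sum_fiberwise (s := Finset.univ) (g := fun j => (Quotient.mk _ j : O))]
  refine Finset.sum_congr rfl fun o _ => ?_
  have h1 : ∀ j ∈ Finset.univ.filter (fun j => (Quotient.mk _ j : O) = o), f j = f o.out := by
    intro j hj
    have h2 : (Quotient.mk _ j : O) = Quotient.mk _ o.out := by
      rw [Quotient.out_eq]; exact (Finset.mem_filter.1 hj).2
    have h3 : j ∈ MulAction.orbit (Perm S)ᵈᵐᵃ o.out := Quotient.exact h2
    obtain ⟨g, hg⟩ := h3
    rw [← hg, ← hinv o.out (DomMulAct.mk.symm g)]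
    rfl
  rw [Finset.sum_congr rfl h1, Finset.sum_const, hfc, nsmul_eq_mul, ← mul_assoc, ← Nat.cast_mul]
  congr 2
  rw [← DomMulAct.stabilizer_card]
  haveI : Fintype (Perm S)ᵈᵐᵃ := Fintype.ofEquiv _ DomMulAct.mk
  have h4 := MulAction.card_orbit_mul_card_stabilizer_eq_card_group (Perm S)ᵈᵐᵃ (o.out)
  have h5 : Fintype.card (Perm S)ᵈᵐᵃ = (Fintype.card S).factorial := by
    rw [← Fintype.card_perm]; exact Fintype.card_congr DomMulAct.mk.symm
  rw [← h5, ← h4]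
  congr 1
  · rw [Fintype.card_subtype]
    congr 1
    ext j
    simp only [Finset.mem_filter, Finset.mem_univ, true_and]
    rw [← MulAction.orbitRel_apply]
    constructor
    · intro h; exact Quotient.exact (h.trans (Quotient.out_eq o).symm)
    · intro h; exact (Quotient.sound h).trans (Quotient.out_eq o)
  · refine Fintype.card_congr ?_
    refine Equiv.subtypeEquiv DomMulAct.mk ?_
    intro g
    rw [DomMulAct.mem_stabilizer_iff]
    rfl

theorem sort_unique {α : Type} [Fintype α] [DecidableEq α] (u v : α → ℕ)
    (hu : Function.Injective u) (hv : Function.Injective v) :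
    ∃! ρ : Perm α, ∀ c d, u c < u d → v (ρ c) < v (ρ d) := by
  let k := Fintype.card α
  let eu : Fin k ≃ α :=
    (@Fintype.orderIsoFinOfCardEq α (LinearOrder.lift' u hu) _ k rfl).toEquiv
  let ev : Fin k ≃ α :=
    (@Fintype.orderIsoFinOfCardEq α (LinearOrder.lift' v hv) _ k rfl).toEquiv
  have hue : ∀ x y, u (eu x) < u (eu y) ↔ x < y := fun x y =>
    (@OrderIso.lt_iff_lt (Fin k) α _ (@PartialOrder.toPreorder _ (LinearOrder.lift' u hu).toPartialOrder)
      (@Fintype.orderIsoFinOfCardEq α (LinearOrder.lift' u hu) _ k rfl) x y)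
  have hve : ∀ x y, v (ev x) < v (ev y) ↔ x < y := fun x y =>
    (@OrderIso.lt_iff_lt (Fin k) α _ (@PartialOrder.toPreorder _ (LinearOrder.lift' v hv).toPartialOrder)
      (@Fintype.orderIsoFinOfCardEq α (LinearOrder.lift' v hv) _ k rfl) x y)
  refine ⟨eu.symm.trans ev, ?_, ?_⟩
  · intro c d h
    obtain ⟨x, rfl⟩ := eu.surjective c
    obtain ⟨y, rfl⟩ := eu.surjective d
    simp only [Equiv.trans_apply, Equiv.symm_apply_apply]
    rw [hve]; exact (hue x y).1 h
  · intro ρ hρ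
    have hm : StrictMono (fun x => ev.symm (ρ (eu x))) := by
      intro x y hxy
      rw [← hve]
      simpa using hρ _ _ ((hue x y).2 hxy)
    have hb : Function.Bijective (fun x => ev.symm (ρ (eu x))) :=
      (ev.symm.bijective.comp (ρ.bijective.comp eu.bijective))
    have hid : (fun x => ev.symm (ρ (eu x))) = id := by
      apply StrictMono.range_inj hm strictMono_id |>.1
      rw [hb.2.range_eq]; simp
    ext c
    obtain ⟨x, rfl⟩ := eu.surjective c
    have := congrFun hid x
    simp only [id] at this
    rw [Equiv.symm_apply_eq] at this
    simp [this]

end DecompPf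

namespace DecompPf

open Equiv Equiv.Perm TabSub

set_option linter.unusedSectionVars false

variable {A : Type} [CommRing A] {ι : Type} [Fintype ι] [DecidableEq ι] {n : ι → ℕ} {s : ℕ}

/-- The block matrix with a single block at the columns `p`, `q`. -/
noncomputable def blk (n : ι → ℕ) (p q : ι) (f : ℕ → ℕ → A) : Matrix (TabCell n) (TabCell n) A :=
  fun c d => if c.1 = p ∧ d.1 = q then f c.2 d.2 else 0

/-- The arrows of a tableau. -/
abbrev Arr (T : TabSub A ι n s) : Type := {c : TabCell n // T.isTail c = true}

/-- The matching of the cells of a tableau. -/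
noncomputable def eT (T : TabSub A ι n s) : Arr T ⊕ Arr T ≃ TabCell n :=
  Equiv.ofBijective (Sum.elim (fun a => a.1) (fun a => T.mate a.1)) (by
    constructor
    · rintro (a | a) (b | b) h
      · simp only [Sum.elim_inl] at h; rw [Subtype.ext h]
      · simp only [Sum.elim_inl, Sum.elim_inr] at h
        have := T.isTail_mate b.1
        rw [← h, a.2, b.2] at this
        simp at this
      · simp only [Sum.elim_inl, Sum.elim_inr] at h
        have := T.isTail_mate a.1
        rw [h, a.2, b.2] at this
        simp at this
      · simp only [Sum.elim_inr] at h; rw [Subtype.ext (T.mate.injective h)]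
    · intro c
      by_cases hc : T.isTail c = true
      · exact ⟨Sum.inl ⟨c, hc⟩, rfl⟩
      · refine ⟨Sum.inr ⟨T.mate c, by rw [T.isTail_mate]; simpa using hc⟩, ?_⟩
        simp [T.mate_invol])

@[simp] theorem eT_inl (T : TabSub A ι n s) (a : Arr T) : eT T (Sum.inl a) = a.1 := rfl
@[simp] theorem eT_inr (T : TabSub A ι n s) (a : Arr T) : eT T (Sum.inr a) = T.mate a.1 := rfl

theorem prod_tails (T : TabSub A ι n s) (f : TabCell n → A) :
    ∏ c ∈ T.tails, f c = ∏ a : Arr T, f a.1 := by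
  rw [Finset.prod_subtype (F := inferInstance) T.tails (p := fun c => T.isTail c = true)]
  intro c; simp [tails]

theorem bpf0_eq_PF (T : TabSub A ι n s) :
    T.bpf0 = PF (eT T) (fun a => blk n (T.colTail (T.lab a.1)) (T.colHead (T.lab a.1))
      (castEntry (T.X (T.lab a.1)))) := by
  rw [PF_block]
  · unfold bpf0
    refine Finset.sum_congr rfl fun π _ => ?_
    rw [prod_tails]
    congr 1
    refine Finset.prod_congr rfl fun a _ => ?_
    unfold blk
    rw [if_pos]
    · rfl
    · exact ⟨(T.colTail_eq _ a.2).symm, (T.colHead_eq _ a.2).symm⟩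
  · intro a c d h
    unfold blk at h
    split_ifs at h with h1
    · rw [h1.1, h1.2]
      exact ⟨T.colTail_eq _ a.2, T.colHead_eq _ a.2⟩
    · exact absurd rfl h

theorem colpres_range (σ : Perm (TabCell n)) (hcol : ∀ c, (σ c).1 = c.1) :
    ∃ π : ∀ i, Perm (Fin (n i)), Equiv.sigmaCongrRight π = σ := by
  let f : ∀ i, Fin (n i) → Fin (n i) := fun i x => Fin.cast (congrArg n (hcol ⟨i, x⟩)) (σ ⟨i, x⟩).2
  have hf : ∀ i x, (⟨i, f i x⟩ : TabCell n) = σ ⟨i, x⟩ := by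
    intro i x
    have : ∀ (c : TabCell n) (h : c.1 = i), (⟨i, Fin.cast (congrArg n h) c.2⟩ : TabCell n) = c := by
      rintro ⟨k, y⟩ h
      subst h
      rfl
    exact this _ (hcol ⟨i, x⟩)
  have hinj : ∀ i, Function.Injective (f i) := by
    intro i x y hxy
    have h3 : σ ⟨i, x⟩ = σ ⟨i, y⟩ := by rw [← hf, ← hf, hxy]
    simpa using σ.injective h3
  refine ⟨fun i => Equiv.ofBijective (f i) (Finite.injective_iff_bijective.1 (hinj i)), ?_⟩
  ext ⟨i, x⟩ : 1
  rw [← hf]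
  rfl

theorem lab_perm (T : TabSub A ι n s) (ρ : Perm (Arr T)) (hρ : ∀ a, T.lab (ρ a).1 = T.lab a.1) :
    ∃ τ : ∀ i, Perm (Fin (n i)), sgnT τ = 1 ∧
      (∀ a : Arr T, (⟨a.1.1, τ _ a.1.2⟩ : TabCell n) = (ρ a).1) ∧
      (∀ a : Arr T, (⟨(T.mate a.1).1, τ _ (T.mate a.1).2⟩ : TabCell n) = T.mate (ρ a).1) := by
  have hl : ∀ a, (eT T).permCongr (Equiv.sumCongr ρ ρ) a.1 = (ρ a).1 := by
    intro a
    rw [← eT_inl T a, Equiv.permCongr_apply, Equiv.symm_apply_apply]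
    rfl
  have hr : ∀ a : Arr T, (eT T).permCongr (Equiv.sumCongr ρ ρ) (T.mate a.1) = T.mate (ρ a).1 := by
    intro a
    rw [← eT_inr T a, Equiv.permCongr_apply, Equiv.symm_apply_apply]
    rfl
  obtain ⟨τ, hτ⟩ := colpres_range ((eT T).permCongr (Equiv.sumCongr ρ ρ)) (by
    intro c
    obtain ⟨x, rfl⟩ := (eT T).surjective c
    rcases x with a | a
    · rw [eT_inl, hl, ← T.colTail_eq _ a.2, ← T.colTail_eq _ (ρ a).2, hρ]
    · rw [eT_inr, hr, ← T.colHead_eq _ a.2, ← T.colHead_eq _ (ρ a).2, hρ])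
  refine ⟨τ, ?_, ?_, ?_⟩
  · rw [← sign_sigma, hτ, Equiv.Perm.sign_permCongr, sign_sumCongr, Int.units_mul_self]; rfl
  · intro a; rw [← hl, ← hτ]; rfl
  · intro a; rw [← hr, ← hτ]; rfl

theorem sgnT_mul (π τ : ∀ i, Perm (Fin (n i))) : sgnT (π * τ) = sgnT π * sgnT τ := by
  simp [sgnT, Finset.prod_mul_distrib]

theorem val_of_eq {c d : TabCell n} (h : c = d) (π : ∀ i, Perm (Fin (n i))) :
    ((π c.1 c.2 : Fin _) : ℕ) = (π d.1 d.2 : Fin _) := by rw [h]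

theorem bpf0_eq (T : TabSub A ι n s) :
    T.bpf0 = ((∏ l, (Fintype.card {a : Arr T // T.lab a.1 = l}).factorial : ℕ) : A) * T.bpf := by
  let lb : Arr T → Fin s := fun a => T.lab a.1
  let G := ∀ l, Perm {a : Arr T // lb a = l}
  let R : G → Perm (Arr T) := fun g => DomMulAct.stabilizerEquiv_invFun_aux g
  have hR : ∀ (g : G) a, lb (R g a) = lb a := fun g a => DomMulAct.comp_stabilizerEquiv_invFun g a
  have hRl : ∀ (g : G) l (a : {a : Arr T // lb a = l}), R g a.1 = (g l a).1 := by
    intro g l a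
    exact DomMulAct.stabilizerEquiv_invFun_eq g a.2
  choose τ hτ1 hτ2 hτ3 using fun g : G => lab_perm T (R g) (hR g)
  let F : (∀ i, Perm (Fin (n i))) → A := fun π => sgnT π • ∏ c ∈ T.tails, T.entry π c
  have hval : ∀ (g : G) π (a : Arr T), (((π * τ g) a.1.1 a.1.2 : Fin _) : ℕ) =
      (π (R g a).1.1 (R g a).1.2 : Fin _) := by
    intro g π a
    exact val_of_eq (hτ2 g a) π
  have hval2 : ∀ (g : G) π (a : Arr T), (((π * τ g) (T.mate a.1).1 (T.mate a.1).2 : Fin _) : ℕ) =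
      (π (T.mate (R g a).1).1 (T.mate (R g a).1).2 : Fin _) := by
    intro g π a
    exact val_of_eq (hτ3 g a) π
  have hF : ∀ (g : G) π, F (π * τ g) = F π := by
    intro g π
    simp only [F]
    rw [sgnT_mul, hτ1, mul_one, prod_tails, prod_tails]
    congr 1
    rw [← Equiv.prod_comp (R g) (fun a => T.entry π a.1)]
    refine Finset.prod_congr rfl fun a _ => ?_
    unfold entry
    rw [hval, hval2]
    have : T.lab a.1 = T.lab (R g a).1 := (hR g a).symm
    rw [this]
  have hsort : ∀ π, ∃! g : G, T.SortedPi (π * τ g) := by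
    intro π
    let u : ∀ l, {a : Arr T // lb a = l} → ℕ := fun l a => (a.1.1.2 : ℕ)
    let v : ∀ l, {a : Arr T // lb a = l} → ℕ := fun l a => (π a.1.1.1 a.1.1.2 : Fin _)
    have hcol : ∀ l (a b : {a : Arr T // lb a = l}), a.1.1.1 = b.1.1.1 := by
      intro l a b
      have h1 := T.colTail_eq _ a.1.2
      have h2 := T.colTail_eq _ b.1.2
      have h3 : T.lab a.1.1 = T.lab b.1.1 := a.2.trans b.2.symm
      rw [← h1, ← h2, h3]
    have hu : ∀ l, Function.Injective (u l) := by
      intro l a b hab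
      have hc := hcol l a b
      obtain ⟨⟨⟨i, x⟩, ha⟩, ha'⟩ := a
      obtain ⟨⟨⟨k, y⟩, hb⟩, hb'⟩ := b
      simp only at hc
      subst hc
      simp only [u] at hab
      have : x = y := Fin.ext hab
      subst this
      rfl
    have hv : ∀ l, Function.Injective (v l) := by
      intro l a b hab
      have hc := hcol l a b
      obtain ⟨⟨⟨i, x⟩, ha⟩, ha'⟩ := a
      obtain ⟨⟨⟨k, y⟩, hb⟩, hb'⟩ := b
      simp only at hc
      subst hc
      simp only [v] at hab
      have : x = y := (π i).injective (Fin.ext hab)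
      subst this
      rfl
    have hiff : ∀ g : G, T.SortedPi (π * τ g) ↔
        ∀ l, ∀ c d, u l c < u l d → v l (g l c) < v l (g l d) := by
      intro g
      constructor
      · intro h l c d hcd
        have h1 := h c.1.1 (by simp [tails, c.1.2]) d.1.1 (by simp [tails, d.1.2])
          (c.2.trans d.2.symm) hcd
        rw [hval, hval, hRl, hRl] at h1
        exact h1
      · intro h c hc d hd hl hcd
        have hc' : T.isTail c = true := by simpa [tails] using hc
        have hd' : T.isTail d = true := by simpa [tails] using hd
        have h1 := h (T.lab c) ⟨⟨c, hc'⟩, rfl⟩ ⟨⟨d, hd'⟩, hl.symm⟩ hcd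
        have e1 := hval g π ⟨c, hc'⟩
        have e2 := hval g π ⟨d, hd'⟩
        have e3 := hRl g (T.lab c) ⟨⟨c, hc'⟩, rfl⟩
        have e4 := hRl g (T.lab c) ⟨⟨d, hd'⟩, hl.symm⟩
        simp only at e1 e2 e3 e4
        rw [e1, e2, e3, e4]
        exact h1
    simp only [hiff]
    choose g hg hgu using fun l => sort_unique (u l) (v l) (hu l) (hv l)
    refine ⟨g, hg, ?_⟩
    intro g' hg'
    funext l
    exact hgu l (g' l) (hg' l)
  have hcard : Fintype.card G = ∏ l, (Fintype.card {a : Arr T // T.lab a.1 = l}).factorial := by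
    rw [Fintype.card_pi]
    refine Finset.prod_congr rfl fun l _ => ?_
    rw [Fintype.card_perm]
  have hb : T.bpf = ∑ π, if T.SortedPi π then F π else 0 := by
    unfold bpf
    rw [Finset.sum_filter]
  have h1 : ∀ g : G, T.bpf = ∑ π, if T.SortedPi (π * τ g) then F π else 0 := by
    intro g
    rw [hb, ← Equiv.sum_comp (Equiv.mulRight (τ g))]
    refine Finset.sum_congr rfl fun π _ => ?_
    simp only [Equiv.coe_mulRight, hF]
  have h2 : ∑ g : G, T.bpf = T.bpf0 := by
    rw [Finset.sum_congr rfl (fun g _ => h1 g), Finset.sum_comm]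
    unfold bpf0
    refine Finset.sum_congr rfl fun π _ => ?_
    obtain ⟨g, hg, hgu⟩ := hsort π
    rw [Finset.sum_eq_single g]
    · rw [if_pos hg]
    · intro g' _ hne
      rw [if_neg]
      intro h; exact hne (hgu g' h)
    · simp
  rw [← h2, Finset.sum_const, nsmul_eq_mul, Finset.card_univ, hcard]

end DecompPf

namespace DecompPf

open Equiv Equiv.Perm TabSub

set_option linter.unusedSectionVars false

section blkalg

variable {A : Type} [CommRing A] {ι : Type} [Fintype ι] [DecidableEq ι] {n : ι → ℕ}

/-- The product of two matrices indexed by natural numbers. -/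
def mulN (b : ℕ) (f g : ℕ → ℕ → A) : ℕ → ℕ → A :=
  fun i j => ∑ p ∈ Finset.range b, f i p * g p j

/-- The transpose. -/
def trN (f : ℕ → ℕ → A) : ℕ → ℕ → A := fun i j => f j i

/-- The identity matrix. -/
def delN : ℕ → ℕ → A := fun i j => if i = j then 1 else 0

/-- `f` is supported in an `x × y` rectangle. -/
def SuppN (x y : ℕ) (f : ℕ → ℕ → A) : Prop := ∀ i j, f i j ≠ 0 → i < x ∧ j < y

theorem SuppN.tr {x y : ℕ} {f : ℕ → ℕ → A} (h : SuppN x y f) : SuppN y x (trN f) :=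
  fun i j hij => (h j i hij).symm

theorem SuppN.mul {x y z w b : ℕ} {f g : ℕ → ℕ → A} (h : SuppN x y f) (h' : SuppN z w g) :
    SuppN x w (mulN b f g) := by
  intro i j hij
  obtain ⟨p, _, hp⟩ := Finset.exists_ne_zero_of_sum_ne_zero hij
  exact ⟨(h i p (left_ne_zero_of_mul hp)).1, (h' p j (right_ne_zero_of_mul hp)).2⟩

theorem blk_transpose (p q : ι) (f : ℕ → ℕ → A) :
    (blk n p q f).transpose = blk n q p (trN f) := by
  ext c d
  simp only [Matrix.transpose_apply, blk, trN, and_comm]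

theorem sum_cells (q : ι) (F : TabCell n → A) (h : ∀ c, c.1 ≠ q → F c = 0) :
    ∑ c, F c = ∑ x : Fin (n q), F ⟨q, x⟩ := by
  rw [Fintype.sum_sigma, Finset.sum_eq_single q]
  · intro i _ hi; exact Finset.sum_eq_zero fun x _ => h ⟨i, x⟩ hi
  · simp

theorem le_dimBound (q : ι) : n q ≤ dimBound n :=
  Finset.single_le_sum (f := n) (fun _ _ => Nat.zero_le _) (Finset.mem_univ q)

theorem blk_mul_ne {p q q' r : ι} (f g : ℕ → ℕ → A) (h : q ≠ q') :
    blk n p q f * blk n q' r g = 0 := by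
  ext c d
  rw [Matrix.mul_apply]
  refine Finset.sum_eq_zero fun x _ => ?_
  unfold blk
  by_cases h1 : x.1 = q
  · rw [if_neg (c := x.1 = q' ∧ _), mul_zero]
    rintro ⟨h2, _⟩; exact h (h1.symm.trans h2)
  · rw [if_neg, zero_mul]
    rintro ⟨_, h2⟩; exact h1 h2

theorem blk_mul' (p q r : ι) (f g : ℕ → ℕ → A) :
    blk n p q f * blk n q r g = blk n p r (mulN (n q) f g) := by
  ext c d
  rw [Matrix.mul_apply, sum_cells q]
  · unfold blk mulN
    by_cases hc : c.1 = p
    · by_cases hd : d.1 = r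
      · simp only [hc, hd, and_self, if_true]
        rw [Finset.sum_range]
      · simp [hd]
    · simp [hc]
  · intro x hx
    unfold blk
    rw [if_neg, zero_mul]
    rintro ⟨_, h2⟩; exact hx h2

theorem mulN_mono {a b z : ℕ} {f g : ℕ → ℕ → A} (hab : a ≤ b) (hg : SuppN a z g) :
    mulN a f g = mulN b f g := by
  funext i j
  unfold mulN
  refine Finset.sum_subset (Finset.range_mono hab) ?_
  intro p _ hp
  by_contra h
  exact hp (Finset.mem_range.2 (hg p j (right_ne_zero_of_mul h)).1)

theorem blk_mul (p q r : ι) (f g : ℕ → ℕ → A) (hg : SuppN (n q) (n r) g) :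
    blk n p q f * blk n q r g = blk n p r (mulN (dimBound n) f g) := by
  rw [blk_mul', mulN_mono (le_dimBound q) hg]

theorem del_mul (p q r : ι) (hpq : n p = n q) (f : ℕ → ℕ → A) :
    blk n p q delN * blk n q r f = blk n p r f := by
  rw [blk_mul']
  ext c d
  unfold blk
  split_ifs with h
  · unfold mulN delN
    rw [Finset.sum_eq_single (c.2 : ℕ)]
    · simp
    · intro b _ hb; rw [if_neg (Ne.symm hb), zero_mul]
    · intro hc
      exfalso; apply hc
      rw [Finset.mem_range, ← hpq, ← h.1]; exact c.2.2
  · rfl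

theorem mul_del (p q r : ι) (hqr : n q = n r) (f : ℕ → ℕ → A) :
    blk n p q f * blk n q r delN = blk n p r f := by
  have h := del_mul r q p hqr.symm (trN f)
  have h2 := congrArg Matrix.transpose h
  rw [Matrix.transpose_mul, blk_transpose, blk_transpose, blk_transpose] at h2
  have h3 : trN (delN : ℕ → ℕ → A) = delN := by
    funext i j; simp [trN, delN, eq_comm]
  rw [h3] at h2
  exact h2

theorem blk_neg (p q : ι) (f : ℕ → ℕ → A) (a : A) : blk n p q (fun i j => a * f i j) = a • blk n p q f := by
  ext c d; simp only [blk, Matrix.smul_apply, smul_eq_mul]; split_ifs <;> simp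

theorem det_unip (r j : ι) (hrj : r ≠ j) (a : A) (f : ℕ → ℕ → A) :
    (1 + a • blk n r j f).det = 1 := by
  have h : a • blk n r j f = blk n r r delN * (a • blk n r j f) := by
    rw [Matrix.mul_smul, del_mul r r j rfl]
  rw [h, Matrix.det_one_add_mul_comm, Matrix.smul_mul, blk_mul_ne _ _ hrj.symm, smul_zero, add_zero,
    Matrix.det_one]

theorem det_blk (q : ι) (a : A) (f : ℕ → ℕ → A) (hf : SuppN (n q) (n q) f) :
    (1 + a • blk n q q f).det =
      (1 + a • (Matrix.of fun i j : Fin (dimBound n) => f i j)).det := by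
  let E : Matrix (TabCell n) (Fin (dimBound n)) A :=
    Matrix.of fun c p => if c.1 = q ∧ (c.2 : ℕ) = p then 1 else 0
  let F : Matrix (Fin (dimBound n)) (Fin (dimBound n)) A := Matrix.of fun i j => f i j
  have h1 : E * (F * E.transpose) = blk n q q f := by
    ext c d
    have hc : ∀ c : TabCell n, (c.2 : ℕ) < dimBound n := fun c => c.2.2.trans_le (le_dimBound c.1)
    rw [Matrix.mul_apply, Finset.sum_eq_single ⟨c.2, hc c⟩, Matrix.mul_apply,
      Finset.sum_eq_single ⟨d.2, hc d⟩]
    · simp only [E, F, Matrix.transpose_apply, Matrix.of_apply, blk]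
      by_cases h1 : c.1 = q <;> by_cases h2 : d.1 = q <;> simp [h1, h2]
    · intro p _ hp
      simp only [Matrix.transpose_apply, E, Matrix.of_apply]
      rw [if_neg, mul_zero]
      rintro ⟨_, h⟩; exact hp (Fin.ext h.symm)
    · simp
    · intro p _ hp
      simp only [E, Matrix.transpose_apply, Matrix.of_apply]
      rw [if_neg, zero_mul]
      rintro ⟨_, h⟩; exact hp (Fin.ext h.symm)
    · simp
  have h2 : F * E.transpose * E = F := by
    rw [Matrix.mul_assoc]
    ext i j
    by_cases hj : (j : ℕ) < n q
    · have : ∀ p, (E.transpose * E) p j = if p = j then 1 else 0 := by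
        intro p
        rw [Matrix.mul_apply, Finset.sum_eq_single (⟨q, ⟨j, hj⟩⟩ : TabCell n)]
        · simp [E, Fin.ext_iff, eq_comm]
        · rintro ⟨c, x⟩ _ hc
          simp only [E, Matrix.transpose_apply, Matrix.of_apply]
          rw [if_neg (c := c = q ∧ (x : ℕ) = j), mul_zero]
          rintro ⟨h, h'⟩
          subst h
          apply hc
          congr 1
          exact Fin.ext h'
        · simp
      rw [Matrix.mul_apply]
      simp [this]
    · have h0 : ∀ i, f i j = 0 := by
        intro i; by_contra h; exact hj (hf i j h).2
      rw [Matrix.mul_apply]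
      simp only [F, Matrix.of_apply, h0]
      refine Finset.sum_eq_zero fun p _ => ?_
      rw [Matrix.mul_apply, Finset.sum_eq_zero, mul_zero]
      rintro ⟨c, x⟩ _
      simp only [E, Matrix.transpose_apply, Matrix.of_apply]
      rw [if_neg (c := c = q ∧ (x : ℕ) = j), mul_zero]
      rintro ⟨h, h'⟩
      subst h
      exact hj (h' ▸ x.2)
  rw [← h1, ← Matrix.mul_smul, Matrix.det_one_add_mul_comm, Matrix.smul_mul, h2]

theorem sigma_zero (b N k : ℕ) (hN : N ≤ b) (hk : N < k) (hkb : k ≤ b) (f : ℕ → ℕ → A)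
    (hf : SuppN N N f) :
    (Matrix.of fun i j : Fin b => f i j).charpoly.coeff (b - k) = 0 := by
  let P : Matrix (Fin b) (Fin N) A := fun i p => if (i : ℕ) = p then 1 else 0
  let F : Matrix (Fin N) (Fin b) A := Matrix.of fun i j => f i j
  have h : P * F = Matrix.of fun i j : Fin b => f i j := by
    ext i j
    rw [Matrix.mul_apply]
    by_cases hi : (i : ℕ) < N
    · rw [Finset.sum_eq_single ⟨i, hi⟩]
      · simp [P, F]
      · intro p _ hp
        simp only [P]
        rw [if_neg, zero_mul]
        intro h; exact hp (Fin.ext h.symm)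
      · simp
    · have : f i j = 0 := by by_contra h; exact hi (hf _ _ h).1
      rw [Matrix.of_apply, this]
      refine Finset.sum_eq_zero fun p _ => ?_
      simp only [P]
      rw [if_neg, zero_mul]
      intro h; exact hi (h ▸ p.2)
  have h2 := Matrix.charpoly_mul_comm_of_le P F (by simpa using hN)
  rw [← h, h2, Polynomial.coeff_X_pow_mul']
  rw [if_neg]
  simp only [Fintype.card_fin]
  omega

theorem det_mem [Nontrivial A] (C : Subring A) (N : ℕ) (q : ι) (hq : n q = N) (a : A) (ha : a ∈ C)
    (f : ℕ → ℕ → A) (hf : SuppN (n q) (n q) f)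
    (hs : ∀ k, 1 ≤ k → k ≤ N →
      sigmaCoeff (dimBound n) (Matrix.of fun i j : Fin (dimBound n) => f i j) k ∈ C) :
    (1 + a • blk n q q f).det ∈ C := by
  rw [det_blk q a f hf]
  subst hq
  set M : Matrix (Fin (dimBound n)) (Fin (dimBound n)) A := Matrix.of fun i j => f i j with hM
  have h1 : (1 + a • M).det = M.charpolyRev.eval (-a) := by
    unfold Matrix.charpolyRev
    rw [← Polynomial.coe_evalRingHom, RingHom.map_det]
    congr 1
    ext i j
    by_cases hij : i = j
    · subst hij; simp; exact mul_comm _ _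
    · simp [Matrix.one_apply_ne hij]; exact mul_comm _ _
  rw [h1, ← Matrix.reverse_charpoly, Polynomial.eval_eq_sum_range]
  refine Subring.sum_mem _ fun k hk => Subring.mul_mem _ ?_ (Subring.pow_mem _ (Subring.neg_mem _ ha) _)
  rw [Polynomial.coeff_reverse, Matrix.charpoly_natDegree_eq_dim, Fintype.card_fin]
  have hk' : k ≤ dimBound n := by
    have := Polynomial.reverse_natDegree_le M.charpoly
    rw [Matrix.charpoly_natDegree_eq_dim, Fintype.card_fin] at this
    have := Finset.mem_range.1 hk
    omega
  rw [Polynomial.revAt_le hk']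
  rcases Nat.eq_zero_or_pos k with rfl | hk0
  · have := (Matrix.charpoly_monic M).coeff_natDegree
    rw [Matrix.charpoly_natDegree_eq_dim, Fintype.card_fin] at this
    rw [Nat.sub_zero, this]; exact Subring.one_mem _
  by_cases hkN : k ≤ n q
  · have h3 := hs k hk0 hkN
    have h4 : M.charpoly.coeff (dimBound n - k) = (-1) ^ k * sigmaCoeff (dimBound n) M k := by
      unfold sigmaCoeff
      rw [← mul_assoc, ← mul_pow]; simp
    rw [h4]
    exact Subring.mul_mem _ (Subring.pow_mem _ (Subring.neg_mem _ (Subring.one_mem _)) _) h3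
  · rw [sigma_zero _ (n q) k (le_dimBound q) (by omega) hk' f hf]
    exact Subring.zero_mem _

end blkalg

end DecompPf

namespace DecompPf

open Equiv Equiv.Perm TabSub

set_option linter.unusedSectionVars false

section elim

variable {Q : Type} [CommRing Q] {ι : Type} [Fintype ι] [DecidableEq ι]

/-- The data for the elimination procedure. -/
structure Ctx (Q : Type) [CommRing Q] (ι : Type) [Fintype ι] [DecidableEq ι] where
  n : ι → ℕ
  q1 : ι
  q2 : ι
  hq : q1 ≠ q2
  hn : n q1 = n q2
  C : Subring Q
  J : Ideal Q
  W : Set (ℕ → ℕ → Q)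
  W_mul : ∀ f ∈ W, ∀ g ∈ W, mulN (dimBound n) f g ∈ W
  W_tr : ∀ f ∈ W, trN f ∈ W
  W_sig : ∀ f ∈ W, ∀ k, 1 ≤ k → k ≤ n q1 →
    sigmaCoeff (dimBound n) (Matrix.of fun i j : Fin (dimBound n) => f i j) k ∈ C

namespace Ctx

variable (G : Ctx Q ι)

/-- Touching one of the distinguished columns. -/
def Tch (p q : ι) : Prop := p = G.q1 ∨ p = G.q2 ∨ q = G.q1 ∨ q = G.q2

/-- Touching generators. -/
def TG (d : ℕ) : Set (Matrix (TabCell G.n) (TabCell G.n) Q) :=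
  {M | ∃ p q f a, G.Tch p q ∧ f ∈ G.W ∧ SuppN (G.n p) (G.n q) f ∧ a ∈ G.C ∧ a ∈ G.J ^ d ∧
    M = a • blk G.n p q f}

/-- Non-touching generators. -/
def NG : Set (Matrix (TabCell G.n) (TabCell G.n) Q) :=
  {M | ∃ p q f a, ¬ G.Tch p q ∧ f ∈ G.W ∧ SuppN (G.n p) (G.n q) f ∧ a ∈ G.C ∧ a ∈ G.J ∧
    M = a • blk G.n p q f}

/-- The additive group spanned by the generators. -/
def LL (d : ℕ) : AddSubgroup (Matrix (TabCell G.n) (TabCell G.n) Q) :=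
  AddSubgroup.closure (G.TG d ∪ G.NG)

/-- Generators of the group of row operations. -/
def VG (d : ℕ) : Set (Matrix (TabCell G.n) (TabCell G.n) Q) :=
  {M | ∃ r j f a, (r = G.q1 ∨ r = G.q2) ∧ f ∈ G.W ∧ SuppN (G.n r) (G.n j) f ∧ a ∈ G.C ∧
    a ∈ G.J ^ d ∧ M = a • blk G.n r j f}

/-- The additive group of row operations. -/
def VV (d : ℕ) : AddSubgroup (Matrix (TabCell G.n) (TabCell G.n) Q) :=
  AddSubgroup.closure (G.VG d)

theorem gen_mem {d : ℕ} {p q : ι} {f : ℕ → ℕ → Q} {a : Q} (hf : f ∈ G.W)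
    (hs : SuppN (G.n p) (G.n q) f) (ha : a ∈ G.C) (hd : 1 ≤ d) (ha' : a ∈ G.J ^ d) :
    a • blk G.n p q f ∈ G.LL d := by
  apply AddSubgroup.subset_closure
  by_cases h : G.Tch p q
  · exact Or.inl ⟨p, q, f, a, h, hf, hs, ha, ha', rfl⟩
  · exact Or.inr ⟨p, q, f, a, h, hf, hs, ha, by
      have := Ideal.pow_le_pow_right hd ha'; simpa using this, rfl⟩

theorem LL_anti {d d' : ℕ} (h : d ≤ d') : G.LL d' ≤ G.LL d := by
  apply AddSubgroup.closure_mono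
  rintro M (⟨p, q, f, a, h1, h2, h3, h4, h5, h6⟩ | hM)
  · exact Or.inl ⟨p, q, f, a, h1, h2, h3, h4, Ideal.pow_le_pow_right h h5, h6⟩
  · exact Or.inr hM

theorem VV_anti {d d' : ℕ} (h : d ≤ d') : G.VV d' ≤ G.VV d := by
  apply AddSubgroup.closure_mono
  rintro M ⟨p, q, f, a, h1, h2, h3, h4, h5, h6⟩
  exact ⟨p, q, f, a, h1, h2, h3, h4, Ideal.pow_le_pow_right h h5, h6⟩

theorem Tch_symm {p q : ι} (h : G.Tch p q) : G.Tch q p := by unfold Tch at *; tauto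

theorem LL_tr {d : ℕ} {X : Matrix (TabCell G.n) (TabCell G.n) Q} (hX : X ∈ G.LL d) :
    X.transpose ∈ G.LL d := by
  induction hX using AddSubgroup.closure_induction with
  | mem M hM =>
    apply AddSubgroup.subset_closure
    rcases hM with ⟨p, q, f, a, h1, h2, h3, h4, h5, rfl⟩ | ⟨p, q, f, a, h1, h2, h3, h4, h5, rfl⟩
    · refine Or.inl ⟨q, p, trN f, a, G.Tch_symm h1, G.W_tr f h2, h3.tr, h4, h5, ?_⟩
      rw [Matrix.transpose_smul, blk_transpose]
    · refine Or.inr ⟨q, p, trN f, a, fun h => h1 (G.Tch_symm h), G.W_tr f h2, h3.tr, h4, h5, ?_⟩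
      rw [Matrix.transpose_smul, blk_transpose]
  | zero => rw [Matrix.transpose_zero]; exact AddSubgroup.zero_mem _
  | add x y _ _ hx hy => rw [Matrix.transpose_add]; exact AddSubgroup.add_mem _ hx hy
  | neg x _ hx => rw [Matrix.transpose_neg]; exact AddSubgroup.neg_mem _ hx

theorem LL_mul_VV {d d' : ℕ} (hd : 1 ≤ d) {X V : Matrix (TabCell G.n) (TabCell G.n) Q}
    (hX : X ∈ G.LL d) (hV : V ∈ G.VV d') : X * V ∈ G.LL (d + d') := by
  induction hV using AddSubgroup.closure_induction with
  | mem V hV =>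
    obtain ⟨r, j, g, b, k1, k2, k3, k4, k5, rfl⟩ := hV
    induction hX using AddSubgroup.closure_induction with
    | mem M hM =>
      rcases hM with ⟨p, q, f, a, h1, h2, h3, h4, h5, rfl⟩ | ⟨p, q, f, a, h1, h2, h3, h4, h5, rfl⟩
      · by_cases hqr : q = r
        · subst hqr
          rw [Matrix.smul_mul, Matrix.mul_smul, smul_smul, blk_mul _ _ _ _ _ k3]
          exact G.gen_mem (G.W_mul _ h2 _ k2) (h3.mul k3) (G.C.mul_mem h4 k4) (by omega)
            (by rw [pow_add]; exact Ideal.mul_mem_mul h5 k5)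
        · rw [Matrix.smul_mul, Matrix.mul_smul, blk_mul_ne _ _ hqr, smul_zero, smul_zero]
          exact AddSubgroup.zero_mem _
      · have hqr : q ≠ r := by
          rintro rfl; apply h1; unfold Tch; tauto
        rw [Matrix.smul_mul, Matrix.mul_smul, blk_mul_ne _ _ hqr, smul_zero, smul_zero]
        exact AddSubgroup.zero_mem _
    | zero => rw [Matrix.zero_mul]; exact AddSubgroup.zero_mem _
    | add x y _ _ hx hy => rw [Matrix.add_mul]; exact AddSubgroup.add_mem _ hx hy
    | neg x _ hx => rw [Matrix.neg_mul]; exact AddSubgroup.neg_mem _ hx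
  | zero => rw [Matrix.mul_zero]; exact AddSubgroup.zero_mem _
  | add x y _ _ hx hy => rw [Matrix.mul_add]; exact AddSubgroup.add_mem _ hx hy
  | neg x _ hx => rw [Matrix.mul_neg]; exact AddSubgroup.neg_mem _ hx

theorem VV_mul_VV {d d' : ℕ} {X V : Matrix (TabCell G.n) (TabCell G.n) Q}
    (hX : X ∈ G.VV d) (hV : V ∈ G.VV d') : X * V ∈ G.VV (d + d') := by
  induction hV using AddSubgroup.closure_induction with
  | mem V hV =>
    obtain ⟨r, j, g, b, k1, k2, k3, k4, k5, rfl⟩ := hV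
    induction hX using AddSubgroup.closure_induction with
    | mem M hM =>
      obtain ⟨p, q, f, a, h1, h2, h3, h4, h5, rfl⟩ := hM
      by_cases hqr : q = r
      · subst hqr
        rw [Matrix.smul_mul, Matrix.mul_smul, smul_smul, blk_mul _ _ _ _ _ k3]
        exact AddSubgroup.subset_closure ⟨p, j, _, _, h1, G.W_mul _ h2 _ k2, h3.mul k3,
          G.C.mul_mem h4 k4, by rw [pow_add]; exact Ideal.mul_mem_mul h5 k5, rfl⟩
      · rw [Matrix.smul_mul, Matrix.mul_smul, blk_mul_ne _ _ hqr, smul_zero, smul_zero]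
        exact AddSubgroup.zero_mem _
    | zero => rw [Matrix.zero_mul]; exact AddSubgroup.zero_mem _
    | add x y _ _ hx hy => rw [Matrix.add_mul]; exact AddSubgroup.add_mem _ hx hy
    | neg x _ hx => rw [Matrix.neg_mul]; exact AddSubgroup.neg_mem _ hx
  | zero => rw [Matrix.mul_zero]; exact AddSubgroup.zero_mem _
  | add x y _ _ hx hy => rw [Matrix.mul_add]; exact AddSubgroup.add_mem _ hx hy
  | neg x _ hx => rw [Matrix.mul_neg]; exact AddSubgroup.neg_mem _ hx

theorem VV_pow {d : ℕ} {V : Matrix (TabCell G.n) (TabCell G.n) Q}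
    (hV : V ∈ G.VV d) (k : ℕ) : V ^ (k + 1) ∈ G.VV (d * (k + 1)) := by
  induction k with
  | zero => simpa using hV
  | succ k ih => rw [pow_succ, mul_add, mul_one]; exact G.VV_mul_VV ih hV

theorem VV_entry {d : ℕ} {V : Matrix (TabCell G.n) (TabCell G.n) Q}
    (hV : V ∈ G.VV d) (c e : TabCell G.n) : V c e ∈ G.J ^ d := by
  induction hV using AddSubgroup.closure_induction with
  | mem V hV =>
    obtain ⟨r, j, g, b, k1, k2, k3, k4, k5, rfl⟩ := hV
    rw [Matrix.smul_apply, smul_eq_mul]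
    exact Ideal.mul_mem_right _ _ k5
  | zero => exact Ideal.zero_mem _
  | add x y _ _ hx hy => exact Ideal.add_mem _ hx hy
  | neg x _ hx => exact neg_mem hx

/-- The pairing of the distinguished columns. -/
noncomputable def EE : Matrix (TabCell G.n) (TabCell G.n) Q := blk G.n G.q1 G.q2 delN

variable {S : Type} [Fintype S] [DecidableEq S] (e : S ⊕ S ≃ TabCell G.n)

/-- The desired property of a matrix. -/
def Good (M : Matrix (TabCell G.n) (TabCell G.n) Q) : Prop :=
  ∃ c ∈ G.C, PF e (fun _ => M) - ((Fintype.card S).factorial : Q) * c ∈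
    G.J ^ (Fintype.card S + 1)

theorem good_conj (h M : Matrix (TabCell G.n) (TabCell G.n) Q) (c : Q) (hc : c ∈ G.C)
    (hch : c * h.det - 1 ∈ G.J ^ (Fintype.card S + 1))
    (hg : G.Good e (h.transpose * M * h)) : G.Good e M := by
  obtain ⟨x, hx, hx'⟩ := hg
  refine ⟨c * x, G.C.mul_mem hc hx, ?_⟩
  rw [PF_conj] at hx'
  have := Ideal.sub_mem _ (Ideal.mul_mem_left _ c hx') (Ideal.mul_mem_right (PF e fun _ => M) _ hch)
  convert this using 1
  ring

theorem conj_diff {d : ℕ} (hd : 1 ≤ d) {X V : Matrix (TabCell G.n) (TabCell G.n) Q}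
    (hX : X ∈ G.LL d) (hV : V ∈ G.VV d) :
    ∃ Y ∈ G.LL (d + 1), (1 + V).transpose * X * (1 + V) = X + Y := by
  have h1 : ∀ X ∈ G.LL d, X * V ∈ G.LL (d + 1) := fun X hX =>
    G.LL_anti (by omega) (G.LL_mul_VV hd hX hV)
  have h2 : V.transpose * X ∈ G.LL (d + 1) := by
    have := G.LL_tr (h1 _ (G.LL_tr hX))
    rwa [Matrix.transpose_mul, Matrix.transpose_transpose] at this
  refine ⟨V.transpose * X + X * V + V.transpose * X * V, ?_, ?_⟩
  · exact add_mem (add_mem h2 (h1 X hX)) (G.LL_anti (by omega) (h1 _ (G.LL_anti (by omega) h2)))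
  · rw [Matrix.transpose_add, Matrix.transpose_one]
    noncomm_ring

theorem elim_aux {d : ℕ} (hd : 1 ≤ d) {X V g R : Matrix (TabCell G.n) (TabCell G.n) Q}
    (hX : X ∈ G.LL d) (hV : V ∈ G.VV d) (hR : R ∈ G.LL (d + 1))
    (hg : (1 + V).transpose * (G.EE + g) * (1 + V) = G.EE + R) (c : Q) (hc : c ∈ G.C)
    (hch : c * (1 + V).det - 1 ∈ G.J ^ (Fintype.card S + 1)) :
    ∃ Y ∈ G.LL (d + 1), G.Good e (G.EE + (X + Y)) → G.Good e (G.EE + g + X) := by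
  obtain ⟨Y, hY, hY'⟩ := G.conj_diff hd hX hV
  refine ⟨Y + R, add_mem hY hR, fun h => ?_⟩
  refine G.good_conj e (1 + V) _ c hc hch ?_
  rw [Matrix.mul_add _ (G.EE + g) X, Matrix.add_mul, hg, hY']
  convert h using 1
  abel

theorem elim_A {d : ℕ} (hd : 1 ≤ d) {X : Matrix (TabCell G.n) (TabCell G.n) Q}
    (hX : X ∈ G.LL d) (j : ι) (hj : j ≠ G.q2) (f : ℕ → ℕ → Q) (hf : f ∈ G.W)
    (hs : SuppN (G.n G.q1) (G.n j) f) (a : Q) (ha : a ∈ G.C) (ha' : a ∈ G.J ^ d) :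
    ∃ Y ∈ G.LL (d + 1), G.Good e (G.EE + (X + Y)) →
      G.Good e (G.EE + a • blk G.n G.q1 j f + X) := by
  refine G.elim_aux e hd hX (V := (-a) • blk G.n G.q2 j f) ?_ (AddSubgroup.zero_mem _) ?_ 1
    (Subring.one_mem _) ?_
  · exact AddSubgroup.subset_closure ⟨_, _, f, -a, Or.inr rfl, hf, G.hn ▸ hs, neg_mem ha,
      neg_mem ha', rfl⟩
  · simp only [EE, Matrix.transpose_add, Matrix.transpose_one, Matrix.transpose_smul,
      blk_transpose, Matrix.add_mul, Matrix.mul_add, Matrix.one_mul, Matrix.mul_one,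
      Matrix.smul_mul, Matrix.mul_smul]
    rw [del_mul _ _ _ G.hn, blk_mul_ne _ _ hj, blk_mul_ne _ _ G.hq.symm, blk_mul_ne _ _ G.hq.symm]
    simp
  · rw [det_unip _ _ hj.symm]; simp

theorem elim_B {d : ℕ} (hd : 1 ≤ d) {X : Matrix (TabCell G.n) (TabCell G.n) Q}
    (hX : X ∈ G.LL d) (j : ι) (hj : j ≠ G.q1) (f : ℕ → ℕ → Q) (hf : f ∈ G.W)
    (hs : SuppN (G.n j) (G.n G.q2) f) (a : Q) (ha : a ∈ G.C) (ha' : a ∈ G.J ^ d) :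
    ∃ Y ∈ G.LL (d + 1), G.Good e (G.EE + (X + Y)) →
      G.Good e (G.EE + a • blk G.n j G.q2 f + X) := by
  refine G.elim_aux e hd hX (V := (-a) • blk G.n G.q1 j (trN f)) ?_ (AddSubgroup.zero_mem _) ?_ 1
    (Subring.one_mem _) ?_
  · exact AddSubgroup.subset_closure ⟨_, _, _, -a, Or.inl rfl, G.W_tr f hf, G.hn ▸ hs.tr,
      neg_mem ha, neg_mem ha', rfl⟩
  · have : trN (trN f) = f := rfl
    simp only [EE, Matrix.transpose_add, Matrix.transpose_one, Matrix.transpose_smul,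
      blk_transpose, Matrix.add_mul, Matrix.mul_add, Matrix.one_mul, Matrix.mul_one,
      Matrix.smul_mul, Matrix.mul_smul, this]
    rw [mul_del _ _ _ G.hn, blk_mul_ne (q := G.q2) (q' := G.q1) _ _ G.hq.symm,
      blk_mul_ne (q := G.q1) (q' := j) _ _ hj.symm,
      blk_mul_ne (q := G.q2) (q' := G.q1) _ _ G.hq.symm]
    simp
  · rw [det_unip _ _ hj.symm]; simp

theorem elim_C [Nontrivial Q] {d : ℕ} (hd : 1 ≤ d) {X : Matrix (TabCell G.n) (TabCell G.n) Q}
    (hX : X ∈ G.LL d) (f : ℕ → ℕ → Q) (hf : f ∈ G.W)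
    (hs : SuppN (G.n G.q1) (G.n G.q2) f) (a : Q) (ha : a ∈ G.C) (ha' : a ∈ G.J ^ d) :
    ∃ Y ∈ G.LL (d + 1), G.Good e (G.EE + (X + Y)) →
      G.Good e (G.EE + a • blk G.n G.q1 G.q2 f + X) := by
  set F := (-a) • blk G.n G.q2 G.q2 f with hF
  set K := Fintype.card S + 2 with hK
  set R := ∑ i ∈ Finset.range (K - 1), F ^ i with hR
  have hs' : SuppN (G.n G.q2) (G.n G.q2) f := G.hn ▸ hs
  have hFV : F ∈ G.VV d := AddSubgroup.subset_closure ⟨_, _, f, -a, Or.inr rfl, hf, hs',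
    neg_mem ha, neg_mem ha', rfl⟩
  have hgs : 1 + F * R = ∑ i ∈ Finset.range K, F ^ i := by
    rw [show K = (K - 1) + 1 by omega, Finset.sum_range_succ', pow_zero, add_comm, hR,
      Finset.mul_sum]
    congr 1
    exact Finset.sum_congr rfl fun i _ => (pow_succ' F i).symm
  have hFR : F * R ∈ G.VV d := by
    rw [hR, Finset.mul_sum]
    refine AddSubgroup.sum_mem _ fun i _ => ?_
    rw [← pow_succ']
    exact G.VV_anti (by nlinarith) (G.VV_pow hFV i)
  have hEF : G.EE * F = (-a) • blk G.n G.q1 G.q2 f := by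
    rw [EE, hF, Matrix.mul_smul, del_mul _ _ _ G.hn]
  have h1 : G.EE + a • blk G.n G.q1 G.q2 f = G.EE * (1 - F) := by
    rw [Matrix.mul_sub, hEF, Matrix.mul_one, neg_smul, sub_neg_eq_add]
  have h2 : (1 - F) * (1 + F * R) = 1 - F ^ K := by rw [hgs, mul_neg_geom_sum]
  have h3 : F.transpose * G.EE = 0 := by
    rw [hF, Matrix.transpose_smul, blk_transpose, EE, Matrix.smul_mul, blk_mul_ne _ _ G.hq.symm,
      smul_zero]
  have h4 : (1 + F * R).transpose * G.EE = G.EE := by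
    rw [Matrix.transpose_add, Matrix.transpose_one, Matrix.transpose_mul]
    have hcomm : F * R = R * F := by
      rw [hR, Finset.mul_sum, Finset.sum_mul]
      exact Finset.sum_congr rfl fun i _ => by rw [← pow_succ', ← pow_succ]
    rw [← Matrix.transpose_mul, hcomm, hcomm.symm, Matrix.transpose_mul, Matrix.add_mul,
      Matrix.mul_assoc, h3, Matrix.mul_zero, Matrix.one_mul, add_zero]
  have h5 : G.EE * F ^ K ∈ G.LL (d + 1) := by
    rw [show K = (Fintype.card S + 1) + 1 by omega, pow_succ', ← Matrix.mul_assoc, hEF]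
    refine G.LL_anti (?_ : d + 1 ≤ d + d * (Fintype.card S + 1))
      (G.LL_mul_VV hd (G.gen_mem hf hs (neg_mem ha) hd (neg_mem ha')) (G.VV_pow hFV _))
    nlinarith
  refine G.elim_aux e hd hX (V := F * R) (R := -(G.EE * F ^ K)) hFR (neg_mem h5) ?_ (1 - F).det ?_ ?_
  · rw [h1, Matrix.mul_assoc, Matrix.mul_assoc, h2, ← Matrix.mul_assoc, h4, Matrix.mul_sub,
      Matrix.mul_one, sub_eq_add_neg]
  · have : (1 - F) = 1 + a • blk G.n G.q2 G.q2 f := by rw [hF, neg_smul, sub_neg_eq_add]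
    rw [this]
    exact det_mem G.C (G.n G.q1) G.q2 G.hn.symm a ha f hs' (G.W_sig f hf)
  · rw [← Matrix.det_mul, h2, ← Ideal.Quotient.eq, RingHom.map_det, map_one]
    have : (Ideal.Quotient.mk (G.J ^ (Fintype.card S + 1))).mapMatrix (1 - F ^ K) = 1 := by
      rw [map_sub, map_one]
      have : (Ideal.Quotient.mk (G.J ^ (Fintype.card S + 1))).mapMatrix (F ^ K) = 0 := by
        ext x y
        simp only [RingHom.mapMatrix_apply, Matrix.map_apply, Matrix.zero_apply]
        rw [Ideal.Quotient.eq_zero_iff_mem]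
        refine Ideal.pow_le_pow_right ?_ (G.VV_entry (G.VV_pow hFV (Fintype.card S + 1)) x y)
        nlinarith
      rw [this, sub_zero]
    rw [this, Matrix.det_one]

theorem elim [Nontrivial Q] {d : ℕ} (hd : 1 ≤ d) {X g : Matrix (TabCell G.n) (TabCell G.n) Q}
    (hX : X ∈ G.LL d) (hg : g ∈ G.TG d) :
    ∃ Y ∈ G.LL (d + 1), G.Good e (G.EE + (X + Y)) → G.Good e (G.EE + g + X) := by
  have main : ∀ p q f a, (p = G.q1 ∨ q = G.q2) → f ∈ G.W → SuppN (G.n p) (G.n q) f → a ∈ G.C →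
      a ∈ G.J ^ d → ∃ Y ∈ G.LL (d + 1), G.Good e (G.EE + (X + Y)) →
        G.Good e (G.EE + a • blk G.n p q f + X) := by
    intro p q f a hpq hf hs ha ha'
    by_cases hp : p = G.q1
    · by_cases hq : q = G.q2
      · subst hp hq; exact G.elim_C e hd hX f hf hs a ha ha'
      · subst hp; exact G.elim_A e hd hX q hq f hf hs a ha ha'
    · have hq := hpq.resolve_left hp
      subst hq; exact G.elim_B e hd hX p hp f hf hs a ha ha'
  obtain ⟨p, q, f, a, h1, h2, h3, h4, h5, rfl⟩ := hg
  by_cases h : p = G.q1 ∨ q = G.q2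
  · exact main p q f a h h2 h3 h4 h5
  · obtain ⟨Y, hY, hY'⟩ := main q p (trN f) (-a) (by unfold Tch at h1; tauto) (G.W_tr f h2) h3.tr
      (neg_mem h4) (neg_mem h5)
    refine ⟨Y, hY, fun h0 => ?_⟩
    obtain ⟨c, hc, hc'⟩ := hY' h0
    refine ⟨c, hc, ?_⟩
    have hsym : (a • blk G.n p q f + a • blk G.n q p (trN f)).IsSymm := by
      rw [Matrix.IsSymm, Matrix.transpose_add, Matrix.transpose_smul, Matrix.transpose_smul,
        blk_transpose, blk_transpose, add_comm]
      rfl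
    have := PF_add_symm e (G.EE + (-a) • blk G.n q p (trN f) + X) _ hsym
    rw [← this] at hc'
    convert hc' using 4
    rw [neg_smul]
    abel

theorem split_LL {d : ℕ} {X : Matrix (TabCell G.n) (TabCell G.n) Q} (hX : X ∈ G.LL d) :
    ∃ l : List (Matrix (TabCell G.n) (TabCell G.n) Q), (∀ g ∈ l, g ∈ G.TG d) ∧
      ∃ k : List (Matrix (TabCell G.n) (TabCell G.n) Q), (∀ g ∈ k, g ∈ G.NG) ∧
        X = l.sum + k.sum := by
  induction hX using AddSubgroup.closure_induction with
  | mem M hM =>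
    rcases hM with hM | hM
    · exact ⟨[M], by simpa using hM, [], by simp, by simp⟩
    · exact ⟨[], by simp, [M], by simpa using hM, by simp⟩
  | zero => exact ⟨[], by simp, [], by simp, by simp⟩
  | add x y _ _ hx hy =>
    obtain ⟨l, hl, k, hk, rfl⟩ := hx
    obtain ⟨l', hl', k', hk', rfl⟩ := hy
    refine ⟨l ++ l', ?_, k ++ k', ?_, ?_⟩
    · intro g hg; rcases List.mem_append.1 hg with h | h
      · exact hl g h
      · exact hl' g h
    · intro g hg; rcases List.mem_append.1 hg with h | h
      · exact hk g h
      · exact hk' g h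
    · rw [List.sum_append, List.sum_append]; abel
  | neg x _ hx =>
    obtain ⟨l, hl, k, hk, rfl⟩ := hx
    refine ⟨l.map (fun g => -g), ?_, k.map (fun g => -g), ?_, ?_⟩
    · intro g hg
      obtain ⟨g', hg', rfl⟩ := List.mem_map.1 hg
      obtain ⟨p, q, f, a, h1, h2, h3, h4, h5, rfl⟩ := hl g' hg'
      exact ⟨p, q, f, -a, h1, h2, h3, neg_mem h4, neg_mem h5, by rw [neg_smul]⟩
    · intro g hg
      obtain ⟨g', hg', rfl⟩ := List.mem_map.1 hg
      obtain ⟨p, q, f, a, h1, h2, h3, h4, h5, rfl⟩ := hk g' hg'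
      exact ⟨p, q, f, -a, h1, h2, h3, neg_mem h4, neg_mem h5, by rw [neg_smul]⟩
    · rw [neg_add, List.sum_neg, List.sum_neg]

theorem all_good [Nontrivial Q]
    (base : ∀ k : List (Matrix (TabCell G.n) (TabCell G.n) Q), (∀ g ∈ k, g ∈ G.NG) →
      G.Good e (G.EE + k.sum)) :
    ∀ X ∈ G.LL 1, G.Good e (G.EE + X) := by
  have key : ∀ i d, 1 ≤ d → d + i = Fintype.card S + 1 → ∀ X ∈ G.LL d, G.Good e (G.EE + X) := by
    intro i
    induction i with
    | zero =>
      intro d hd hdi X hX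
      obtain ⟨l, hl, k, hk, rfl⟩ := G.split_LL hX
      obtain ⟨c, hc, hc'⟩ := base k hk
      refine ⟨c, hc, ?_⟩
      have h1 : PF e (fun _ => G.EE + (l.sum + k.sum)) - PF e (fun _ => G.EE + k.sum) ∈
          G.J ^ (Fintype.card S + 1) := by
        apply PF_sub_mem
        intro _ x y
        have : (G.EE + (l.sum + k.sum)) x y - (G.EE + k.sum) x y = l.sum x y := by
          simp only [Matrix.add_apply]; ring
        rw [this]
        clear this
        induction l with
        | nil => simp
        | cons g l ih =>
          rw [List.sum_cons, Matrix.add_apply]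
          refine Ideal.add_mem _ ?_ (ih (fun g hg => hl g (List.mem_cons_of_mem _ hg)) (by
            refine add_mem (AddSubgroup.list_sum_mem _ fun g hg => ?_)
              (AddSubgroup.list_sum_mem _ fun g hg => ?_)
            · exact AddSubgroup.subset_closure (Or.inl (hl g (List.mem_cons_of_mem _ hg)))
            · exact AddSubgroup.subset_closure (Or.inr (hk g hg))))
          obtain ⟨p, q, f, a, h1, h2, h3, h4, h5, rfl⟩ := hl g List.mem_cons_self
          rw [Matrix.smul_apply, smul_eq_mul]
          refine Ideal.mul_mem_right _ _ ?_
          rw [← hdi]; exact h5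
      have := Ideal.add_mem _ h1 hc'
      convert this using 1
      ring
    | succ i ih =>
      intro d hd hdi X hX
      obtain ⟨l, hl, k, hk, rfl⟩ := G.split_LL hX
      have hkm : k.sum ∈ G.LL (d + 1) := AddSubgroup.list_sum_mem _ fun g hg =>
        AddSubgroup.subset_closure (Or.inr (hk g hg))
      clear hX
      generalize k.sum = Y at hkm
      induction l generalizing Y with
      | nil => simpa using ih (d + 1) (by omega) (by omega) Y hkm
      | cons g l ih2 =>
        have hlm : l.sum ∈ G.LL d := AddSubgroup.list_sum_mem _ fun g hg =>
          AddSubgroup.subset_closure (Or.inl (hl g (List.mem_cons_of_mem _ hg)))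
        obtain ⟨Y', hY', h⟩ := G.elim e hd (add_mem hlm (G.LL_anti (Nat.le_succ d) hkm))
          (hl g List.mem_cons_self)
        have := h (by
          have := ih2 (fun g hg => hl g (List.mem_cons_of_mem _ hg)) (Y + Y') (add_mem hkm hY')
          convert this using 1
          abel)
        convert this using 1
        rw [List.sum_cons]
        abel
  exact key (Fintype.card S) 1 le_rfl (by omega)

end Ctx

end elim

end DecompPf

namespace DecompPf

open Equiv Equiv.Perm TabSub

set_option linter.unusedSectionVars false

section base

variable {Q : Type} [CommRing Q] {ι : Type} [Fintype ι] [DecidableEq ι] {n : ι → ℕ}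
  {S : Type} [Fintype S] [DecidableEq S]

/-- The block sum attached to a matching. -/
noncomputable def BS (e : S ⊕ S ≃ TabCell n) (g : S → ℕ → ℕ → Q) : Q :=
  ∑ π : ∀ i : ι, Perm (Fin (n i)), sgnT π • ∏ a, g a (π _ (e (Sum.inl a)).2 : Fin _)
    (π _ (e (Sum.inr a)).2 : Fin _)

/-- The tableau attached to a matching with labels. -/
noncomputable def mkTab {t : ℕ} (e : S ⊕ S ≃ TabCell n) (lb : S → Fin t) (rep : Fin t → S)
    (hrep : ∀ i, lb (rep i) = i) (f : Fin t → ℕ → ℕ → Q)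
    (hl : ∀ a b, lb a = lb b → (e (Sum.inl a)).1 = (e (Sum.inl b)).1)
    (hr : ∀ a b, lb a = lb b → (e (Sum.inr a)).1 = (e (Sum.inr b)).1) : TabSub Q ι n t where
  mate := e.permCongr (Equiv.sumComm S S)
  isTail c := (e.symm c).isLeft
  lab c := lb (Sum.elim id id (e.symm c))
  colTail i := (e (Sum.inl (rep i))).1
  colHead i := (e (Sum.inr (rep i))).1
  X i := Matrix.of fun x y => f i x y
  mate_ne c := by
    obtain ⟨x, rfl⟩ := e.surjective c
    rcases x with a | a <;> simp
  mate_invol c := by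
    obtain ⟨x, rfl⟩ := e.surjective c
    rcases x with a | a <;> simp
  isTail_mate c := by
    obtain ⟨x, rfl⟩ := e.surjective c
    rcases x with a | a <;> simp
  lab_mate c := by
    obtain ⟨x, rfl⟩ := e.surjective c
    rcases x with a | a <;> simp
  lab_surj i := ⟨e (Sum.inl (rep i)), by simp, by simp [hrep]⟩
  colTail_eq c hc := by
    obtain ⟨x, rfl⟩ := e.surjective c
    rcases x with a | a
    · simp only [Equiv.symm_apply_apply, Sum.elim_inl, id]
      exact hl _ _ (hrep _)
    · simp at hc
  colHead_eq c hc := by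
    obtain ⟨x, rfl⟩ := e.surjective c
    rcases x with a | a
    · simp only [Equiv.symm_apply_apply, Sum.elim_inl, id, Equiv.permCongr_apply,
        Equiv.sumComm_apply, Sum.swap_inl]
      exact hr _ _ (hrep _)
    · simp at hc

theorem exists_tab_fin {t : ℕ} (e : S ⊕ S ≃ TabCell n) (lb : S → Fin t)
    (hsurj : Function.Surjective lb) (f : Fin t → ℕ → ℕ → Q)
    (hl : ∀ a b, lb a = lb b → (e (Sum.inl a)).1 = (e (Sum.inl b)).1)
    (hr : ∀ a b, lb a = lb b → (e (Sum.inr a)).1 = (e (Sum.inr b)).1) :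
    ∃ D : TabSub Q ι n t, (∀ i, ∃ a, lb a = i ∧ ∀ x y, castEntry (D.X i) x y =
        if x < n (e (Sum.inl a)).1 ∧ y < n (e (Sum.inr a)).1 then f i x y else 0) ∧
      BS e (fun a => f (lb a)) =
        ((∏ l, (Fintype.card {a // lb a = l}).factorial : ℕ) : Q) * D.bpf := by
  choose rep hrep using hsurj
  let D := mkTab e lb rep hrep f hl hr
  have hX : ∀ i x y, castEntry (D.X i) x y =
        if x < n (e (Sum.inl (rep i))).1 ∧ y < n (e (Sum.inr (rep i))).1 then f i x y else 0 := by
    intro i x y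
    unfold castEntry
    by_cases h1 : x < n (e (Sum.inl (rep i))).1 ∧ y < n (e (Sum.inr (rep i))).1
    · rw [if_pos h1]
      exact dif_pos h1
    · rw [if_neg h1]
      exact dif_neg h1
  refine ⟨D, fun i => ⟨rep i, hrep i, hX i⟩, ?_⟩
  let E : S ≃ Arr D := Equiv.ofBijective (fun a => ⟨e (Sum.inl a), by simp [D, mkTab]⟩) (by
    constructor
    · intro a b h; simpa using h
    · rintro ⟨c, hc⟩
      obtain ⟨x, rfl⟩ := e.surjective c
      rcases x with a | a
      · exact ⟨a, rfl⟩
      · simp [D, mkTab] at hc)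
  have hElab : ∀ a, D.lab (E a).1 = lb a := by
    intro a
    show lb (Sum.elim id id (e.symm (e (Sum.inl a)))) = lb a
    simp
  have hcard : ∀ l, Fintype.card {a // lb a = l} = Fintype.card {a : Arr D // D.lab a.1 = l} := by
    intro l
    refine Fintype.card_congr (Equiv.subtypeEquiv E ?_)
    intro a; rw [hElab]
  simp only [hcard]
  rw [← bpf0_eq]
  unfold BS bpf0
  refine Finset.sum_congr rfl fun π _ => ?_
  rw [prod_tails, ← Equiv.prod_comp E]
  congr 1
  refine Finset.prod_congr rfl fun a _ => ?_
  have hm : D.mate (E a).1 = e (Sum.inr a) := by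
    show e.permCongr (Equiv.sumComm S S) (e (Sum.inl a)) = e (Sum.inr a)
    simp
  unfold entry
  rw [val_of_eq hm π, hElab, hX, if_pos]
  · rfl
  · have h1 := hl (rep (lb a)) a (hrep _)
    have h2 := hr (rep (lb a)) a (hrep _)
    rw [h1, h2]
    exact ⟨(π _ (e (Sum.inl a)).2).2, (π _ (e (Sum.inr a)).2).2⟩

theorem exists_tab {L : Type} [Fintype L] [DecidableEq L] (e : S ⊕ S ≃ TabCell n) (lb : S → L)
    (f : L → ℕ → ℕ → Q)
    (hl : ∀ a b, lb a = lb b → (e (Sum.inl a)).1 = (e (Sum.inl b)).1)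
    (hr : ∀ a b, lb a = lb b → (e (Sum.inr a)).1 = (e (Sum.inr b)).1) :
    ∃ (t : ℕ) (D : TabSub Q ι n t), (∀ i, ∃ a, ∀ x y, castEntry (D.X i) x y =
        if x < n (e (Sum.inl a)).1 ∧ y < n (e (Sum.inr a)).1 then f (lb a) x y else 0) ∧
      BS e (fun a => f (lb a)) =
        ((∏ l, (Fintype.card {a // lb a = l}).factorial : ℕ) : Q) * D.bpf := by
  let R := {l // ∃ a, lb a = l}
  let E : R ≃ Fin (Fintype.card R) := Fintype.equivFin R
  let lb' : S → Fin (Fintype.card R) := fun a => E ⟨lb a, a, rfl⟩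
  have hlb' : ∀ a b, lb' a = lb' b ↔ lb a = lb b := by
    intro a b
    simp only [lb', EmbeddingLike.apply_eq_iff_eq]
    exact Subtype.ext_iff
  have hE : ∀ a, (E.symm (lb' a)).1 = lb a := by intro a; simp [lb']
  obtain ⟨D, hD, hD'⟩ := exists_tab_fin e lb' (by
    intro i
    obtain ⟨⟨l, a, rfl⟩, rfl⟩ := E.surjective i
    exact ⟨a, rfl⟩) (fun i => f (E.symm i).1) (fun a b h => hl a b ((hlb' a b).1 h))
    (fun a b h => hr a b ((hlb' a b).1 h))
  refine ⟨_, D, ?_, ?_⟩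
  · intro i
    obtain ⟨a, rfl, h⟩ := hD i
    refine ⟨a, fun x y => ?_⟩
    rw [h, hE]
  · simp only [hE] at hD'
    rw [hD']
    congr 2
    rw [← Equiv.prod_comp E, ← Finset.prod_filter_mul_prod_filter_not Finset.univ (fun l => ∃ a, lb a = l)]
    rw [Finset.prod_eq_one (s := Finset.univ.filter fun l => ¬ ∃ a, lb a = l), mul_one]
    · rw [Finset.prod_subtype (p := fun l => ∃ a, lb a = l) (F := inferInstance)]
      · refine Finset.prod_congr rfl fun l _ => ?_
        congr 1
        refine Fintype.card_congr (Equiv.subtypeEquivRight ?_)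
        intro a
        simp only [lb', EmbeddingLike.apply_eq_iff_eq]
        exact Subtype.ext_iff
      · intro x; simp
    · intro l hl
      have : IsEmpty {a // lb a = l} := ⟨fun a => (Finset.mem_filter.1 hl).2 ⟨a.1, a.2⟩⟩
      rw [Fintype.card_eq_zero]; rfl

/-- Restricting a matching to a set of columns. -/
noncomputable def restr (e : S ⊕ S ≃ TabCell n) (r : ι → Prop) (u : S → Prop)
    (h1 : ∀ a, u a ↔ r (e (Sum.inl a)).1) (h2 : ∀ a, u a ↔ r (e (Sum.inr a)).1) :
    {a // u a} ⊕ {a // u a} ≃ TabCell (fun i : {i // r i} => n i.1) :=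
  Equiv.ofBijective (Sum.elim (fun a => ⟨⟨(e (Sum.inl a.1)).1, (h1 a.1).1 a.2⟩, (e (Sum.inl a.1)).2⟩)
    (fun a => ⟨⟨(e (Sum.inr a.1)).1, (h2 a.1).1 a.2⟩, (e (Sum.inr a.1)).2⟩)) (by
    let em : TabCell (fun i : {i // r i} => n i.1) → TabCell n := fun c => ⟨c.1.1, c.2⟩
    have hem : Function.Injective em := by
      rintro ⟨⟨i, hi⟩, x⟩ ⟨⟨k, hk⟩, y⟩ h
      simp only [em, Sigma.mk.injEq] at h
      obtain ⟨rfl, h⟩ := h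
      simp only [heq_eq_eq] at h
      subst h; rfl
    constructor
    · rintro (a | a) (b | b) h
      all_goals
        have h' := congrArg em h
        simp only [em, Sum.elim_inl, Sum.elim_inr] at h'
      · have := e.injective (show e (Sum.inl a.1) = e (Sum.inl b.1) from h')
        simp only [Sum.inl.injEq] at this
        rw [Subtype.ext this]
      · have := e.injective (show e (Sum.inl a.1) = e (Sum.inr b.1) from h')
        simp at this
      · have := e.injective (show e (Sum.inr a.1) = e (Sum.inl b.1) from h')
        simp at this
      · have := e.injective (show e (Sum.inr a.1) = e (Sum.inr b.1) from h')
        simp only [Sum.inr.injEq] at this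
        rw [Subtype.ext this]
    · rintro c
      obtain ⟨x, hx⟩ := e.surjective (em c)
      have hc : r (em c).1 := c.1.2
      rcases x with a | a
      · rw [← hx] at hc
        exact ⟨Sum.inl ⟨a, (h1 a).2 hc⟩, hem hx⟩
      · rw [← hx] at hc
        exact ⟨Sum.inr ⟨a, (h2 a).2 hc⟩, hem hx⟩)

theorem BS_split (e : S ⊕ S ≃ TabCell n) (r : ι → Prop) (u : S → Prop)
    (h1 : ∀ a, u a ↔ r (e (Sum.inl a)).1) (h2 : ∀ a, u a ↔ r (e (Sum.inr a)).1)
    (g : S → ℕ → ℕ → Q) :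
    BS e g = BS (restr e r u h1 h2) (fun a => g a.1) *
      BS (restr e (fun i => ¬ r i) (fun a => ¬ u a) (fun a => not_congr (h1 a))
        (fun a => not_congr (h2 a))) (fun a => g a.1) := by
  unfold BS
  rw [← Equiv.sum_comp (Equiv.piEquivPiSubtypeProd r (fun i => Perm (Fin (n i)))).symm,
    Fintype.sum_prod_type, Finset.sum_mul_sum]
  refine Finset.sum_congr rfl fun π _ => Finset.sum_congr rfl fun ρ _ => ?_
  set τ := (Equiv.piEquivPiSubtypeProd r (fun i => Perm (Fin (n i)))).symm (π, ρ) with hτ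
  have hπ : π = fun i : {i // r i} => τ i.1 := by
    have := congrArg Prod.fst (Equiv.apply_symm_apply (Equiv.piEquivPiSubtypeProd r (fun i => Perm (Fin (n i)))) (π, ρ))
    exact this.symm
  have hρ : ρ = fun i : {i // ¬ r i} => τ i.1 := by
    have := congrArg Prod.snd (Equiv.apply_symm_apply (Equiv.piEquivPiSubtypeProd r (fun i => Perm (Fin (n i)))) (π, ρ))
    exact this.symm
  clear_value τ
  subst hπ hρ
  rw [smul_mul_smul_comm]
  congr 1
  · unfold sgnT
    exact (Fintype.prod_subtype_mul_prod_subtype r (fun i => ((sign (τ i) : ℤˣ) : ℤ))).symm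
  · exact (Fintype.prod_subtype_mul_prod_subtype u (fun a => g a (τ _ (e (Sum.inl a)).2 : Fin _)
      (τ _ (e (Sum.inr a)).2 : Fin _))).symm

end base

namespace Ctx

variable {Q : Type} [CommRing Q] {ι : Type} [Fintype ι] [DecidableEq ι] (G : Ctx Q ι)
  {S : Type} [Fintype S] [DecidableEq S]

/-- The hypothesis on reduced tableaux. -/
def HD : Prop := ∀ (t : ℕ) (D : TabSub Q {i : ι // i ≠ G.q1 ∧ i ≠ G.q2} (fun i => G.n i.1) t),
  (∀ j, castEntry (D.X j) ∈ G.W) → D.bpf ∈ G.C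

theorem bpf_mem {κ : Type} [Fintype κ] [DecidableEq κ] {n : κ → ℕ} {t : ℕ} (C : Subring Q)
    (D : TabSub Q κ n t) (h : ∀ i x y, castEntry (D.X i) x y ∈ C) : D.bpf ∈ C := by
  unfold bpf
  refine Subring.sum_mem _ fun π _ => Subring.zsmul_mem _ (Subring.prod_mem _ fun c _ => ?_) _
  exact h _ _ _

theorem base_j (hD : G.HD) {k : ℕ} (p q : Fin k → ι) (f : Fin k → ℕ → ℕ → Q)
    (hT : ∀ l, ¬ G.Tch (p l) (q l)) (hW : ∀ l, f l ∈ G.W)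
    (hs : ∀ l, SuppN (G.n (p l)) (G.n (q l)) (f l)) (j : S → Option (Fin k))
    (e : S ⊕ S ≃ TabCell G.n) :
    ∃ c ∈ G.C, PF e (fun a => (j a).elim G.EE (fun l => blk G.n (p l) (q l) (f l))) =
      ((∏ o, (Fintype.card {a // j a = o}).factorial : ℕ) : Q) * c := by
  let P : Option (Fin k) → ι := fun o => o.elim G.q1 p
  let P' : Option (Fin k) → ι := fun o => o.elim G.q2 q
  let F : Option (Fin k) → ℕ → ℕ → Q := fun o => o.elim delN f
  have hB : ∀ o : Option (Fin k), o.elim G.EE (fun l => blk G.n (p l) (q l) (f l)) =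
      blk G.n (P o) (P' o) (F o) := by
    intro o; cases o <;> rfl
  simp only [hB]
  -- the case where no permutation matches
  by_cases hex : ∃ σ0 : Perm (TabCell G.n), ∀ a, (σ0 (e (Sum.inl a))).1 = P (j a) ∧
      (σ0 (e (Sum.inr a))).1 = P' (j a)
  swap
  · refine ⟨0, Subring.zero_mem _, ?_⟩
    rw [mul_zero]
    unfold PF
    refine Finset.sum_eq_zero fun σ _ => ?_
    have : ∃ a, ¬ ((σ (e (Sum.inl a))).1 = P (j a) ∧ (σ (e (Sum.inr a))).1 = P' (j a)) := by
      by_contra h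
      push Not at h
      exact hex ⟨σ, h⟩
    obtain ⟨a, ha⟩ := this
    rw [Finset.prod_eq_zero (Finset.mem_univ a), smul_zero]
    unfold blk
    exact if_neg ha
  obtain ⟨σ0, hσ0⟩ := hex
  rw [PF_trans e σ0]
  have hcol : ∀ a, ((e.trans σ0) (Sum.inl a)).1 = P (j a) ∧ ((e.trans σ0) (Sum.inr a)).1 = P' (j a) :=
    hσ0
  generalize e.trans σ0 = e' at hcol
  suffices h : ∃ c ∈ G.C, PF e' (fun a => blk G.n (P (j a)) (P' (j a)) (F (j a))) =
      ((∏ o, (Fintype.card {a // j a = o}).factorial : ℕ) : Q) * c by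
    obtain ⟨c, hc, h⟩ := h
    refine ⟨((sign σ0 : ℤˣ) : ℤ) • c, Subring.zsmul_mem _ hc _, ?_⟩
    rw [h, mul_smul_comm]
  have hBS : PF e' (fun a => blk G.n (P (j a)) (P' (j a)) (F (j a))) = BS e' (fun a => F (j a)) := by
    rw [PF_block]
    · unfold BS
      refine Finset.sum_congr rfl fun π _ => ?_
      congr 1
      refine Finset.prod_congr rfl fun a _ => ?_
      unfold blk
      rw [if_pos]
      exact hcol a
    · intro a c d h
      unfold blk at h
      rw [(hcol a).1, (hcol a).2]
      by_contra h'
      exact h (if_neg h')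
  rw [hBS]
  let r : ι → Prop := fun i => i ≠ G.q1 ∧ i ≠ G.q2
  have hr1 : ∀ o, o ≠ none ↔ r (P o) := by
    intro o
    cases o with
    | none => simp [r, P]
    | some l =>
      have := hT l
      simp only [r, P, Tch, Option.elim] at *
      simp; tauto
  have hr2 : ∀ o, o ≠ none ↔ r (P' o) := by
    intro o
    cases o with
    | none => simp [r, P']
    | some l =>
      have := hT l
      simp only [r, P', Tch, Option.elim] at *
      simp; tauto
  have h1 : ∀ a, j a ≠ none ↔ r (e' (Sum.inl a)).1 := by
    intro a; rw [(hcol a).1]; exact hr1 _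
  have h2 : ∀ a, j a ≠ none ↔ r (e' (Sum.inr a)).1 := by
    intro a; rw [(hcol a).2]; exact hr2 _
  obtain ⟨t1, D1, hD1, hE1⟩ := exists_tab (restr e' r (fun a => j a ≠ none) h1 h2)
    (fun a => j a.1) F
    (by
      intro a b hab
      apply Subtype.ext
      show (e' (Sum.inl a.1)).1 = (e' (Sum.inl b.1)).1
      rw [(hcol _).1, (hcol _).1, hab])
    (by
      intro a b hab
      apply Subtype.ext
      show (e' (Sum.inr a.1)).1 = (e' (Sum.inr b.1)).1
      rw [(hcol _).2, (hcol _).2, hab])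
  obtain ⟨t2, D2, hD2, hE2⟩ := exists_tab (restr e' (fun i => ¬ r i) (fun a => ¬ j a ≠ none)
    (fun a => not_congr (h1 a)) (fun a => not_congr (h2 a)))
    (fun a => j a.1) F
    (by
      intro a b hab
      apply Subtype.ext
      show (e' (Sum.inl a.1)).1 = (e' (Sum.inl b.1)).1
      rw [(hcol _).1, (hcol _).1, hab])
    (by
      intro a b hab
      apply Subtype.ext
      show (e' (Sum.inr a.1)).1 = (e' (Sum.inr b.1)).1
      rw [(hcol _).2, (hcol _).2, hab])
  have hE : BS (restr e' r (fun a => j a ≠ none) h1 h2) (fun a => F (j a.1)) *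
      BS (restr e' (fun i => ¬ r i) (fun a => ¬ j a ≠ none)
        (fun a => not_congr (h1 a)) (fun a => not_congr (h2 a))) (fun a => F (j a.1)) = _ :=
    congrArg₂ (· * ·) hE1 hE2
  have hE' : BS e' (fun a => F (j a)) = _ :=
    Eq.trans (by convert BS_split e' r (fun a => j a ≠ none) h1 h2 (fun a => F (j a))) hE
  rw [hE']
  refine ⟨D1.bpf * D2.bpf, Subring.mul_mem _ ?_ ?_, ?_⟩
  · apply hD
    intro i
    obtain ⟨a, ha⟩ := hD1 i
    obtain ⟨l, hl⟩ := Option.ne_none_iff_exists'.1 a.2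
    have : castEntry (D1.X i) = f l := by
      funext x y
      refine (ha x y).trans ?_
      have e1 : G.n (e' (Sum.inl a.1)).1 = G.n (p l) := by rw [(hcol _).1, hl]; rfl
      have e2 : G.n (e' (Sum.inr a.1)).1 = G.n (q l) := by rw [(hcol _).2, hl]; rfl
      have e3 : F (j a.1) = f l := by rw [hl]; rfl
      rw [e3]
      by_cases h0 : f l x y = 0
      · rw [h0]; simp
      · rw [if_pos]
        have := hs l x y h0
        exact ⟨e1 ▸ this.1, e2 ▸ this.2⟩
    rw [this]
    exact hW l
  · apply bpf_mem
    intro i x y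
    obtain ⟨a, ha⟩ := hD2 i
    have hl : j a.1 = none := by have := a.2; simpa using this
    rw [ha]
    simp only [hl, F, Option.elim, delN]
    split_ifs
    · exact Subring.one_mem _
    · exact Subring.zero_mem _
    · exact Subring.zero_mem _
  · have hc : (∏ o, (Fintype.card {a // j a = o}).factorial) =
        (∏ o, (Fintype.card {a : {a // j a ≠ none} // j a.1 = o}).factorial) *
        (∏ o, (Fintype.card {a : {a // ¬ j a ≠ none} // j a.1 = o}).factorial) := by
      rw [← Finset.prod_mul_distrib]
      refine Finset.prod_congr rfl fun o _ => ?_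
      by_cases ho : o = none
      · have i1 : IsEmpty {a : {a // j a ≠ none} // j a.1 = o} := ⟨fun a => a.1.2 (a.2.trans ho)⟩
        rw [Fintype.card_eq_zero (α := {a : {a // j a ≠ none} // j a.1 = o}), Nat.factorial_zero,
          one_mul]
        congr 1
        refine Fintype.card_congr ⟨fun a => ⟨⟨a.1, by simpa using a.2.trans ho⟩, a.2⟩,
          fun a => ⟨a.1.1, a.2⟩, fun _ => rfl, fun _ => rfl⟩
      · have i1 : IsEmpty {a : {a // ¬ j a ≠ none} // j a.1 = o} :=
          ⟨fun a => a.1.2 (fun h => ho (a.2.symm.trans h))⟩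
        rw [Fintype.card_eq_zero (α := {a : {a // ¬ j a ≠ none} // j a.1 = o}), Nat.factorial_zero,
          mul_one]
        congr 1
        refine Fintype.card_congr ⟨fun a => ⟨⟨a.1, fun h => ho (a.2.symm.trans h)⟩, a.2⟩,
          fun a => ⟨a.1.1, a.2⟩, fun _ => rfl, fun _ => rfl⟩
    rw [hc]
    push_cast
    ring

theorem base_good (hD : G.HD) (e : S ⊕ S ≃ TabCell G.n)
    (k : List (Matrix (TabCell G.n) (TabCell G.n) Q)) (hk : ∀ g ∈ k, g ∈ G.NG) :
    G.Good e (G.EE + k.sum) := by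
  have h := fun l : Fin k.length => hk _ (List.get_mem k l)
  choose p q f a h1 h2 h3 h4 h5 h6 using h
  let co : Option (Fin k.length) → Q := fun o => o.elim 1 a
  let B : Option (Fin k.length) → Matrix (TabCell G.n) (TabCell G.n) Q :=
    fun o => o.elim G.EE (fun l => blk G.n (p l) (q l) (f l))
  have hsum : G.EE + k.sum = ∑ o, co o • B o := by
    rw [Fintype.sum_option]
    congr 1
    · simp [co, B]
    · rw [← Fin.sum_univ_getElem]
      exact Finset.sum_congr rfl fun l _ => h6 l
  have key := orbit_sum G.C (fun j : S → Option (Fin k.length) => PF e (fun x => co (j x) • B (j x)))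
    (fun j ρ => PF_perm e ρ (fun x => co (j x) • B (j x))) (by
      intro j
      obtain ⟨c, hc, hc'⟩ := G.base_j hD p q f h1 h2 h3 j e
      refine ⟨(∏ x, co (j x)) * c, Subring.mul_mem _ (Subring.prod_mem _ fun x _ => ?_) hc, ?_⟩
      · simp only [co]
        cases j x with
        | none => exact Subring.one_mem _
        | some l => exact h4 l
      · have := PF_smul e (fun x => co (j x)) (fun x => B (j x))
        show PF e (fun x => co (j x) • B (j x)) = _
        rw [this]
        simp only [B]
        rw [hc']
        ring)
  obtain ⟨c, hc, hc'⟩ := key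
  refine ⟨c, hc, ?_⟩
  rw [hsum, PF_sum e (fun o => co o • B o), hc', sub_self]
  exact Ideal.zero_mem _

end Ctx

end DecompPf

namespace DecompPf

open Equiv Equiv.Perm TabSub

set_option linter.unusedSectionVars false

section words

variable {A : Type} [CommRing A] {ι : Type} [Fintype ι] [DecidableEq ι] {n : ι → ℕ} {s : ℕ}

theorem mLP_append_aux (b : ℕ) (l l' : List (ℕ → ℕ → A)) (i j : ℕ) (hi : i < b) :
    matListProd b (l ++ l') i j =
      ∑ p ∈ Finset.range b, matListProd b l i p * matListProd b l' p j := by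
  induction l generalizing i with
  | nil =>
    rw [Finset.sum_eq_single i]
    · simp [matListProd]
    · intro p _ hp; simp [matListProd, Ne.symm hp]
    · intro h; exact absurd (Finset.mem_range.2 hi) h
  | cons f l ih =>
    simp only [List.cons_append, matListProd, Finset.sum_mul]
    rw [Finset.sum_comm]
    refine Finset.sum_congr rfl fun p hp => ?_
    rw [ih p (Finset.mem_range.1 hp), Finset.mul_sum]
    exact Finset.sum_congr rfl fun r _ => (mul_assoc _ _ _).symm

theorem mLP_append (b : ℕ) (l l' : List (ℕ → ℕ → A)) (hl : l ≠ []) :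
    matListProd b (l ++ l') = mulN b (matListProd b l) (matListProd b l') := by
  obtain ⟨f, l, rfl⟩ := List.exists_cons_of_ne_nil hl
  funext i j
  simp only [List.cons_append, matListProd, mulN, Finset.sum_mul]
  rw [Finset.sum_comm]
  refine Finset.sum_congr rfl fun p hp => ?_
  rw [mLP_append_aux b l l' p j (Finset.mem_range.1 hp), Finset.mul_sum]
  exact Finset.sum_congr rfl fun r _ => (mul_assoc _ _ _).symm

theorem mLP_col_zero (b : ℕ) (l : List (ℕ → ℕ → A)) (i j : ℕ) (hi : i < b) (hj : b ≤ j) :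
    matListProd b l i j = 0 := by
  induction l generalizing i with
  | nil => simp only [matListProd]; rw [if_neg (by omega)]
  | cons f l ih =>
    exact Finset.sum_eq_zero fun p hp => by rw [ih p (Finset.mem_range.1 hp), mul_zero]

theorem mLP_supp (b : ℕ) (l : List (ℕ → ℕ → A)) (hl : l ≠ []) (h : ∀ f ∈ l, SuppN b b f) :
    SuppN b b (matListProd b l) := by
  obtain ⟨f, l, rfl⟩ := List.exists_cons_of_ne_nil hl
  intro i j hij
  obtain ⟨p, hp, hne⟩ := Finset.exists_ne_zero_of_sum_ne_zero hij
  refine ⟨(h f (by simp) i p (left_ne_zero_of_mul hne)).1, ?_⟩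
  by_contra hj
  exact right_ne_zero_of_mul hne (mLP_col_zero b l p j (Finset.mem_range.1 hp) (by omega))

theorem mLP_tr_aux (b : ℕ) (l : List (ℕ → ℕ → A)) (i j : ℕ) (hi : i < b) (hj : j < b) :
    matListProd b (l.map trN).reverse i j = matListProd b l j i := by
  induction l generalizing j with
  | nil => simp [matListProd, eq_comm]
  | cons f l ih =>
    rw [List.map_cons, List.reverse_cons, mLP_append_aux _ _ _ _ _ hi]
    simp only [matListProd]
    refine Finset.sum_congr rfl fun p hp => ?_
    rw [ih p (Finset.mem_range.1 hp), mul_comm]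
    congr 1
    rw [Finset.sum_eq_single j]
    · simp [trN]
    · intro r _ hr; simp [hr]
    · intro h; exact absurd (Finset.mem_range.2 hj) h

theorem supp_ext {x y : ℕ} {f g : ℕ → ℕ → A} (hf : SuppN x y f) (hg : SuppN x y g)
    (h : ∀ i j, i < x → j < y → f i j = g i j) : f = g := by
  funext i j
  by_cases hij : i < x ∧ j < y
  · exact h i j hij.1 hij.2
  · rw [not_imp_comm.1 (hf i j) hij, not_imp_comm.1 (hg i j) hij]

theorem castEntry_supp {a b : ι} (M : Matrix (Fin (n a)) (Fin (n b)) A) :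
    SuppN (n a) (n b) (castEntry M) := by
  intro i j h
  by_contra h'
  exact h (dif_neg h')

theorem SuppN.mono {x y x' y' : ℕ} {f : ℕ → ℕ → A} (h : SuppN x y f) (hx : x ≤ x') (hy : y ≤ y') :
    SuppN x' y' f := fun i j hij => ⟨(h i j hij).1.trans_le hx, (h i j hij).2.trans_le hy⟩

/-- The matrix of a letter. -/
def letM (T : TabSub A ι n s) (p : Fin s × Bool) : ℕ → ℕ → A :=
  fun i j => if p.2 then castEntry (T.X p.1) j i else castEntry (T.X p.1) i j

theorem letM_supp (T : TabSub A ι n s) (p : Fin s × Bool) :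
    SuppN (dimBound n) (dimBound n) (letM T p) := by
  have h := (castEntry_supp (T.X p.1)).mono (le_dimBound _) (le_dimBound _)
  obtain ⟨j, b⟩ := p
  cases b
  · intro x y hxy; exact h x y (by simpa [letM] using hxy)
  · intro x y hxy; exact (h y x (by simpa [letM] using hxy)).symm

theorem wordMat_eq (T : TabSub A ι n s) (w : List (Fin s × Bool)) :
    T.wordMat w = matListProd (dimBound n) (w.map (letM T)) := rfl

theorem wordMat_supp (T : TabSub A ι n s) (w : List (Fin s × Bool)) (hw : w ≠ []) :
    SuppN (dimBound n) (dimBound n) (T.wordMat w) := by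
  rw [wordMat_eq]
  apply mLP_supp
  · simpa using hw
  · intro f hf
    obtain ⟨p, _, rfl⟩ := List.mem_map.1 hf
    exact letM_supp T p

theorem wordMat_append (T : TabSub A ι n s) (w u : List (Fin s × Bool)) (hw : w ≠ []) :
    T.wordMat (w ++ u) = mulN (dimBound n) (T.wordMat w) (T.wordMat u) := by
  rw [wordMat_eq, List.map_append, mLP_append _ _ _ (by simpa using hw)]
  rfl

theorem wtp_ne {w : List (Fin s × Bool)} (hw : w ≠ []) : wtp w ≠ [] := by
  simpa [wtp] using hw

theorem wordMat_wtp (T : TabSub A ι n s) (w : List (Fin s × Bool)) (hw : w ≠ []) :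
    T.wordMat (wtp w) = trN (T.wordMat w) := by
  refine supp_ext (wordMat_supp T _ (wtp_ne hw)) (wordMat_supp T w hw).tr fun i j hi hj => ?_
  have h : (wtp w).map (letM T) = ((w.map (letM T)).map trN).reverse := by
    unfold wtp
    rw [List.map_reverse, List.map_map, List.map_map]
    congr 2
    funext ⟨k, b⟩ i j
    cases b <;> simp [letM, trN]
  rw [wordMat_eq, h, mLP_tr_aux _ _ _ _ hi hj]
  rfl

theorem wordMat_single (T : TabSub A ι n s) (k : Fin s) :
    T.wordMat [(k, false)] = castEntry (T.X k) := by
  refine supp_ext (wordMat_supp T _ (by simp))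
    ((castEntry_supp (T.X k)).mono (le_dimBound _) (le_dimBound _)) fun i j hi hj => ?_
  simp only [wordMat, List.map_cons, List.map_nil, matListProd]
  rw [Finset.sum_eq_single j]
  · simp
  · intro r _ hr; simp [hr]
  · intro h; exact absurd (Finset.mem_range.2 hj) h

end words

section maps

variable {A B : Type} [CommRing A] [CommRing B] {ι : Type} [Fintype ι] [DecidableEq ι]
  {n : ι → ℕ} {s : ℕ}

/-- Replace the matrices of a tableau with substitution. -/
def setX (T : TabSub A ι n s)
    (Y : ∀ j : Fin s, Matrix (Fin (n (T.colTail j))) (Fin (n (T.colHead j))) B) :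
    TabSub B ι n s where
  mate := T.mate
  isTail := T.isTail
  lab := T.lab
  colTail := T.colTail
  colHead := T.colHead
  X := Y
  mate_ne := T.mate_ne
  mate_invol := T.mate_invol
  isTail_mate := T.isTail_mate
  lab_mate := T.lab_mate
  lab_surj := T.lab_surj
  colTail_eq := T.colTail_eq
  colHead_eq := T.colHead_eq

/-- Apply a ring homomorphism to the matrices. -/
def mapT (φ : A →+* B) (T : TabSub A ι n s) : TabSub B ι n s := setX T (fun j => (T.X j).map φ)

theorem castEntry_map (φ : A →+* B) {a b : ι} (M : Matrix (Fin (n a)) (Fin (n b)) A) (i j : ℕ) :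
    castEntry (n := n) (a := a) (b := b) (M.map φ) i j = φ (castEntry M i j) := by
  unfold castEntry
  split_ifs
  · rfl
  · simp

theorem mapT_entry (φ : A →+* B) (T : TabSub A ι n s) (j : Fin s) (x y : ℕ) :
    castEntry ((mapT φ T).X j) x y = φ (castEntry (T.X j) x y) :=
  castEntry_map φ (T.X j) x y

theorem mapT_bpf (φ : A →+* B) (T : TabSub A ι n s) : (mapT φ T).bpf = φ T.bpf := by
  unfold bpf
  rw [map_sum]
  refine Finset.sum_congr rfl fun π _ => ?_
  rw [map_zsmul, map_prod]
  congr 1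
  refine Finset.prod_congr rfl fun c _ => ?_
  exact mapT_entry φ T _ _ _

theorem mapT_wordMat (φ : A →+* B) (T : TabSub A ι n s) (w : List (Fin s × Bool)) (i j : ℕ) :
    (mapT φ T).wordMat w i j = φ (T.wordMat w i j) := by
  unfold wordMat
  induction w generalizing i with
  | nil => simp only [List.map_nil, matListProd]; split_ifs <;> simp
  | cons p w ih =>
    simp only [List.map_cons, matListProd]
    rw [map_sum]
    refine Finset.sum_congr rfl fun r _ => ?_
    rw [ih, map_mul, mapT_entry, mapT_entry]
    congr 1
    split_ifs <;> rfl

theorem mapT_wordSigma (φ : A →+* B) (T : TabSub A ι n s) (w : List (Fin s × Bool)) (k : ℕ) :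
    (mapT φ T).wordSigma w k = φ (T.wordSigma w k) := by
  unfold wordSigma sigmaCoeff
  rw [map_mul, map_pow, map_neg, map_one, ← Polynomial.coeff_map, ← Matrix.charpoly_map]
  congr 3
  ext i j
  exact mapT_wordMat φ T w i j

theorem mapT_mapT {E : Type} [CommRing E] (φ : A →+* B) (ψ : B →+* E) (T : TabSub A ι n s) :
    mapT ψ (mapT φ T) = mapT (ψ.comp φ) T := rfl

theorem mapT_eq_self (φ : A →+* A) (T : TabSub A ι n s)
    (h : ∀ j x y, φ (castEntry (T.X j) x y) = castEntry (T.X j) x y) : mapT φ T = T := by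
  have : (fun j => (T.X j).map φ) = T.X := by
    funext j
    ext x y
    have := h j x y
    unfold castEntry at this
    rw [dif_pos ⟨x.2, y.2⟩] at this
    exact this
  unfold mapT
  rw [this]
  rfl

end maps

section count

theorem orbit_count {S L : Type} [Fintype S] [DecidableEq S] [Fintype L] [DecidableEq L]
    (f : S → L) :
    Fintype.card {j : S → L // ∃ ρ : Perm S, j = fun a => f (ρ a)} *
      ∏ l, (Fintype.card {a // f a = l}).factorial = (Fintype.card S).factorial := by
  rw [← DomMulAct.stabilizer_card]
  haveI : Fintype (Perm S)ᵈᵐᵃ := Fintype.ofEquiv _ DomMulAct.mk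
  have h4 := MulAction.card_orbit_mul_card_stabilizer_eq_card_group (Perm S)ᵈᵐᵃ f
  have h5 : Fintype.card (Perm S)ᵈᵐᵃ = (Fintype.card S).factorial := by
    rw [← Fintype.card_perm]; exact Fintype.card_congr DomMulAct.mk.symm
  rw [← h5, ← h4]
  congr 1
  · refine Fintype.card_congr (Equiv.subtypeEquivRight ?_)
    intro j
    constructor
    · rintro ⟨ρ, rfl⟩; exact ⟨DomMulAct.mk ρ, rfl⟩
    · rintro ⟨g, rfl⟩; exact ⟨DomMulAct.mk.symm g, rfl⟩
  · refine Fintype.card_congr ?_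
    refine Equiv.subtypeEquiv DomMulAct.mk ?_
    intro g
    rw [DomMulAct.mem_stabilizer_iff]
    rfl

/-- The multidegree of a label function. -/
noncomputable def mdeg {S : Type} [Fintype S] {s : ℕ} (j : S → Option (Fin s)) : Fin s →₀ ℕ :=
  ∑ a, (j a).elim 0 (fun l => Finsupp.single l 1)

theorem mdeg_apply {S : Type} [Fintype S] {s : ℕ} (j : S → Option (Fin s)) (l : Fin s) :
    mdeg j l = Fintype.card {a // j a = some l} := by
  unfold mdeg
  rw [Finsupp.finset_sum_apply, Fintype.card_subtype, Finset.card_filter]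
  refine Finset.sum_congr rfl fun a _ => ?_
  cases h : j a with
  | none => simp
  | some k => simp [Finsupp.single_apply]

theorem mdeg_iff {S : Type} [Fintype S] [DecidableEq S] {s : ℕ} (lab : S → Fin s)
    (j : S → Option (Fin s)) :
    mdeg j = mdeg (fun a => some (lab a)) ↔ ∃ ρ : Perm S, j = fun a => some (lab (ρ a)) := by
  constructor
  · intro h
    have hs : ∀ l, Fintype.card {a // j a = some l} = Fintype.card {a // some (lab a) = some l} := by
      intro l
      have := DFunLike.congr_fun h l
      rwa [mdeg_apply, mdeg_apply] at this
    have htot : ∀ k : S → Option (Fin s), Fintype.card {a // k a = none} +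
        ∑ l, Fintype.card {a // k a = some l} = Fintype.card S := by
      intro k
      rw [← Fintype.card_congr (Equiv.sigmaFiberEquiv k), Fintype.card_sigma,
        Fintype.sum_option]
    have h0 : Fintype.card {a // j a = none} = Fintype.card {a // some (lab a) = none} := by
      have h1 := htot j
      have h2 := htot (fun a => some (lab a))
      rw [← h2, Finset.sum_congr rfl (fun l _ => hs l)] at h1
      exact Nat.add_right_cancel h1
    have he : ∀ o, Nonempty ({a // j a = o} ≃ {a // some (lab a) = o}) := by
      intro o
      apply Fintype.card_eq.1
      cases o with
      | none => exact h0
      | some l => exact hs l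
    refine ⟨Equiv.ofFiberEquiv (f := j) (g := fun a => some (lab a)) (fun o => (he o).some), ?_⟩
    funext a
    exact (Equiv.ofFiberEquiv_map (f := j) (g := fun a => some (lab a)) _ a).symm
  · rintro ⟨ρ, rfl⟩
    unfold mdeg
    exact Equiv.sum_comp ρ (fun a => (some (lab a)).elim 0 (fun l => Finsupp.single l 1))

theorem mdeg_degree {S : Type} [Fintype S] {s : ℕ} (lab : S → Fin s) :
    (mdeg (fun a => some (lab a))).degree = Fintype.card S := by
  unfold mdeg
  rw [map_sum]
  simp

end count

end DecompPf

namespace DecompPf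

open Equiv Equiv.Perm TabSub

set_option linter.unusedSectionVars false

section final

variable {A : Type} [CommRing A] {ι : Type} [Fintype ι] [DecidableEq ι] {n : ι → ℕ} {s : ℕ}

theorem blk_map {B : Type} [CommRing B] (φ : A →+* B) (p q : ι) (f : ℕ → ℕ → A) :
    (blk n p q f).map φ = blk n p q (fun i j => φ (f i j)) := by
  ext c d
  simp only [blk, Matrix.map_apply]
  split_ifs
  · rfl
  · simp

/-- The index type of the generic entries. -/
abbrev GIdx (T : TabSub A ι n s) : Type :=
  Σ j : Fin s, Fin (n (T.colTail j)) × Fin (n (T.colHead j))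

/-- The generic coefficient ring. -/
abbrev GR (T : TabSub A ι n s) : Type := MvPolynomial (GIdx T) ℤ

/-- The generic tableau. -/
noncomputable def genT (T : TabSub A ι n s) : TabSub (GR T) ι n s :=
  setX T (fun j => Matrix.of fun x y => MvPolynomial.X ⟨j, x, y⟩)

/-- Specialization of the generic entries. -/
noncomputable def spec (T : TabSub A ι n s) : GR T →+* A :=
  MvPolynomial.eval₂Hom (Int.castRingHom A) (fun x => T.X x.1 x.2.1 x.2.2)

theorem mapT_spec (T : TabSub A ι n s) : mapT (spec T) (genT T) = T := by
  have : (fun j => ((genT T).X j).map (spec T)) = T.X := by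
    funext j
    ext x y
    show MvPolynomial.eval₂ (Int.castRingHom A) (fun x : GIdx T => T.X x.1 x.2.1 x.2.2)
      (MvPolynomial.X ⟨j, x, y⟩) = T.X j x y
    rw [MvPolynomial.eval₂_X]
  show setX T (fun j => ((genT T).X j).map (spec T)) = T
  rw [this]
  rfl

/-- The extended ring. -/
abbrev GQ (T : TabSub A ι n s) : Type := MvPolynomial (Fin s) (GR T)

/-- Polynomials whose specialized coefficients lie in `CA`. -/
noncomputable def coefC (T : TabSub A ι n s) (CA : Subring A) : Subring (GQ T) :=
  ((MvPolynomial.map CA.subtype : MvPolynomial (Fin s) CA →+* MvPolynomial (Fin s) A).range).comap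
    (MvPolynomial.map (spec T))

theorem C_mem_coefC (T : TabSub A ι n s) (CA : Subring A) (r : GR T) (hr : spec T r ∈ CA) :
    (MvPolynomial.C r : GQ T) ∈ coefC T CA := by
  refine ⟨MvPolynomial.C ⟨spec T r, hr⟩, ?_⟩
  simp

theorem X_mem_coefC (T : TabSub A ι n s) (CA : Subring A) (j : Fin s) :
    (MvPolynomial.X j : GQ T) ∈ coefC T CA := by
  refine ⟨MvPolynomial.X j, ?_⟩
  simp

theorem coeff_mem (T : TabSub A ι n s) (CA : Subring A) (p : GQ T) (hp : p ∈ coefC T CA)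
    (m : Fin s →₀ ℕ) : spec T (p.coeff m) ∈ CA := by
  obtain ⟨q, hq⟩ := hp
  rw [← MvPolynomial.coeff_map, ← hq, MvPolynomial.coeff_map]
  exact (q.coeff m).2

/-- The coefficient extraction. -/
theorem coeff_PF (T : TabSub A ι n s) (E : Matrix (TabCell n) (TabCell n) A) :
    (PF (eT T) (fun _ => E.map MvPolynomial.C + ∑ l : Fin s, (MvPolynomial.X l : MvPolynomial (Fin s) A) •
      blk n (T.colTail l) (T.colHead l)
        (castEntry ((mapT MvPolynomial.C T : TabSub (MvPolynomial (Fin s) A) ι n s).X l)))).coeff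
      (mdeg (fun a : Arr T => some (T.lab a.1))) = ((Fintype.card (Arr T)).factorial : A) * T.bpf := by
  let B : Option (Fin s) → Matrix (TabCell n) (TabCell n) A := fun o =>
    o.elim E (fun l => blk n (T.colTail l) (T.colHead l) (castEntry (T.X l)))
  let co : Option (Fin s) → MvPolynomial (Fin s) A := fun o => o.elim 1 MvPolynomial.X
  have hsum : E.map MvPolynomial.C + ∑ l : Fin s, (MvPolynomial.X l : MvPolynomial (Fin s) A) •
      blk n (T.colTail l) (T.colHead l)
        (castEntry ((mapT MvPolynomial.C T : TabSub (MvPolynomial (Fin s) A) ι n s).X l)) =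
      ∑ o, co o • (B o).map MvPolynomial.C := by
    rw [Fintype.sum_option]
    congr 1
    · simp [co, B]
    · refine Finset.sum_congr rfl fun l _ => ?_
      simp only [co, B, Option.elim, blk_map]
      congr 2
      funext x y
      exact mapT_entry _ T l x y
  rw [hsum, PF_sum (eT T) (fun o => co o • (B o).map MvPolynomial.C), MvPolynomial.coeff_sum]
  have hterm : ∀ j : Arr T → Option (Fin s),
      MvPolynomial.coeff (mdeg (fun a : Arr T => some (T.lab a.1)))
        (PF (eT T) (fun a => co (j a) • (B (j a)).map MvPolynomial.C)) =
      if (∃ ρ : Perm (Arr T), j = fun a => some (T.lab (ρ a).1)) then T.bpf0 else 0 := by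
    intro j
    rw [PF_smul (eT T) (fun a => co (j a)) (fun a => (B (j a)).map MvPolynomial.C)]
    rw [← PF_map MvPolynomial.C (eT T) (fun a => B (j a))]
    have hco : ∏ a, co (j a) = MvPolynomial.monomial (mdeg j) 1 := by
      unfold mdeg
      rw [MvPolynomial.monomial_sum_one]
      refine Finset.prod_congr rfl fun a _ => ?_
      cases j a with
      | none => simp [co]
      | some l => rfl
    rw [hco, mul_comm, MvPolynomial.C_mul_monomial, mul_one, MvPolynomial.coeff_monomial]
    have hiff := mdeg_iff (fun a : Arr T => T.lab a.1) j
    by_cases h : mdeg j = mdeg (fun a : Arr T => some (T.lab a.1))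
    · rw [if_pos h, if_pos (hiff.1 h)]
      obtain ⟨ρ, rfl⟩ := hiff.1 h
      rw [PF_perm (eT T) ρ (fun a => B (some (T.lab a.1))), bpf0_eq_PF]
      rfl
    · rw [if_neg h, if_neg (fun h' => h (hiff.2 h'))]
  rw [Finset.sum_congr rfl fun j _ => hterm j, Finset.sum_ite, Finset.sum_const_zero, add_zero,
    Finset.sum_const, nsmul_eq_mul, bpf0_eq, ← mul_assoc, ← Nat.cast_mul]
  congr 2
  rw [← orbit_count (fun a : Arr T => some (T.lab a.1)), Fintype.prod_option]
  have h0 : IsEmpty {a : Arr T // (some (T.lab a.1) : Option (Fin s)) = none} :=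
    ⟨fun a => Option.some_ne_none _ a.2⟩
  rw [Fintype.card_eq_zero (α := {a : Arr T // (some (T.lab a.1) : Option (Fin s)) = none}),
    Nat.factorial_zero, one_mul, Fintype.card_subtype]
  congr 1
  refine Finset.prod_congr rfl fun l _ => ?_
  congr 1
  exact Fintype.card_congr (Equiv.subtypeEquivRight fun a => Option.some_inj.symm)

/-- The generating set of the target ring. -/
def target (T : TabSub A ι n s) (q1 q2 : ι) : Subring A :=
  Subring.closure
      ({x : A | ∃ (t : ℕ) (D : TabSub A {i : ι // i ≠ q1 ∧ i ≠ q2} (fun i => n i.1) t),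
          (∀ j : Fin t, ∃ w : List (Fin s × Bool), w ≠ [] ∧
            ∀ i i' : ℕ, castEntry (D.X j) i i' = T.wordMat w i i') ∧
          x = D.bpf} ∪
       {x : A | ∃ (w : List (Fin s × Bool)) (k : ℕ), w ≠ [] ∧ 1 ≤ k ∧ k ≤ n q1 ∧
          x = T.wordSigma w k})

/-- The generic tableau over the extended ring. -/
noncomputable def genQ (T : TabSub A ι n s) : TabSub (GQ T) ι n s := mapT MvPolynomial.C (genT T)

/-- The context of the main proof. -/
noncomputable def mainCtx (T : TabSub A ι n s) (q1 q2 : ι) (hq : q1 ≠ q2) (hn : n q1 = n q2) :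
    Ctx (GQ T) ι where
  n := n
  q1 := q1
  q2 := q2
  hq := hq
  hn := hn
  C := coefC T (target T q1 q2)
  J := MvPolynomial.idealOfVars (Fin s) (GR T)
  W := {f | ∃ w : List (Fin s × Bool), w ≠ [] ∧ f = (genQ T).wordMat w}
  W_mul := by
    rintro f ⟨w, hw, rfl⟩ g ⟨u, hu, rfl⟩
    exact ⟨w ++ u, by simp [hw], (wordMat_append _ _ _ hw).symm⟩
  W_tr := by
    rintro f ⟨w, hw, rfl⟩
    exact ⟨wtp w, wtp_ne hw, (wordMat_wtp _ _ hw).symm⟩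
  W_sig := by
    rintro f ⟨w, hw, rfl⟩ k hk1 hk2
    have h : (genQ T).wordSigma w k ∈ coefC T (target T q1 q2) := by
      unfold genQ
      rw [mapT_wordSigma]
      apply C_mem_coefC
      rw [← mapT_wordSigma, mapT_spec]
      exact Subring.subset_closure (Or.inr ⟨w, k, hw, hk1, hk2, rfl⟩)
    exact h

theorem mainCtx_HD (T : TabSub A ι n s) (q1 q2 : ι) (hq : q1 ≠ q2) (hn : n q1 = n q2) :
    (mainCtx T q1 q2 hq hn).HD := by
  intro t D hD
  have hself : mapT (MvPolynomial.C.comp MvPolynomial.constantCoeff) D = D := by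
    apply mapT_eq_self
    intro j x y
    obtain ⟨w, _, hw⟩ := hD j
    have hw' := congrFun (congrFun hw x) y
    refine (congrArg _ hw').trans (Eq.trans ?_ hw'.symm)
    unfold genQ
    rw [mapT_wordMat]
    simp
  have hb : D.bpf = MvPolynomial.C (MvPolynomial.constantCoeff D.bpf) := by
    have h := mapT_bpf ((MvPolynomial.C : GR T →+* GQ T).comp MvPolynomial.constantCoeff) D
    rw [hself] at h
    exact h
  rw [hb]
  apply C_mem_coefC
  have h2 := mapT_bpf ((spec T).comp MvPolynomial.constantCoeff) D
  rw [RingHom.comp_apply] at h2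
  rw [← h2]
  refine Subring.subset_closure (Or.inl ⟨t, _, ?_, rfl⟩)
  intro j
  obtain ⟨w, hw0, hw⟩ := hD j
  refine ⟨w, hw0, fun x y => ?_⟩
  refine (mapT_entry _ D j x y).trans ?_
  refine (congrArg _ (congrFun (congrFun hw x) y)).trans ?_
  unfold genQ
  rw [mapT_wordMat, RingHom.comp_apply, MvPolynomial.constantCoeff_C, ← mapT_wordMat, mapT_spec]

theorem main_thm (T : TabSub A ι n s) (q1 q2 : ι) (hq : q1 ≠ q2) (hn : n q1 = n q2) :
    T.bpf ∈ target T q1 q2 := by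
  let G := mainCtx T q1 q2 hq hn
  have hgood := G.all_good (e := eT (genT T))
    (fun k hk => G.base_good (mainCtx_HD T q1 q2 hq hn) (eT (genT T)) k hk)
    (∑ l : Fin s, (MvPolynomial.X l : GQ T) •
      blk n (T.colTail l) (T.colHead l) (castEntry ((genQ T).X l))) (by
      refine AddSubgroup.sum_mem _ fun l _ => ?_
      refine G.gen_mem ⟨[(l, false)], by simp, (wordMat_single _ l).symm⟩
        (castEntry_supp ((genQ T).X l)) (X_mem_coefC T _ l) le_rfl ?_
      rw [pow_one]
      exact Ideal.subset_span ⟨l, rfl⟩)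
  obtain ⟨c, hc, hcJ⟩ := hgood
  have hco := coeff_PF (genT T) (blk n q1 q2 delN)
  have h0 := (MvPolynomial.mem_pow_idealOfVars_iff' _ _).1 hcJ
    (mdeg (fun a : Arr (genT T) => some ((genT T).lab a.1))) (by
      rw [mdeg_degree]; exact Nat.lt_succ_self _)
  rw [MvPolynomial.coeff_sub, sub_eq_zero] at h0
  have hEE : G.EE = (blk n q1 q2 (delN : ℕ → ℕ → GR T)).map MvPolynomial.C := by
    rw [blk_map]
    show blk n q1 q2 delN = _
    congr 1
    funext i j
    unfold delN
    split_ifs <;> simp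
  rw [hEE] at h0
  have h1 := hco.symm.trans h0
  rw [← map_natCast (MvPolynomial.C : GR T →+* GQ T), MvPolynomial.coeff_C_mul] at h1
  have h2 := mul_left_cancel₀ (Nat.cast_ne_zero.2 (Nat.factorial_ne_zero _)) h1
  have h3 := coeff_mem T _ c hc (mdeg (fun a : Arr (genT T) => some ((genT T).lab a.1)))
  rw [← h2, ← mapT_bpf, mapT_spec] at h3
  exact h3

end final

end DecompPf

open TabSub in
/-- Decomposition formula, short version. -/
theorem stmt8 (K : Type) [Field K] [Infinite K] (A : Type) [CommRing A] [Algebra K A]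
    (m s : ℕ) (n : Fin m → ℕ) (T : TabSub A (Fin m) n s)
    (q1 q2 : Fin m) (hq : q1 < q2) (hn : n q1 = n q2) :
    T.bpf ∈ Subring.closure
      ({x : A | ∃ (t : ℕ) (D : TabSub A {i : Fin m // i ≠ q1 ∧ i ≠ q2} (fun i => n i.1) t),
          (∀ j : Fin t, ∃ w : List (Fin s × Bool), w ≠ [] ∧
            ∀ i i' : ℕ, castEntry (D.X j) i i' = T.wordMat w i i') ∧
          x = D.bpf} ∪
       {x : A | ∃ (w : List (Fin s × Bool)) (k : ℕ), w ≠ [] ∧ 1 ≤ k ∧ k ≤ n q1 ∧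
          x = T.wordSigma w k}) := by
  exact DecompPf.main_thm T q1 q2 hq.ne hn
end

section
/- Let K be an infinite field, let n = (n_1,…,n_m) ∈ ℕ^m with n_1 + ⋯ + n_m even, let 1 ≤ p_1,…,p_s, q_1,…,q_s ≤ m, let X_j be an n_{p_j} × n_{q_j} matrix for each 1 ≤ j ≤ s, and let k_1,…,k_s be positive integers with k_1 + ⋯ + k_s = (n_1 + ⋯ + n_m)/2 such that for all 1 ≤ i ≤ m: Σ_{j: p_j = i} k_j + Σ_{j: q_j = i} k_j = n_i. Then there is a tableau with substitution (T,(X_1,…,X_s)) of dimension n such that bpf_T(X_1,…,X_s) = ± P_{k_1,…,k_s}(X_1^{p_1,q_1},…,X_s^{p_s,q_s}). -/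
open scoped BigOperators
set_option linter.unusedVariables false

attribute [local instance] Classical.propDecidable

/-- The condition on a permutation `π` appearing in the definition of the pfaffian:
`π(1) < π(3) < ⋯ < π(N−1)` and `π(2i−1) < π(2i)` (written 0-based). -/
def pfCond {N : ℕ} (π : Equiv.Perm (Fin N)) : Prop :=
  (∀ i : ℕ, ∀ h : 2 * i + 1 < N, π ⟨2 * i, by omega⟩ < π ⟨2 * i + 1, h⟩) ∧
  (∀ i j : ℕ, ∀ _hij : i < j, ∀ h : 2 * j < N, π ⟨2 * i, by omega⟩ < π ⟨2 * j, h⟩)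

/-- `∏_{i=1}^{N/2} x_{π(2i−1), π(2i)}` (written 0-based). -/
def pairProd {A : Type*} [CommRing A] {N : ℕ} (X : Matrix (Fin N) (Fin N) A)
    (π : Equiv.Perm (Fin N)) : A :=
  ∏ i ∈ Finset.range (N / 2),
    if h : 2 * i + 1 < N then X (π ⟨2 * i, by omega⟩) (π ⟨2 * i + 1, h⟩) else 0

open scoped Classical in
/-- The pfaffian of a (skew-symmetric) `N×N` matrix. -/
noncomputable def pfaffian {A : Type*} [CommRing A] {N : ℕ} (X : Matrix (Fin N) (Fin N) A) : A :=
  ∑ π ∈ Finset.univ.filter pfCond, (Equiv.Perm.sign π : ℤ) • pairProd X π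

/-- The generalized pfaffian `P(X) = pf(X − Xᵗ)` of an arbitrary `N×N` matrix. -/
noncomputable def genPf {A : Type*} [CommRing A] {N : ℕ} (X : Matrix (Fin N) (Fin N) A) : A :=
  pfaffian (X - X.transpose)

/-- The partial linearization `P_{k_1,…,k_s}(X_1,…,X_s)`: the coefficient of
`x_1^{k_1}⋯x_s^{k_s}` in `P(x_1 X_1 + ⋯ + x_s X_s)`. -/
noncomputable def pfLin {A : Type*} [CommRing A] {N s : ℕ} (k : Fin s → ℕ)
    (M : Fin s → Matrix (Fin N) (Fin N) A) : A :=
  MvPolynomial.coeff (Finsupp.equivFunOnFinite.symm k)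
    (genPf (Matrix.of fun i j =>
      ∑ r, (MvPolynomial.X r : MvPolynomial (Fin s) A) * MvPolynomial.C (M r i j)))

/-- `offset n p = n_1 + ⋯ + n_{p-1}`. -/
def offset {m : ℕ} (n : Fin m → ℕ) (p : Fin m) : ℕ :=
  ∑ i ∈ Finset.univ.filter (· < p), n i

/-- The block matrix `X^{p,q}`: the `(n_1+⋯+n_m)×(n_1+⋯+n_m)` matrix whose `(p,q)`-th
block is `X` and whose other blocks are zero. -/
def blockEmb {A : Type*} [CommRing A] {m : ℕ} (n : Fin m → ℕ) (p q : Fin m)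
    (X : Matrix (Fin (n p)) (Fin (n q)) A) :
    Matrix (Fin (∑ i, n i)) (Fin (∑ i, n i)) A :=
  Matrix.of fun r c =>
    if h : offset n p ≤ r.1 ∧ r.1 < offset n p + n p ∧
           offset n q ≤ c.1 ∧ c.1 < offset n q + n q then
      X ⟨r.1 - offset n p, by omega⟩ ⟨c.1 - offset n q, by omega⟩
    else 0

namespace StmtTen

open Finset

/-- index of the `i`-th pair, `b`-th member -/
def uEq {h N : ℕ} (hN : h * 2 = N) : Fin h × Fin 2 ≃ Fin N := finProdFinEquiv.trans (finCongr hN)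

/-- sign of a bijection -/
def sg {h N : ℕ} (hN : h * 2 = N) (E : Fin h × Fin 2 ≃ Fin N) : ℤ :=
  (Equiv.Perm.sign ((uEq hN).symm.trans E) : ℤ)

lemma fin_two_expand {α : Type*} [CommRing α] (Z : Fin 2 → Fin 2 → α) :
    Z 0 1 - Z 1 0 =
      ∑ τ : Equiv.Perm (Fin 2), (Equiv.Perm.sign τ : ℤ) • Z (τ 0) (τ 1) := by
  rw [show (Finset.univ : Finset (Equiv.Perm (Fin 2))) = {1, Equiv.swap 0 1} by decide]
  rw [Finset.sum_pair (by decide)]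
  simp [sub_eq_add_neg]

lemma sort_unique {h : ℕ} {L : Type*} [LinearOrder L] (g : Fin h → L)
    (hg : Function.Injective g) :
    ∃! σ : Equiv.Perm (Fin h), StrictMono (g ∘ σ) := by
  refine ⟨Tuple.sort g,
    (Tuple.monotone_sort g).strictMono_of_injective (hg.comp (Equiv.injective _)), ?_⟩
  intro σ hσ
  have := Tuple.unique_monotone hσ.monotone (Tuple.monotone_sort g)
  ext i
  exact congrArg Fin.val (hg (congrFun this i))

lemma orbit_sum {G Ω A : Type*} [Group G] [Fintype G] [Fintype Ω]
    [AddCommMonoid A] (act : G → Ω → Ω) (hact : ∀ g ω, act g⁻¹ (act g ω) = ω)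
    (F : Ω → A) (hF : ∀ (g : G) ω, F (act g ω) = F ω)
    (R1 R2 : Ω → Prop) {_ : DecidablePred R1} {_ : DecidablePred R2}
    (h1 : ∀ ω, ∃! g : G, R1 (act g ω)) (h2 : ∀ ω, ∃! g : G, R2 (act g ω)) :
    ∑ ω with R1 ω, F ω = ∑ ω with R2 ω, F ω := by
  classical
  have key : ∀ (R1 R2 : Ω → Prop) [DecidablePred R1] [DecidablePred R2]
     (h2 : ∀ ω, ∃! g : G, R2 (act g ω)),
     ∑ ω with R1 ω, F ω = ∑ ω, ∑ g : G, if R1 ω ∧ R2 (act g ω) then F ω else 0 := by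
    intro R1 R2 _ _ h2
    rw [Finset.sum_filter]
    refine Finset.sum_congr rfl fun ω _ => ?_
    obtain ⟨g, hg, hu⟩ := h2 ω
    rw [Finset.sum_eq_single g]
    · simp [show R2 (act g ω) from hg]
    · intro b _ hb
      rw [if_neg]
      rintro ⟨_, h⟩
      exact hb (hu b h)
    · simp
  rw [key R1 R2 h2, key R2 R1 h1, Finset.sum_comm,
    Finset.sum_comm (f := fun ω g => if R2 ω ∧ _ then _ else _)]
  rw [← Equiv.sum_comp (Equiv.inv G)]
  refine Finset.sum_congr rfl fun g _ => ?_
  let ag : Ω ≃ Ω := ⟨act g, act g⁻¹, hact g, fun ω => by simpa using hact g⁻¹ ω⟩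
  rw [← Equiv.sum_comp ag]
  refine Finset.sum_congr rfl fun ω _ => ?_
  simp [ag, hF, hact, and_comm]

lemma sign_sigma {ι : Type*} [Fintype ι] [DecidableEq ι] (n : ι → ℕ)
    (π : ∀ i : ι, Equiv.Perm (Fin (n i))) :
    Equiv.Perm.sign (Equiv.Perm.sigmaCongrRight π) = ∏ i, Equiv.Perm.sign (π i) := by
  let f : (∀ i : ι, Equiv.Perm (Fin (n i))) →* ℤˣ :=
    (Equiv.Perm.sign).comp (Equiv.Perm.sigmaCongrRightHom _)
  let g : (∀ i : ι, Equiv.Perm (Fin (n i))) →* ℤˣ :=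
    { toFun := fun π => ∏ i, Equiv.Perm.sign (π i)
      map_one' := by simp
      map_mul' := by intro x y; simp [Finset.prod_mul_distrib] }
  have : f = g := by
    apply MonoidHom.pi_ext
    intro i x
    have h1 : g (Pi.mulSingle i x) = Equiv.Perm.sign x := by
      show ∏ j, Equiv.Perm.sign ((Pi.mulSingle i x : ∀ i : ι, Equiv.Perm (Fin (n i))) j) = _
      rw [Finset.prod_eq_single i]
      · simp
      · intro b _ hb
        simp [Pi.mulSingle_eq_of_ne hb]
      · simp
    rw [h1]
    show Equiv.Perm.sign (Equiv.Perm.sigmaCongrRight _) = _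
    symm
    refine Equiv.Perm.sign_bij (fun b _ => (⟨i, b⟩ : Σ i, Fin (n i))) ?_ ?_ ?_
    · intro b hb _
      simp
    · intro a b _ _ h
      simpa using h
    · rintro ⟨j, b⟩ hb
      by_cases hj : j = i
      · subst hj
        refine ⟨b, ?_, rfl⟩
        simpa using hb
      · exfalso
        apply hb
        simp [Pi.mulSingle_eq_of_ne hj]
  exact DFunLike.congr_fun this π

/-- the smaller element of the `i`-th pair -/
def minKey {h N : ℕ} (E : Fin h × Fin 2 ≃ Fin N) (i : Fin h) : Fin N :=
  min (E (i, 0)) (E (i, 1))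

lemma minKey_inj {h N : ℕ} (E : Fin h × Fin 2 ≃ Fin N) : Function.Injective (minKey E) := by
  intro i j hij
  unfold minKey at hij
  rcases min_choice (E (i, 0)) (E (i, 1)) with h1 | h1 <;>
  rcases min_choice (E (j, 0)) (E (j, 1)) with h2 | h2 <;>
  · rw [h1, h2] at hij
    simpa using E.injective hij

lemma perm_two (τ : Equiv.Perm (Fin 2)) : (τ 0 = 0 ∧ τ 1 = 1) ∨ (τ 0 = 1 ∧ τ 1 = 0) := by
  revert τ; decide

lemma minKey_flip {h N : ℕ} (E : Fin h × Fin 2 ≃ Fin N) (ε : Fin h → Equiv.Perm (Fin 2)) :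
    minKey ((Equiv.prodCongrRight ε).trans E) = minKey E := by
  funext i
  unfold minKey
  rcases perm_two (ε i) with ⟨h1, h2⟩ | ⟨h1, h2⟩
  · simp [h1, h2]
  · simp [h1, h2, min_comm]

lemma sg_flip {h N : ℕ} (hN : h * 2 = N) (E : Fin h × Fin 2 ≃ Fin N)
    (ε : Fin h → Equiv.Perm (Fin 2)) :
    sg hN ((Equiv.prodCongrRight ε).trans E) =
      sg hN E * ∏ i, (Equiv.Perm.sign (ε i) : ℤ) := by
  unfold sg
  have : (uEq hN).symm.trans ((Equiv.prodCongrRight ε).trans E) =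
      ((uEq hN).symm.trans E) * (((uEq hN).symm.trans (Equiv.prodCongrRight ε)).trans (uEq hN)) := by
    ext x; simp
  rw [this, Equiv.Perm.sign_mul, Equiv.Perm.sign_symm_trans_trans,
    Equiv.Perm.sign_prodCongrRight]
  simp

lemma sg_perm {h N : ℕ} (hN : h * 2 = N) (E : Fin h × Fin 2 ≃ Fin N)
    (σ : Equiv.Perm (Fin h)) :
    sg hN ((Equiv.prodCongrLeft (fun _ => σ)).trans E) = sg hN E := by
  unfold sg
  have : (uEq hN).symm.trans ((Equiv.prodCongrLeft (fun _ => σ)).trans E) =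
      ((uEq hN).symm.trans E) *
        (((uEq hN).symm.trans (Equiv.prodCongrLeft (fun _ => σ))).trans (uEq hN)) := by
    ext x; simp
  rw [this, Equiv.Perm.sign_mul, Equiv.Perm.sign_symm_trans_trans,
    Equiv.Perm.sign_prodCongrLeft]
  simp

/-- the pfaffian condition for bijections -/
def PairSorted {h N : ℕ} (E : Fin h × Fin 2 ≃ Fin N) : Prop := ∀ i, E (i, 0) < E (i, 1)

lemma uEq_zero {h N : ℕ} (hN : h * 2 = N) (i : Fin h) :
    uEq hN (i, 0) = ⟨2 * i, by omega⟩ := by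
  ext; simp [uEq]

lemma uEq_one {h N : ℕ} (hN : h * 2 = N) (i : Fin h) :
    uEq hN (i, 1) = ⟨2 * i + 1, by omega⟩ := by
  ext; simp [uEq, add_comm]

lemma pfCond_iff {h N : ℕ} (hN : h * 2 = N) (π : Equiv.Perm (Fin N)) :
    pfCond π ↔ PairSorted ((uEq hN).trans π) ∧ StrictMono (minKey ((uEq hN).trans π)) := by
  have hmin : PairSorted ((uEq hN).trans π) →
      minKey ((uEq hN).trans π) = fun i => π (uEq hN (i, 0)) := by
    intro hp
    funext i
    exact min_eq_left (hp i).le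
  constructor
  · rintro ⟨h1, h2⟩
    have hp : PairSorted ((uEq hN).trans π) := by
      intro i
      have := h1 i (by omega)
      simpa [uEq_zero, uEq_one] using this
    refine ⟨hp, ?_⟩
    rw [hmin hp]
    intro i j hij
    have := h2 i j hij (by omega)
    simpa [uEq_zero, uEq_one] using this
  · rintro ⟨hp, hm⟩
    rw [hmin hp] at hm
    constructor
    · intro i hi
      have := hp ⟨i, by omega⟩
      simpa [uEq_zero, uEq_one] using this
    · intro i j hij hj
      have := @hm ⟨i, by omega⟩ ⟨j, by omega⟩ hij
      simpa [uEq_zero, uEq_one] using this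

lemma pairProd_eq {R : Type*} [CommRing R] {h N : ℕ} (hN : h * 2 = N)
    (Z : Matrix (Fin N) (Fin N) R) (π : Equiv.Perm (Fin N)) :
    pairProd Z π = ∏ i : Fin h, Z (π (uEq hN (i, 0))) (π (uEq hN (i, 1))) := by
  unfold pairProd
  rw [show N / 2 = h by omega, Finset.prod_range]
  refine Finset.prod_congr rfl fun i _ => ?_
  rw [dif_pos (by omega), uEq_zero, uEq_one]

/-- A pair-sorting flip exists uniquely. -/
lemma flip_unique {h N : ℕ} (E : Fin h × Fin 2 ≃ Fin N) :
    ∃! ε : Fin h → Equiv.Perm (Fin 2), PairSorted ((Equiv.prodCongrRight ε).trans E) := by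
  have h1 : ∀ i, ∃! τ : Equiv.Perm (Fin 2), StrictMono ((fun b => E (i, b)) ∘ τ) := fun i =>
    sort_unique _ (fun a b hab => by simpa using E.injective hab)
  have h2 : ∀ i (τ : Equiv.Perm (Fin 2)),
      StrictMono ((fun b => E (i, b)) ∘ τ) ↔ E (i, τ 0) < E (i, τ 1) := by
    intro i τ
    constructor
    · intro hm
      exact hm (show (0 : Fin 2) < 1 by decide)
    · intro hm a b hab
      fin_cases a <;> fin_cases b <;> simp_all
  simp_rw [h2] at h1
  choose τ hτ hu using h1
  refine ⟨τ, fun i => by simpa using hτ i, fun ε hε => ?_⟩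
  funext i
  exact hu i _ (by simpa using hε i)

lemma genPf_eq {R : Type*} [CommRing R] {h N : ℕ} (hN : h * 2 = N)
    (Z : Matrix (Fin N) (Fin N) R) :
    genPf Z = ∑ E : Fin h × Fin 2 ≃ Fin N with StrictMono (minKey E),
      sg hN E • ∏ i, Z (E (i, 0)) (E (i, 1)) := by
  classical
  unfold genPf pfaffian
  have step : ∀ E : Fin h × Fin 2 ≃ Fin N,
      sg hN E • ∏ i, (Z - Z.transpose) (E (i, 0)) (E (i, 1)) =
      ∑ ε : Fin h → Equiv.Perm (Fin 2), sg hN ((Equiv.prodCongrRight ε).trans E) •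
        ∏ i, Z (((Equiv.prodCongrRight ε).trans E) (i, 0))
          (((Equiv.prodCongrRight ε).trans E) (i, 1)) := by
    intro E
    have : ∀ i, (Z - Z.transpose) (E (i, 0)) (E (i, 1)) =
        ∑ τ : Equiv.Perm (Fin 2), (Equiv.Perm.sign τ : ℤ) • Z (E (i, τ 0)) (E (i, τ 1)) := by
      intro i
      exact fin_two_expand (fun a b => Z (E (i, a)) (E (i, b)))
    simp_rw [this]
    rw [Finset.prod_univ_sum, Fintype.piFinset_univ, Finset.smul_sum]
    refine Finset.sum_congr rfl fun ε _ => ?_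
    rw [sg_flip, mul_smul]
    congr 1
    simp only [zsmul_eq_mul, Finset.prod_mul_distrib]
    simp
  have e1 : ∑ π ∈ Finset.univ.filter (pfCond (N := N)),
      (Equiv.Perm.sign π : ℤ) • pairProd (Z - Z.transpose) π =
      ∑ E : Fin h × Fin 2 ≃ Fin N with PairSorted E ∧ StrictMono (minKey E),
        sg hN E • ∏ i, (Z - Z.transpose) (E (i, 0)) (E (i, 1)) := by
    rw [Finset.sum_filter, Finset.sum_filter]
    let eq : Equiv.Perm (Fin N) ≃ (Fin h × Fin 2 ≃ Fin N) :=
      ⟨fun π => (uEq hN).trans π, fun E => (uEq hN).symm.trans E,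
        fun π => by ext x; simp, fun E => by ext x; simp⟩
    rw [← Equiv.sum_comp eq]
    refine Finset.sum_congr rfl fun π _ => ?_
    have hs : sg hN (eq π) = (Equiv.Perm.sign π : ℤ) := by
      unfold sg
      congr 2
      exact eq.left_inv π
    rw [hs, pairProd_eq hN]
    simp only [pfCond_iff hN]
    rfl
  rw [e1]
  simp_rw [step]
  rw [Finset.sum_filter, Finset.sum_filter]
  have e2 : ∀ (G : (Fin h × Fin 2 ≃ Fin N) → R),
      (∑ E : Fin h × Fin 2 ≃ Fin N, if PairSorted E ∧ StrictMono (minKey E) then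
        ∑ ε : Fin h → Equiv.Perm (Fin 2), G ((Equiv.prodCongrRight ε).trans E) else 0) =
      ∑ E : Fin h × Fin 2 ≃ Fin N, if StrictMono (minKey E) then G E else 0 := by
    intro G
    have : ∀ E : Fin h × Fin 2 ≃ Fin N, (if PairSorted E ∧ StrictMono (minKey E) then
        ∑ ε : Fin h → Equiv.Perm (Fin 2), G ((Equiv.prodCongrRight ε).trans E) else 0) =
        ∑ ε : Fin h → Equiv.Perm (Fin 2), if PairSorted E ∧ StrictMono (minKey E) then
         G ((Equiv.prodCongrRight ε).trans E) else 0 := by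
      intro E; split_ifs <;> simp
    simp_rw [this]
    rw [Finset.sum_comm]
    have inner : ∀ ε : Fin h → Equiv.Perm (Fin 2),
        (∑ E : Fin h × Fin 2 ≃ Fin N, if PairSorted E ∧ StrictMono (minKey E) then
         G ((Equiv.prodCongrRight ε).trans E) else 0) =
        ∑ E : Fin h × Fin 2 ≃ Fin N,
          if PairSorted ((Equiv.prodCongrRight ε⁻¹).trans E) ∧ StrictMono (minKey E) then
         G E else 0 := by
      intro ε
      let eq : (Fin h × Fin 2 ≃ Fin N) ≃ (Fin h × Fin 2 ≃ Fin N) :=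
        ⟨fun E => (Equiv.prodCongrRight ε).trans E, fun E => (Equiv.prodCongrRight ε⁻¹).trans E,
          fun π => by ext ⟨a, b⟩; simp, fun E => by ext ⟨a, b⟩; simp⟩
      rw [← Equiv.sum_comp eq (fun E =>
          if PairSorted ((Equiv.prodCongrRight ε⁻¹).trans E) ∧ StrictMono (minKey E) then
         G E else 0)]
      refine Finset.sum_congr rfl fun E _ => ?_
      have h1 : (Equiv.prodCongrRight ε⁻¹).trans (eq E) = E := eq.left_inv E
      have h2 : minKey (eq E) = minKey E := minKey_flip E ε
      rw [h1, h2]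
      rfl
    simp_rw [inner]
    rw [← Equiv.sum_comp (Equiv.inv _), Finset.sum_comm]
    refine Finset.sum_congr rfl fun E _ => ?_
    obtain ⟨ε, hε, hu⟩ := flip_unique E
    rw [Finset.sum_eq_single ε]
    · simp only [Equiv.inv_apply, inv_inv]
      simp [hε]
    · intro b _ hb
      rw [if_neg]
      rintro ⟨h3, _⟩
      simp only [Equiv.inv_apply, inv_inv] at h3
      exact hb (hu b h3)
    · simp
  exact e2 (fun E => sg hN E • ∏ i, Z (E (i, 0)) (E (i, 1)))

lemma pfLin_eq {R : Type*} [CommRing R] {h N s : ℕ} (hN : h * 2 = N) (k : Fin s → ℕ)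
    (M : Fin s → Matrix (Fin N) (Fin N) R) :
    pfLin k M = ∑ ω : (Fin h × Fin 2 ≃ Fin N) × (Fin h → Fin s) with StrictMono (minKey ω.1),
      if ∑ i, Finsupp.single (ω.2 i) 1 = Finsupp.equivFunOnFinite.symm k then
        sg hN ω.1 • ∏ i, M (ω.2 i) (ω.1 (i, 0)) (ω.1 (i, 1)) else 0 := by
  classical
  unfold pfLin
  rw [genPf_eq hN, MvPolynomial.coeff_sum, Finset.sum_filter, Finset.sum_filter,
    Fintype.sum_prod_type]
  refine Finset.sum_congr rfl fun E _ => ?_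
  by_cases hE : StrictMono (minKey E)
  · simp only [hE, if_true]
    simp only [Matrix.of_apply]
    rw [Finset.prod_univ_sum, Fintype.piFinset_univ, Finset.smul_sum, MvPolynomial.coeff_sum]
    refine Finset.sum_congr rfl fun f _ => ?_
    have : ∏ i, (MvPolynomial.X (f i) * MvPolynomial.C (M (f i) (E (i, 0)) (E (i, 1)))) =
        MvPolynomial.monomial (∑ i, Finsupp.single (f i) 1)
          (∏ i, M (f i) (E (i, 0)) (E (i, 1))) := by
      rw [MvPolynomial.monomial_sum_index, Finset.prod_mul_distrib, map_prod, mul_comm]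
      rfl
    rw [this, MvPolynomial.coeff_smul, MvPolynomial.coeff_monomial]
    split_ifs <;> simp
  · simp [hE]

/-- key for the tableau order -/
def lexKey {h N s : ℕ} (ω : (Fin h × Fin 2 ≃ Fin N) × (Fin h → Fin s)) (i : Fin h) :
    Fin s ×ₗ Fin N := toLex (ω.2 i, ω.1 (i, 0))

/-- relabelling pairs -/
def act {h N s : ℕ} (σ : Equiv.Perm (Fin h))
    (ω : (Fin h × Fin 2 ≃ Fin N) × (Fin h → Fin s)) :
    (Fin h × Fin 2 ≃ Fin N) × (Fin h → Fin s) :=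
  ((Equiv.prodCongrLeft (fun _ => σ)).trans ω.1, ω.2 ∘ σ)

lemma lexKey_inj {h N s : ℕ} (ω : (Fin h × Fin 2 ≃ Fin N) × (Fin h → Fin s)) :
    Function.Injective (lexKey ω) := by
  intro i j hij
  have h1 := congrArg (fun x => (ofLex x).2) hij
  simp only [lexKey, ofLex_toLex] at h1
  simpa using ω.1.injective h1

lemma pfLin_eq_lex {R : Type*} [CommRing R] {h N s : ℕ} (hN : h * 2 = N) (k : Fin s → ℕ)
    (M : Fin s → Matrix (Fin N) (Fin N) R) :
    pfLin k M = ∑ ω : (Fin h × Fin 2 ≃ Fin N) × (Fin h → Fin s) with StrictMono (lexKey ω),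
      if ∑ i, Finsupp.single (ω.2 i) 1 = Finsupp.equivFunOnFinite.symm k then
        sg hN ω.1 • ∏ i, M (ω.2 i) (ω.1 (i, 0)) (ω.1 (i, 1)) else 0 := by
  classical
  rw [pfLin_eq hN]
  refine orbit_sum act ?_ _ ?_ _ _ ?_ ?_
  · rintro σ ⟨E, f⟩
    refine Prod.ext ?_ ?_
    · ext ⟨a, b⟩; simp [act]
    · funext x; simp [act]
  · rintro σ ⟨E, f⟩
    have h1 : ∑ i, Finsupp.single ((f ∘ σ) i) (1 : ℕ) = ∑ i, Finsupp.single (f i) 1 :=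
      Equiv.sum_comp σ (fun i => Finsupp.single (f i) (1 : ℕ))
    have h2 := Equiv.prod_comp σ (fun i => M (f i) (E (i, 0)) (E (i, 1)))
    simp only [act, h1, sg_perm]
    rw [← h2]
    rfl
  · rintro ⟨E, f⟩
    exact sort_unique _ (minKey_inj E)
  · rintro ⟨E, f⟩
    exact sort_unique _ (lexKey_inj (E, f))

/-! ### cells -/

/-- numbering of cells -/
def vEq {m : ℕ} (n : Fin m → ℕ) : TabCell n ≃ Fin (∑ i, n i) := finSigmaFinEquiv

lemma vEq_val {m : ℕ} (n : Fin m → ℕ) (c : TabCell n) :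
    (vEq n c : ℕ) = offset n c.1 + c.2 := by
  unfold vEq offset
  rw [finSigmaFinEquiv_apply]
  congr 1
  symm
  refine Finset.sum_bij' (fun i hi => (⟨i, by simpa using hi⟩ : Fin c.1))
    (fun i _ => Fin.castLE c.1.2.le i) ?_ ?_ ?_ ?_ ?_
  · simp
  · intro i _
    simp only [Finset.mem_filter, Finset.mem_univ, true_and]
    exact i.2
  · simp
  · simp
  · intro i _
    rfl

lemma vEq_range {m : ℕ} (n : Fin m → ℕ) (c : TabCell n) (p : Fin m) :
    (offset n p ≤ (vEq n c : ℕ) ∧ (vEq n c : ℕ) < offset n p + n p) ↔ c.1 = p := by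
  constructor
  · rintro ⟨h1, h2⟩
    have : vEq n c = vEq n ⟨p, ⟨(vEq n c : ℕ) - offset n p, by omega⟩⟩ := by
      ext
      rw [vEq_val n ⟨p, _⟩]
      simp only
      omega
    rw [(vEq n).injective this]
  · rintro rfl
    rw [vEq_val]
    omega

lemma blockEmb_vEq {A : Type} [CommRing A] {m : ℕ} (n : Fin m → ℕ) (p q : Fin m)
    (X : Matrix (Fin (n p)) (Fin (n q)) A) (c d : TabCell n) :
    blockEmb n p q X (vEq n c) (vEq n d) =
      if c.1 = p ∧ d.1 = q then TabSub.castEntry X c.2 d.2 else 0 := by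
  unfold blockEmb
  rw [Matrix.of_apply]
  by_cases h : c.1 = p ∧ d.1 = q
  · rw [if_pos h]
    obtain ⟨h1, h2⟩ := h
    have h1' := (vEq_range n c p).2 h1
    have h2' := (vEq_range n d q).2 h2
    rw [dif_pos ⟨h1'.1, h1'.2, h2'.1, h2'.2⟩]
    unfold TabSub.castEntry
    subst h1 h2
    rw [dif_pos ⟨c.2.2, d.2.2⟩]
    congr 1
    · ext; simp [vEq_val]
    · ext; simp [vEq_val]
  · rw [if_neg h, dif_neg]
    rintro ⟨h1, h2, h3, h4⟩
    exact h ⟨(vEq_range n c p).1 ⟨h1, h2⟩, (vEq_range n d q).1 ⟨h3, h4⟩⟩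

/-- The tableau attached to a labelled oriented matching of cells. -/
def mkTab {A : Type} [CommRing A] {m s h : ℕ} {n : Fin m → ℕ}
    (p q : Fin s → Fin m) (X : ∀ j : Fin s, Matrix (Fin (n (p j))) (Fin (n (q j))) A)
    (e : Fin h × Fin 2 ≃ TabCell n) (f : Fin h → Fin s)
    (hp : ∀ i, (e (i, 0)).1 = p (f i)) (hq : ∀ i, (e (i, 1)).1 = q (f i))
    (hf : ∀ j, ∃ i, f i = j) : TabSub A (Fin m) n s where
  mate := (e.symm.trans (Equiv.prodCongrRight (fun _ => Equiv.swap 0 1))).trans e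
  isTail c := decide ((e.symm c).2 = 0)
  lab c := f (e.symm c).1
  colTail := p
  colHead := q
  X := X
  mate_ne c hc := by
    obtain ⟨⟨i, b⟩, rfl⟩ := e.surjective c
    have := e.injective hc
    simp at this
    revert this
    fin_cases b <;> decide
  mate_invol c := by
    obtain ⟨⟨i, b⟩, rfl⟩ := e.surjective c
    simp
  isTail_mate c := by
    obtain ⟨⟨i, b⟩, rfl⟩ := e.surjective c
    fin_cases b <;> simp
  lab_mate c := by
    obtain ⟨⟨i, b⟩, rfl⟩ := e.surjective c
    simp
  lab_surj j := by
    obtain ⟨i, hi⟩ := hf j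
    exact ⟨e (i, 0), by simp, by simp [hi]⟩
  colTail_eq c hc := by
    obtain ⟨⟨i, b⟩, rfl⟩ := e.surjective c
    simp at hc
    subst hc
    simp [hp]
  colHead_eq c hc := by
    obtain ⟨⟨i, b⟩, rfl⟩ := e.surjective c
    simp at hc
    subst hc
    simp [hq]


lemma cnt_iff {h s : ℕ} (f : Fin h → Fin s) (k : Fin s → ℕ) :
    (∑ i, Finsupp.single (f i) 1 = Finsupp.equivFunOnFinite.symm k) ↔
      ∀ j, Fintype.card {i // f i = j} = k j := by
  classical
  rw [Finsupp.ext_iff]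
  refine forall_congr' fun j => ?_
  rw [Finsupp.finsetSum_apply]
  simp only [Finsupp.single_apply, Finset.sum_boole, Finsupp.equivFunOnFinite_symm_apply_apply,
    Fintype.card_subtype]
  simp

lemma lexKey_mono {h N s : ℕ} {ω : (Fin h × Fin 2 ≃ Fin N) × (Fin h → Fin s)}
    (hω : StrictMono (lexKey ω)) : Monotone ω.2 := by
  intro i j hij
  rcases hij.lt_or_eq with h1 | rfl
  · rcases Prod.Lex.lt_iff.1 (hω h1) with h2 | h2
    · exact h2.le
    · exact h2.1.le
  · exact le_rfl

lemma mono_cnt_unique {h s : ℕ} (f g : Fin h → Fin s) (hf : Monotone f) (hg : Monotone g)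
    (hc : ∀ j, Fintype.card {i // f i = j} = Fintype.card {i // g i = j}) : f = g := by
  let σ : Equiv.Perm (Fin h) := Equiv.ofFiberEquiv (f := f) (g := g)
    (fun j => Fintype.equivOfCardEq (hc j))
  have h1 : g ∘ σ = f := funext fun i => Equiv.ofFiberEquiv_map _ i
  have h2 := Tuple.unique_monotone (f := g) (σ := σ) (τ := Equiv.refl _)
    (by rw [h1]; exact hf) hg
  rw [h1] at h2
  exact h2

lemma exists_sigma {m : ℕ} {n : Fin m → ℕ} (Q : Equiv.Perm (TabCell n))
    (hQ : ∀ c, (Q c).1 = c.1) :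
    ∃ π : ∀ i, Equiv.Perm (Fin (n i)), Equiv.Perm.sigmaCongrRight π = Q := by
  have h1 : ∀ i (j : Fin (n i)), ∃ j', Q ⟨i, j⟩ = ⟨i, j'⟩ := by
    intro i j
    have := hQ ⟨i, j⟩
    rcases hq : Q ⟨i, j⟩ with ⟨a, b⟩
    rw [hq] at this
    simp only at this
    subst this
    exact ⟨b, rfl⟩
  choose g hg using h1
  have hinj : ∀ i, Function.Injective (g i) := by
    intro i a b hab
    have : Q ⟨i, a⟩ = Q ⟨i, b⟩ := by rw [hg, hg, hab]
    simpa using Q.injective this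
  refine ⟨fun i => Equiv.ofBijective (g i) (Finite.injective_iff_bijective.1 (hinj i)), ?_⟩
  ext ⟨i, j⟩ : 1
  rw [hg]
  rfl

lemma vEq_lt {m : ℕ} (n : Fin m → ℕ) (c d : TabCell n) (h : c.1 = d.1) :
    vEq n c < vEq n d ↔ (c.2 : ℕ) < (d.2 : ℕ) := by
  rw [Fin.lt_def, vEq_val, vEq_val]
  have h2 : offset n c.1 = offset n d.1 := congrArg _ h
  omega

lemma sg_sigma {h m : ℕ} {n : Fin m → ℕ} (hN : h * 2 = ∑ i, n i)
    (e : Fin h × Fin 2 ≃ TabCell n) (π : ∀ i, Equiv.Perm (Fin (n i))) :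
    sg hN ((e.trans (Equiv.Perm.sigmaCongrRight π)).trans (vEq n)) =
      sg hN (e.trans (vEq n)) * TabSub.sgnT π := by
  unfold sg TabSub.sgnT
  have : (uEq hN).symm.trans ((e.trans (Equiv.Perm.sigmaCongrRight π)).trans (vEq n)) =
      (((vEq n).symm.trans (Equiv.Perm.sigmaCongrRight π)).trans (vEq n)) *
      ((uEq hN).symm.trans (e.trans (vEq n)))
       := by
    ext x; simp
  rw [this, Equiv.Perm.sign_mul, Equiv.Perm.sign_symm_trans_trans, sign_sigma]
  simp [mul_comm]

section tab

variable {A : Type} [CommRing A] {m s h : ℕ} {n : Fin m → ℕ}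
    (p q : Fin s → Fin m) (X : ∀ j : Fin s, Matrix (Fin (n (p j))) (Fin (n (q j))) A)
    (e : Fin h × Fin 2 ≃ TabCell n) (f : Fin h → Fin s)
    (hp : ∀ i, (e (i, 0)).1 = p (f i)) (hq : ∀ i, (e (i, 1)).1 = q (f i))
    (hf : ∀ j, ∃ i, f i = j)

lemma mem_tails (c : TabCell n) :
    c ∈ (mkTab p q X e f hp hq hf).tails ↔ ∃ i, c = e (i, 0) := by
  unfold TabSub.tails
  obtain ⟨⟨i, b⟩, rfl⟩ := e.surjective c
  simp only [Finset.mem_filter, Finset.mem_univ, true_and, mkTab]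
  simp

lemma mk_prod (π : ∀ i, Equiv.Perm (Fin (n i))) :
    ∏ c ∈ (mkTab p q X e f hp hq hf).tails, (mkTab p q X e f hp hq hf).entry π c =
    ∏ i, blockEmb n (p (f i)) (q (f i)) (X (f i))
      (vEq n (Equiv.Perm.sigmaCongrRight π (e (i, 0))))
      (vEq n (Equiv.Perm.sigmaCongrRight π (e (i, 1)))) := by
  symm
  refine Finset.prod_bij (fun i _ => e (i, 0)) ?_ ?_ ?_ ?_
  · intro i _
    rw [mem_tails]
    exact ⟨i, rfl⟩
  · intro i _ j _ hij
    simpa using e.injective hij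
  · intro c hc
    obtain ⟨i, rfl⟩ := (mem_tails p q X e f hp hq hf c).1 hc
    exact ⟨i, Finset.mem_univ _, rfl⟩
  · intro i _
    rw [blockEmb_vEq, if_pos ⟨by simpa using hp i, by simpa using hq i⟩]
    have h1 : ∀ (j j' : Fin s) (a b : ℕ), j = j' →
        TabSub.castEntry (X j) a b = TabSub.castEntry (X j') a b := by
      rintro j _ a b rfl; rfl
    have h2 : (mkTab p q X e f hp hq hf).mate (e (i, 0)) = e (i, 1) := by
      simp [mkTab]
    have h3 : (mkTab p q X e f hp hq hf).lab (e (i, 0)) = f i := by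
      simp [mkTab]
    unfold TabSub.entry
    rw [h2]
    exact h1 _ _ _ _ h3.symm

lemma sorted_iff (hlex : StrictMono (lexKey (e.trans (vEq n), f)))
    (π : ∀ i, Equiv.Perm (Fin (n i))) :
    (mkTab p q X e f hp hq hf).SortedPi π ↔
      StrictMono (lexKey ((e.trans (Equiv.Perm.sigmaCongrRight π)).trans (vEq n), f)) := by
  have hlt : ∀ i j, f i = f j →
      (i < j ↔ ((e (i, 0)).2 : ℕ) < ((e (j, 0)).2 : ℕ)) := by
    intro i j hij
    rw [← hlex.lt_iff_lt, ← vEq_lt n _ _ (by rw [hp, hp, hij])]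
    rw [lexKey, lexKey, Prod.Lex.lt_iff]
    simp [hij]
  have hlt2 : ∀ i j, f i = f j →
      (vEq n (Equiv.Perm.sigmaCongrRight π (e (i, 0))) <
        vEq n (Equiv.Perm.sigmaCongrRight π (e (j, 0))) ↔
       ((π _ (e (i, 0)).2 : Fin _) : ℕ) < ((π _ (e (j, 0)).2 : Fin _) : ℕ)) := by
    intro i j hij
    exact vEq_lt n _ _ (by simp [hp, hij])
  have hlab : ∀ i, (mkTab p q X e f hp hq hf).lab (e (i, 0)) = f i := by
    intro i; simp [mkTab]
  constructor
  · intro hs i j hij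
    rw [lexKey, lexKey, Prod.Lex.lt_iff]
    rcases (lexKey_mono hlex hij.le).lt_or_eq with h1 | h1
    · left; exact h1
    · right
      refine ⟨h1, ?_⟩
      refine (hlt2 i j h1).2 ?_
      refine hs _ ((mem_tails p q X e f hp hq hf _).2 ⟨i, rfl⟩) _
        ((mem_tails p q X e f hp hq hf _).2 ⟨j, rfl⟩) ?_ ((hlt i j h1).1 hij)
      rw [hlab, hlab]; exact h1
  · intro hm c hc d hd hcd hlt'
    obtain ⟨i, rfl⟩ := (mem_tails p q X e f hp hq hf c).1 hc
    obtain ⟨j, rfl⟩ := (mem_tails p q X e f hp hq hf d).1 hd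
    rw [hlab, hlab] at hcd
    have h1 := hm ((hlt i j hcd).2 hlt')
    rw [lexKey, lexKey, Prod.Lex.lt_iff] at h1
    rw [← hlt2 i j hcd]
    rcases h1 with h1 | h1
    · exact absurd hcd h1.ne
    · exact h1.2

lemma bpf_eq (hN : h * 2 = ∑ i, n i) (hlex : StrictMono (lexKey (e.trans (vEq n), f)))
    (k : Fin s → ℕ) (hk : ∀ j, Fintype.card {i // f i = j} = k j) :
    sg hN (e.trans (vEq n)) • (mkTab p q X e f hp hq hf).bpf =
      pfLin k (fun j => blockEmb n (p j) (q j) (X j)) := by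
  classical
  rw [pfLin_eq_lex hN]
  unfold TabSub.bpf
  rw [Finset.smul_sum]
  refine Finset.sum_of_injOn
    (fun π => ((e.trans (Equiv.Perm.sigmaCongrRight π)).trans (vEq n), f)) ?_ ?_ ?_ ?_
  · intro π _ π' _ hππ
    have h1 := congrArg Prod.fst hππ
    simp only at h1
    apply Equiv.Perm.sigmaCongrRightHom_injective
    ext c : 1
    obtain ⟨x, rfl⟩ := e.surjective c
    exact (vEq n).injective (DFunLike.congr_fun h1 x)
  · intro π hπ
    simp only [Finset.coe_filter, Finset.mem_univ, true_and, Set.mem_ofPred_eq] at hπ ⊢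
    exact (sorted_iff p q X e f hp hq hf hlex π).1 hπ
  · rintro ⟨E, f'⟩ hω hnot
    simp only [Finset.mem_filter, Finset.mem_univ, true_and] at hω
    by_contra hne
    apply hnot
    rw [ite_eq_right_iff, Classical.not_imp] at hne
    obtain ⟨hc, hne⟩ := hne
    rw [cnt_iff] at hc
    simp only at hc
    have hff : f' = f := mono_cnt_unique _ _ (lexKey_mono hω) (lexKey_mono hlex)
      (fun j => by rw [hc, hk])
    subst hff
    have hcol : ∀ i, ((vEq n).symm (E (i, 0))).1 = p (f' i) ∧
        ((vEq n).symm (E (i, 1))).1 = q (f' i) := by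
      intro i
      by_contra hi
      apply hne
      rw [Finset.prod_eq_zero (Finset.mem_univ i), smul_zero]
      have := blockEmb_vEq n (p (f' i)) (q (f' i)) (X (f' i)) ((vEq n).symm (E (i, 0)))
        ((vEq n).symm (E (i, 1)))
      rw [if_neg hi] at this
      simpa using this
    obtain ⟨π, hπ⟩ := exists_sigma (e.symm.trans (E.trans (vEq n).symm)) (by
      intro c
      obtain ⟨⟨i, b⟩, rfl⟩ := e.surjective c
      fin_cases b
      · simpa [hp] using (hcol i).1
      · simpa [hq] using (hcol i).2)
    have hE : (e.trans (Equiv.Perm.sigmaCongrRight π)).trans (vEq n) = E := by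
      rw [hπ]; ext x; simp
    refine ⟨π, ?_, by simp only [hE]⟩
    simp only [Finset.coe_filter, Finset.mem_univ, true_and, Set.mem_ofPred_eq]
    rw [sorted_iff p q X e f' hp hq hf hlex, hE]
    exact hω
  · intro π _
    rw [if_pos ((cnt_iff _ _).2 hk), mk_prod, sg_sigma, mul_smul]
    rfl

end tab

lemma exists_init {m s h : ℕ} {n : Fin m → ℕ} (p q : Fin s → Fin m) (k : Fin s → ℕ)
    (hsum : ∑ j, k j = h)
    (hcond : ∀ i : Fin m,
      (∑ j ∈ Finset.univ.filter fun j => p j = i, k j) +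
      (∑ j ∈ Finset.univ.filter fun j => q j = i, k j) = n i) :
    ∃ (e : Fin h × Fin 2 ≃ TabCell n) (f : Fin h → Fin s),
      (∀ i, (e (i, 0)).1 = p (f i)) ∧ (∀ i, (e (i, 1)).1 = q (f i)) ∧
      (∀ j, Fintype.card {i // f i = j} = k j) := by
  classical
  let w : Fin h ≃ Σ j : Fin s, Fin (k j) := Fintype.equivOfCardEq (by simp [hsum])
  let f : Fin h → Fin s := fun i => (w i).1
  have hf : ∀ j, Fintype.card {i // f i = j} = k j := by
    intro j
    rw [← Fintype.card_fin (k j)]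
    refine Fintype.card_congr ((w.subtypeEquiv (q := fun x => x.1 = j) (fun i => Iff.rfl)).trans
      (Equiv.sigmaSubtype j))
  let col : Fin h × Fin 2 → Fin m := fun x => if x.2 = 0 then p (f x.1) else q (f x.1)
  have hcnt : ∀ (r : Fin s → Fin m) (c : Fin m),
      ∑ i : Fin h, (if r (f i) = c then 1 else 0) = ∑ j with r j = c, k j := by
    intro r c
    rw [Finset.sum_filter, ← Equiv.sum_comp w.symm, Fintype.sum_sigma]
    refine Finset.sum_congr rfl fun j _ => ?_
    simp [f]
  have hcol : ∀ c, Fintype.card {x // col x = c} = Fintype.card {d : TabCell n // d.1 = c} := by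
    intro c
    have h1 : Fintype.card {d : TabCell n // d.1 = c} = n c := by
      rw [← Fintype.card_fin (n c)]
      exact Fintype.card_congr (Equiv.sigmaSubtype c)
    rw [h1, ← hcond c, ← hcnt p c, ← hcnt q c, Fintype.card_subtype, Finset.card_filter,
      Fintype.sum_prod_type, ← Finset.sum_add_distrib]
    refine Finset.sum_congr rfl fun i _ => ?_
    rw [Fin.sum_univ_two]
    simp [col]
  let e : Fin h × Fin 2 ≃ TabCell n := Equiv.ofFiberEquiv (f := col) (g := fun d => d.1)
    (fun c => Fintype.equivOfCardEq (hcol c))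
  have he : ∀ x, (e x).1 = col x := fun x =>
    Equiv.ofFiberEquiv_map (f := col) (g := fun d : TabCell n => d.1) _ x
  exact ⟨e, f, fun i => by rw [he]; simp [col], fun i => by rw [he]; simp [col], hf⟩

end StmtTen

open TabSub in
/-- For any data defining a block partial linearization of the pfaffian satisfying the
column condition, there is a tableau with substitution computing it up to sign. -/
theorem stmt10 (K : Type) [Field K] [Infinite K] (A : Type) [CommRing A] [Algebra K A]
    (m s : ℕ) (n : Fin m → ℕ) (hEven : Even (∑ i, n i))
    (p q : Fin s → Fin m) (X : ∀ j : Fin s, Matrix (Fin (n (p j))) (Fin (n (q j))) A)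
    (k : Fin s → ℕ) (hk : ∀ j, 0 < k j) (hsum : ∑ j, k j = (∑ i, n i) / 2)
    (hcond : ∀ i : Fin m,
      (∑ j ∈ Finset.univ.filter fun j => p j = i, k j) +
      (∑ j ∈ Finset.univ.filter fun j => q j = i, k j) = n i) :
    ∃ T : TabSub A (Fin m) n s, T.colTail = p ∧ T.colHead = q ∧ HEq T.X X ∧
      (T.bpf = pfLin k (fun j => blockEmb n (p j) (q j) (X j)) ∨
       T.bpf = -pfLin k (fun j => blockEmb n (p j) (q j) (X j))) := by
  obtain ⟨h, hh⟩ : ∃ h, h = (∑ i, n i) / 2 := ⟨_, rfl⟩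
  have hN : h * 2 = ∑ i, n i := by
    rw [hh]; exact Nat.div_mul_cancel hEven.two_dvd
  rw [← hh] at hsum
  obtain ⟨e0, f0, hp0, hq0, hc0⟩ := StmtTen.exists_init (n := n) p q k hsum (by
    intro i; convert hcond i)
  obtain ⟨σ, hσ, -⟩ := StmtTen.sort_unique _
    (StmtTen.lexKey_inj (e0.trans (StmtTen.vEq n), f0))
  let e : Fin h × Fin 2 ≃ TabCell n := (Equiv.prodCongrLeft (fun _ => σ)).trans e0
  let f : Fin h → Fin s := f0 ∘ σ
  have hp : ∀ i, (e (i, 0)).1 = p (f i) := fun i => hp0 (σ i)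
  have hq : ∀ i, (e (i, 1)).1 = q (f i) := fun i => hq0 (σ i)
  have hc : ∀ j, Fintype.card {i // f i = j} = k j := by
    intro j
    rw [← hc0 j]
    exact Fintype.card_congr (σ.subtypeEquiv (fun i => Iff.rfl))
  have hf : ∀ j, ∃ i, f i = j := by
    intro j
    have : 0 < Fintype.card {i // f i = j} := by rw [hc]; exact hk j
    obtain ⟨x⟩ := Fintype.card_pos_iff.1 this
    exact ⟨x.1, x.2⟩
  have hlex : StrictMono (StmtTen.lexKey (e.trans (StmtTen.vEq n), f)) := hσ
  have key := StmtTen.bpf_eq p q X e f hp hq hf hN hlex k hc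
  refine ⟨StmtTen.mkTab p q X e f hp hq hf, rfl, rfl, HEq.rfl, ?_⟩
  rw [← key]
  rcases Int.units_eq_one_or
    (Equiv.Perm.sign ((StmtTen.uEq hN).symm.trans (e.trans (StmtTen.vEq n)))) with h1 | h1
  · left
    simp [StmtTen.sg, h1]
  · right
    simp [StmtTen.sg, h1]
end
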